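/- arXiv:1812.04979 — 5 statements merged into one kernel-verified Lean document; each statement's English description precedes it below -/
import Mathlib

section
/- Let A = ⊕_{i∈ℤ} A_i be a ℤ-graded integral domain which is finitely generated as an A_0-algebra, let ω ∈ ℤ, let F ∈ A_ω be nonzero, let c be a positive integer with gcd(c, ω) = 1, and set B = A[Z]/(Z^c − F) where A[Z] is a polynomial ring in one variable over A. Then B is an integral domain, and the fraction field of A is isomorphic to the fraction field of B as extensions of K = frac(A_0) (i.e., frac(A) ≅_K frac(B)). -/
set_option synthInstance.maxHeartbeats 1000000
set_option maxHeartbeats 1000000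

/-- `x` is a homogeneous element of degree `i` in the localization of the graded domain `A` at
its nonzero homogeneous elements. -/
def IsHomogeneousFraction {A : Type*} [CommRing A] [IsDomain A] (𝒜 : ℤ → AddSubgroup A)
    (i : ℤ) (x : FractionRing A) : Prop :=
  ∃ j, ∃ a ∈ 𝒜 (i + j), ∃ b ∈ 𝒜 j, b ≠ 0 ∧
    x * algebraMap A (FractionRing A) b = algebraMap A (FractionRing A) a

namespace IsHomogeneousFraction

variable {A : Type*} [CommRing A] [IsDomain A] {𝒜 : ℤ → AddSubgroup A}
  {i j : ℤ} {x y : FractionRing A}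

theorem inv (hx : IsHomogeneousFraction 𝒜 i x) (hx0 : x ≠ 0) :
    IsHomogeneousFraction 𝒜 (-i) x⁻¹ := by
  obtain ⟨k, a, ha, b, hb, hb0, hab⟩ := hx
  refine ⟨i + k, b, by simpa using hb, a, ha, ?_, ?_⟩
  · rintro rfl
    simp_all
  · rw [← hab, inv_mul_cancel_left₀ hx0]

variable [GradedRing 𝒜]

theorem of_mem {a : A} (ha : a ∈ 𝒜 i) :
    IsHomogeneousFraction 𝒜 i (algebraMap A (FractionRing A) a) :=
  ⟨0, a, by simpa using ha, 1, SetLike.GradedOne.one_mem, one_ne_zero, by simp⟩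

theorem one : IsHomogeneousFraction 𝒜 0 1 := by
  simpa using of_mem (SetLike.GradedOne.one_mem (A := 𝒜))

theorem mul (hx : IsHomogeneousFraction 𝒜 i x) (hy : IsHomogeneousFraction 𝒜 j y) :
    IsHomogeneousFraction 𝒜 (i + j) (x * y) := by
  obtain ⟨k, a, ha, b, hb, hb0, hab⟩ := hx
  obtain ⟨l, a', ha', b', hb', hb0', hab'⟩ := hy
  refine ⟨k + l, a * a', ?_, b * b', SetLike.GradedMul.mul_mem hb hb', mul_ne_zero hb0 hb0', ?_⟩
  · rw [add_add_add_comm]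
    exact SetLike.GradedMul.mul_mem ha ha'
  · rw [map_mul, map_mul, ← hab, ← hab']
    ring

theorem pow (hx : IsHomogeneousFraction 𝒜 i x) (n : ℕ) :
    IsHomogeneousFraction 𝒜 (n * i) (x ^ n) := by
  induction n with
  | zero => simpa using one
  | succ n ih =>
    rw [pow_succ, Nat.cast_succ, add_mul, one_mul]
    exact ih.mul hx

theorem zpow (hx : IsHomogeneousFraction 𝒜 i x) (hx0 : x ≠ 0) (n : ℤ) :
    IsHomogeneousFraction 𝒜 (n * i) (x ^ n) := by
  obtain ⟨n, rfl | rfl⟩ := n.eq_nat_or_neg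
  · simpa using hx.pow n
  · simpa using (hx.pow n).inv (pow_ne_zero n hx0)

theorem exists_common_denominator {ι : Type*} (s : Finset ι) (g : ι → ℤ)
    (x : ι → FractionRing A) (hx : ∀ n ∈ s, IsHomogeneousFraction 𝒜 (g n) (x n)) :
    ∃ k, ∃ b ∈ 𝒜 k, b ≠ 0 ∧ ∀ n ∈ s, ∃ a ∈ 𝒜 (g n + k),
      x n * algebraMap A (FractionRing A) b = algebraMap A (FractionRing A) a := by
  classical
  induction s using Finset.induction_on with
  | empty => exact ⟨0, 1, SetLike.GradedOne.one_mem, one_ne_zero, by simp⟩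
  | insert n s _ ih =>
    obtain ⟨k, b, hb, hb0, h⟩ := ih fun n hn => hx n (Finset.mem_insert_of_mem hn)
    obtain ⟨l, a', ha', b', hb', hb0', hab'⟩ := hx n (Finset.mem_insert_self _ _)
    refine ⟨k + l, b * b', SetLike.GradedMul.mul_mem hb hb', mul_ne_zero hb0 hb0', ?_⟩
    intro n' hn'
    rcases Finset.mem_insert.mp hn' with rfl | hn'
    · refine ⟨a' * b, ?_, ?_⟩
      · rw [add_comm k, ← add_assoc]
        exact SetLike.GradedMul.mul_mem ha' hb
      · rw [map_mul, map_mul, ← hab']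
        ring
    · obtain ⟨a, ha, hab⟩ := h n' hn'
      refine ⟨a * b', ?_, ?_⟩
      · rw [← add_assoc]
        exact SetLike.GradedMul.mul_mem ha hb'
      · rw [map_mul, map_mul, ← hab]
        ring

/-- Homogeneous fractions of pairwise distinct degrees are independent. -/
theorem eq_zero_of_sum_eq_zero {ι : Type*} (s : Finset ι) (g : ι → ℤ)
    (x : ι → FractionRing A) (hx : ∀ n ∈ s, IsHomogeneousFraction 𝒜 (g n) (x n))
    (hg : Set.InjOn g s) (hsum : ∑ n ∈ s, x n = 0) : ∀ n ∈ s, x n = 0 := by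
  classical
  obtain ⟨k, b, hb, hb0, h⟩ := exists_common_denominator s g x hx
  choose! a ha hab using h
  have hinj := IsFractionRing.injective A (FractionRing A)
  have hasum : ∑ n ∈ s, a n = 0 := by
    apply hinj
    rw [map_sum, map_zero, ← Finset.sum_congr rfl hab, ← Finset.sum_mul, hsum, zero_mul]
  intro n hn
  have hcomp : (DirectSum.decompose 𝒜 (∑ n ∈ s, a n) (g n + k) : A) = a n := by
    rw [DirectSum.decompose_sum, DFinsupp.finsetSum_apply, AddSubmonoidClass.coe_finsetSum,
      Finset.sum_eq_single_of_mem n hn]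
    · exact DirectSum.decompose_of_mem_same 𝒜 (ha n hn)
    · intro n' hn' hne
      refine DirectSum.decompose_of_mem_ne 𝒜 (ha n' hn') fun h => hne (hg hn' hn ?_)
      exact add_right_cancel h
  have han : a n = 0 := by simpa [hasum] using hcomp.symm
  have := hab n hn
  rw [han, map_zero] at this
  exact (mul_eq_zero.mp this).resolve_right fun h => hb0 (hinj (by simpa using h))

variable (𝒜) in
/-- The group of degrees of nonzero homogeneous fractions. -/
def degrees : AddSubgroup ℤ where
  carrier := {i | ∃ x : FractionRing A, x ≠ 0 ∧ IsHomogeneousFraction 𝒜 i x}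
  zero_mem' := ⟨1, one_ne_zero, one⟩
  add_mem' := by
    rintro i j ⟨x, hx0, hx⟩ ⟨y, hy0, hy⟩
    exact ⟨x * y, mul_ne_zero hx0 hy0, hx.mul hy⟩
  neg_mem' := by
    rintro i ⟨x, hx0, hx⟩
    exact ⟨x⁻¹, inv_ne_zero hx0, hx.inv hx0⟩

variable (𝒜) in
theorem exists_generator : ∃ (d : ℤ) (t : FractionRing A), t ≠ 0 ∧ IsHomogeneousFraction 𝒜 d t ∧
    ∀ i x, x ≠ 0 → IsHomogeneousFraction 𝒜 i x → d ∣ i := by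
  obtain ⟨d, hd⟩ := Int.subgroup_cyclic (degrees 𝒜)
  rw [← AddSubgroup.zmultiples_eq_closure] at hd
  have hmem : d ∈ degrees 𝒜 := hd ▸ AddSubgroup.mem_zmultiples d
  obtain ⟨t, ht0, ht⟩ := hmem
  refine ⟨d, t, ht0, ht, fun i x hx0 hx => ?_⟩
  have hi : i ∈ degrees 𝒜 := ⟨x, hx0, hx⟩
  rwa [hd, Int.mem_zmultiples_iff] at hi

end IsHomogeneousFraction

/-- A map out of a graded domain which rescales the degree `i` part by `χ i`, for `χ`
multiplicative on the degrees that occur. -/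
theorem GradedRing.exists_twist {A L : Type*} [CommRing A] [CommRing L]
    (𝒜 : ℤ → AddSubgroup A) [GradedRing 𝒜] (f : A →+* L) (χ : ℤ → L) (h0 : χ 0 = 1)
    (hadd : ∀ i j, ∀ a ∈ 𝒜 i, ∀ b ∈ 𝒜 j, a ≠ 0 → b ≠ 0 → χ (i + j) = χ i * χ j) :
    ∃ φ : A →+* L, ∀ i, ∀ a ∈ 𝒜 i, φ a = f a * χ i := by
  classical
  let g : ∀ i, 𝒜 i →+ L := fun i =>
    (AddMonoidHom.mulRight (χ i)).comp (f.toAddMonoidHom.comp (𝒜 i).subtype)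
  have hg : ∀ i (a : 𝒜 i), g i a = f a * χ i := fun i a => rfl
  refine ⟨(DirectSum.toSemiring g ?_ ?_).comp
    (DirectSum.decomposeRingEquiv 𝒜 : A →+* DirectSum ℤ fun i => 𝒜 i), fun i a ha => ?_⟩
  · simp [hg, h0]
  · intro i j a b
    rw [hg, hg, hg, SetLike.coe_gMul, map_mul]
    by_cases ha : (a : A) = 0
    · simp [ha]
    by_cases hb : (b : A) = 0
    · simp [hb]
    rw [hadd i j a a.2 b b.2 ha hb]
    ring
  · have : DirectSum.decomposeRingEquiv 𝒜 a = DirectSum.of (fun i => 𝒜 i) i ⟨a, ha⟩ :=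
      DirectSum.decompose_of_mem 𝒜 ha
    rw [RingHom.comp_apply, RingHom.coe_coe, this, DirectSum.toSemiring_of, hg]

open Polynomial in
/-- A ring map `A[X] → L` to a field which kills `X ^ c - F`, is injective on polynomials of
degree less than `c`, and whose image generates `L`, realizes `L` as the fraction field of
`A[X] / (X ^ c - F)`. -/
theorem isDomain_and_exists_ringEquiv_fractionRing_of_eval₂ {A L : Type*} [CommRing A] [IsDomain A]
    [Field L] (F : A) (c : ℕ) (hc : 0 < c) (φ : A →+* L) (ζ : L) (hζ : ζ ^ c = φ F)
    (hinj : ∀ r : A[X], r.natDegree < c → eval₂ φ ζ r = 0 → r = 0)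
    (hgen : Subfield.closure (Set.range (eval₂RingHom φ ζ)) = ⊤) :
    IsDomain (A[X] ⧸ Ideal.span {X ^ c - C F}) ∧
      ∃ e : L ≃+* FractionRing (A[X] ⧸ Ideal.span {X ^ c - C F}),
        ∀ a, e (φ a) = algebraMap (A[X] ⧸ Ideal.span {X ^ c - C F})
          (FractionRing (A[X] ⧸ Ideal.span {X ^ c - C F}))
          (Ideal.Quotient.mk (Ideal.span {X ^ c - C F}) (C a)) := by
  have hq : (X ^ c - C F).Monic := monic_X_pow_sub_C F hc.ne'
  have hq0 : eval₂RingHom φ ζ (X ^ c - C F) = 0 := by simp [hζ]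
  have hle : ∀ p ∈ Ideal.span {X ^ c - C F}, eval₂RingHom φ ζ p = 0 := by
    intro p hp
    obtain ⟨s, rfl⟩ := Ideal.mem_span_singleton'.mp hp
    rw [map_mul, hq0, mul_zero]
  let Ψ : (A[X] ⧸ Ideal.span {X ^ c - C F}) →+* L := Ideal.Quotient.lift _ _ hle
  have hΨ : ∀ p, Ψ (Ideal.Quotient.mk _ p) = eval₂RingHom φ ζ p := fun p =>
    Ideal.Quotient.lift_mk _ _ hle
  have hΨinj : Function.Injective Ψ := by
    rw [injective_iff_map_eq_zero]
    intro b hb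
    obtain ⟨p, rfl⟩ := Ideal.Quotient.mk_surjective b
    rw [hΨ] at hb
    rw [Ideal.Quotient.eq_zero_iff_mem, Ideal.mem_span_singleton, ← modByMonic_eq_zero_iff_dvd hq]
    apply hinj
    · have := natDegree_modByMonic_lt p hq (fun h => hc.ne' (by
        simpa using congrArg natDegree h))
      rwa [natDegree_X_pow_sub_C] at this
    · have := congrArg (eval₂RingHom φ ζ) (modByMonic_add_div p (X ^ c - C F))
      rw [map_add, map_mul, hq0, zero_mul, add_zero, hb] at this
      exact this
  have hdom : IsDomain (A[X] ⧸ Ideal.span {X ^ c - C F}) := hΨinj.isDomain Ψ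
  refine ⟨hdom, ?_⟩
  let _ : Algebra (A[X] ⧸ Ideal.span {X ^ c - C F}) L := Ψ.toAlgebra
  have _ : FaithfulSMul (A[X] ⧸ Ideal.span {X ^ c - C F}) L :=
    (faithfulSMul_iff_algebraMap_injective _ _).mpr hΨinj
  have _ : IsFractionRing (A[X] ⧸ Ideal.span {X ^ c - C F}) L := by
    refine IsFractionRing.of_field _ _ fun z => ?_
    have hz : z ∈ Subfield.closure (Set.range (eval₂RingHom φ ζ)) := hgen ▸ Subfield.mem_top z
    rw [← RingHom.coe_range] at hz
    obtain ⟨x, hx, y, hy, rfl⟩ := Subfield.mem_closure_iff.mp hz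
    rw [Subring.closure_eq] at hx hy
    obtain ⟨x, rfl⟩ := hx
    obtain ⟨y, rfl⟩ := hy
    exact ⟨Ideal.Quotient.mk _ x, Ideal.Quotient.mk _ y, by
      rw [RingHom.algebraMap_toAlgebra, hΨ, hΨ]⟩
  refine ⟨(FractionRing.algEquiv (A[X] ⧸ Ideal.span {X ^ c - C F}) L).symm.toRingEquiv, fun a => ?_⟩
  have : φ a = algebraMap (A[X] ⧸ Ideal.span {X ^ c - C F}) L (Ideal.Quotient.mk _ (C a)) := by
    rw [RingHom.algebraMap_toAlgebra, hΨ]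
    simp
  rw [this]
  exact AlgEquiv.commutes _ _

open Polynomial in
theorem eq_zero_of_eval₂_eq_zero_of_isHomogeneousFraction {A : Type*} [CommRing A] [IsDomain A]
    (𝒜 : ℤ → AddSubgroup A) [GradedRing 𝒜] (ω : ℤ) (c : ℕ) (hc : 0 < c)
    (hgcd : Int.gcd (c : ℤ) ω = 1) (φ : A →+* FractionRing A)
    (hφ : ∀ i, ∀ a ∈ 𝒜 i, IsHomogeneousFraction 𝒜 (c * i) (φ a))
    (hφ0 : ∀ i, ∀ a ∈ 𝒜 i, φ a = 0 → a = 0)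
    (ζ : FractionRing A) (hζ : IsHomogeneousFraction 𝒜 ω ζ) (hζ0 : ζ ≠ 0)
    (r : A[X]) (hr : r.natDegree < c) (h : eval₂ φ ζ r = 0) : r = 0 := by
  classical
  let s : Finset (Σ _ : ℕ, ℤ) :=
    (Finset.range c).sigma fun j => (DirectSum.decompose 𝒜 (r.coeff j)).support
  have hsum : ∑ n ∈ s, φ (DirectSum.decompose 𝒜 (r.coeff n.1) n.2) * ζ ^ n.1 = 0 := by
    rw [eval₂_eq_sum_range' φ hr] at h
    rw [Finset.sum_sigma, ← h]
    refine Finset.sum_congr rfl fun j _ => ?_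
    dsimp only
    rw [← Finset.sum_mul, ← map_sum, DirectSum.sum_support_decompose]
  have key := IsHomogeneousFraction.eq_zero_of_sum_eq_zero (𝒜 := 𝒜) s
    (fun n => c * n.2 + n.1 * ω) _ (fun n _ => (hφ n.2 _ (SetLike.coe_mem _)).mul (hζ.pow n.1))
    ?_ hsum
  · ext j
    rw [coeff_zero]
    rcases lt_or_ge j c with hj | hj
    · rw [← DirectSum.sum_support_decompose 𝒜 (r.coeff j)]
      refine Finset.sum_eq_zero fun i hi => ?_
      have := key ⟨j, i⟩ (Finset.mem_sigma.mpr ⟨Finset.mem_range.mpr hj, hi⟩)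
      exact hφ0 i _ (SetLike.coe_mem _)
        ((mul_eq_zero.mp this).resolve_right (pow_ne_zero _ hζ0))
    · exact coeff_eq_zero_of_natDegree_lt (hr.trans_le hj)
  · rintro ⟨j, i⟩ hn ⟨j', i'⟩ hn' heq
    have hj := Finset.mem_range.mp (Finset.mem_sigma.mp hn).1
    have hj' := Finset.mem_range.mp (Finset.mem_sigma.mp hn').1
    dsimp only at hj hj' heq
    have hdvd : (c : ℤ) ∣ (j - j' : ℤ) := by
      refine (Int.isCoprime_iff_gcd_eq_one.mpr hgcd).dvd_of_dvd_mul_right ⟨i' - i, ?_⟩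
      linear_combination heq
    have hjj : j = j' := by
      have := Int.eq_zero_of_abs_lt_dvd hdvd (by rw [abs_lt]; omega)
      omega
    subst hjj
    have : (c : ℤ) * i = c * i' := by linear_combination heq
    rw [mul_left_cancel₀ (by exact_mod_cast hc.ne') this]

/-- Let `A = ⊕_{i∈ℤ} A_i` be a ℤ-graded integral domain which is finitely
generated as an `A₀`-algebra, let `ω ∈ ℤ`, let `F ∈ A_ω` be nonzero, let `c` be a
positive integer with `gcd(c, ω) = 1`, and set `B = A[Z]/(Z^c − F)`.  Then `B` is an
integral domain and `frac(A) ≅ frac(B)` as extensions of `K = frac(A₀)`, i.e. there is a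
ring isomorphism `frac(A) ≃ frac(B)` compatible with the natural maps from `A₀`. -/
theorem stmt_0 {A : Type*} [CommRing A] [IsDomain A]
    (𝒜 : ℤ → AddSubgroup A) [GradedRing 𝒜]
    (hfg : ∃ s : Finset A, Subring.closure ((𝒜 0 : Set A) ∪ (s : Set A)) = ⊤)
    (ω : ℤ) (F : A) (hF : F ∈ 𝒜 ω) (hF0 : F ≠ 0)
    (c : ℕ) (hc : 0 < c) (hgcd : Int.gcd (c : ℤ) ω = 1) :
    IsDomain (Polynomial A ⧸ Ideal.span {Polynomial.X ^ c - Polynomial.C F}) ∧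
      ∃ e : FractionRing A ≃+*
          FractionRing (Polynomial A ⧸ Ideal.span {Polynomial.X ^ c - Polynomial.C F}),
        ∀ a ∈ 𝒜 0,
          e (algebraMap A (FractionRing A) a) =
            algebraMap (Polynomial A ⧸ Ideal.span {Polynomial.X ^ c - Polynomial.C F})
              (FractionRing (Polynomial A ⧸ Ideal.span {Polynomial.X ^ c - Polynomial.C F}))
              (Ideal.Quotient.mk (Ideal.span {Polynomial.X ^ c - Polynomial.C F})
                (Polynomial.C a)) := by
  obtain ⟨d, t, ht0, ht, hd⟩ := IsHomogeneousFraction.exists_generator 𝒜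
  have hdvd : ∀ i, ∀ a ∈ 𝒜 i, a ≠ 0 → d ∣ i := fun i a ha ha0 =>
    hd i _ (by simpa using ha0) (IsHomogeneousFraction.of_mem ha)
  have hfF : IsHomogeneousFraction 𝒜 ω (algebraMap A (FractionRing A) F) :=
    IsHomogeneousFraction.of_mem hF
  have hf0 : algebraMap A (FractionRing A) F ≠ 0 := by simpa using hF0
  set f := algebraMap A (FractionRing A) F with hf
  obtain ⟨m, hm⟩ := hdvd ω F hF hF0
  obtain ⟨m, hm, hmd⟩ : ∃ m, ω = d * m ∧ ω / d = m :=
    ⟨ω / d, (Int.mul_ediv_cancel' ⟨m, hm⟩).symm, rfl⟩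
  obtain ⟨u, v, huv⟩ : ∃ u v : ℤ, u * c + v * m = 1 := by
    obtain ⟨u, v, huv⟩ := Int.isCoprime_iff_gcd_eq_one.mpr hgcd
    exact ⟨u, v * d, by rw [← huv, hm]; ring⟩
  set h := t ^ (c * (1 - u)) * f ^ (-v) with hh
  have hh0 : h ≠ 0 := mul_ne_zero (zpow_ne_zero _ ht0) (zpow_ne_zero _ hf0)
  have hhdeg : IsHomogeneousFraction 𝒜 (d * (c - 1)) h := by
    convert (ht.zpow ht0 (c * (1 - u))).mul (hfF.zpow hf0 (-v)) using 1
    rw [hm]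
    linear_combination d * huv
  set ζ := f ^ u * t ^ (m * (1 - u)) with hζ
  have hζ0 : ζ ≠ 0 := mul_ne_zero (zpow_ne_zero _ hf0) (zpow_ne_zero _ ht0)
  have hζdeg : IsHomogeneousFraction 𝒜 ω ζ := by
    convert (hfF.zpow hf0 u).mul (ht.zpow ht0 (m * (1 - u))) using 1
    rw [hm]
    ring
  obtain ⟨φ, hφ⟩ := GradedRing.exists_twist 𝒜 (algebraMap A (FractionRing A))
    (fun i => h ^ (i / d)) (by simp) fun i j a ha b hb ha0 hb0 => by
      rw [Int.add_ediv_of_dvd_left (hdvd i a ha ha0), zpow_add₀ hh0]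
  have hφ0 : ∀ i, ∀ a ∈ 𝒜 i, φ a = 0 → a = 0 := fun i a ha h0 => by
    rw [hφ i a ha] at h0
    simpa using (mul_eq_zero.mp h0).resolve_right (zpow_ne_zero _ hh0)
  have hφdeg : ∀ i, ∀ a ∈ 𝒜 i, IsHomogeneousFraction 𝒜 (c * i) (φ a) := fun i a ha => by
    by_cases ha0 : a = 0
    · rw [ha0, map_zero, ← map_zero (algebraMap A (FractionRing A))]
      exact IsHomogeneousFraction.of_mem (zero_mem _)
    rw [hφ i a ha]
    convert (IsHomogeneousFraction.of_mem ha).mul (hhdeg.zpow hh0 (i / d)) using 1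
    linear_combination (1 - (c : ℤ)) * Int.ediv_mul_cancel (hdvd i a ha ha0)
  have hζc : ζ ^ c = φ F := by
    rw [hφ ω F hF, hmd, ← hf, hζ, hh, mul_pow, mul_zpow, ← zpow_natCast, ← zpow_natCast,
      ← zpow_mul, ← zpow_mul, ← zpow_mul, ← zpow_mul, mul_left_comm, ← zpow_one_add₀ hf0, mul_comm]
    congr 2
    · ring
    · linear_combination huv
  have hgen : Subfield.closure (Set.range (Polynomial.eval₂RingHom φ ζ)) = ⊤ := by
    set M := Subfield.closure (Set.range (Polynomial.eval₂RingHom φ ζ)) with hM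
    have hφM : ∀ a, φ a ∈ M := fun a =>
      Subfield.subset_closure ⟨Polynomial.C a, by simp⟩
    have hζM : ζ ∈ M := Subfield.subset_closure ⟨Polynomial.X, by simp⟩
    have htwist : ∀ i x, IsHomogeneousFraction 𝒜 i x → x ≠ 0 → x * h ^ (i / d) ∈ M := by
      rintro i x ⟨j, a, ha, b, hb, hb0, hab⟩ hx0
      have hb0' : algebraMap A (FractionRing A) b ≠ 0 := by simpa using hb0
      have : x * h ^ (i / d) = φ a / φ b := by
        rw [eq_div_iff fun h0 => hb0 (hφ0 j b hb h0), hφ _ a ha, hφ _ b hb, ← hab,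
          Int.add_ediv_of_dvd_right (hdvd j b hb hb0), zpow_add₀ hh0]
        ring
      rw [this]
      exact div_mem (hφM a) (hφM b)
    have htM : t ∈ M := by
      have ht' := htwist d t ht ht0
      rcases eq_or_ne d 0 with hd0 | hd0
      · simpa [hd0] using ht'
      · rw [Int.ediv_self hd0, zpow_one] at ht'
        convert mul_mem (zpow_mem ht' u) (zpow_mem hζM v) using 1
        rw [hζ, hh, mul_zpow, mul_zpow, mul_zpow, ← zpow_mul, ← zpow_mul, ← zpow_mul, ← zpow_mul]
        have hexp : t ^ u * (t ^ (c * (1 - u) * u) * f ^ (-v * u)) *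
            (f ^ (u * v) * t ^ (m * (1 - u) * v)) =
            t ^ (u + c * (1 - u) * u + m * (1 - u) * v) * f ^ (-v * u + u * v) := by
          rw [zpow_add₀ ht0, zpow_add₀ ht0, zpow_add₀ hf0]
          ring
        rw [hexp, show u + c * (1 - u) * u + m * (1 - u) * v = 1 by
          linear_combination (1 - u) * huv, show -v * u + u * v = 0 by ring]
        simp
    have hfM : f ∈ M := by
      have hdeg : IsHomogeneousFraction 𝒜 0 (f * t ^ (-m)) := by
        convert hfF.mul (ht.zpow ht0 (-m)) using 1
        rw [hm]
        ring
      have := htwist _ _ hdeg (mul_ne_zero hf0 (zpow_ne_zero _ ht0))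
      rw [Int.zero_ediv, zpow_zero, mul_one] at this
      simpa [mul_assoc, inv_mul_cancel₀ (zpow_ne_zero m ht0)] using mul_mem this (zpow_mem htM m)
    have hhM : h ∈ M := mul_mem (zpow_mem htM _) (zpow_mem hfM _)
    have hAM : ∀ a, algebraMap A (FractionRing A) a ∈ M := by
      classical
      intro a
      rw [← DirectSum.sum_support_decompose 𝒜 a, map_sum]
      refine sum_mem fun i _ => ?_
      have := hφ i (DirectSum.decompose 𝒜 a i) (SetLike.coe_mem _)
      rw [← mul_inv_eq_iff_eq_mul₀ (zpow_ne_zero _ hh0)] at this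
      rw [← this]
      exact mul_mem (hφM _) (inv_mem (zpow_mem hhM _))
    rw [eq_top_iff]
    intro x _
    obtain ⟨a, b, _, rfl⟩ := IsFractionRing.div_surjective (A := A) x
    exact div_mem (hAM a) (hAM b)
  obtain ⟨hdom, e, he⟩ := isDomain_and_exists_ringEquiv_fractionRing_of_eval₂ F c hc φ ζ hζc
    (eq_zero_of_eval₂_eq_zero_of_isHomogeneousFraction 𝒜 ω c hc hgcd φ hφdeg hφ0 ζ hζdeg hζ0) hgen
  refine ⟨hdom, e, fun a ha => ?_⟩
  rw [← he a, hφ 0 a ha]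
  simp
end

section
/- Let A = ⊕_{i∈ℤ} A_i be a noetherian ℤ-graded integral domain which is finitely generated as an A_0-algebra, let ω ∈ ℤ, let F ∈ A_ω be a nonzero prime element of A, let c be a positive integer with gcd(c, ω) = 1, and set B = A[Z]/(Z^c − F). Then A is a unique factorization domain if and only if B is a unique factorization domain. -/
set_option synthInstance.maxHeartbeats 1000000
set_option maxHeartbeats 1000000

open DirectSum

section Graded

variable {R : Type*} [CommRing R] (𝒜 : ℤ → AddSubgroup R) [GradedRing 𝒜]

/-- `m` and `M` are the smallest and the largest degree of a nonzero homogeneous component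
of `f`. -/
structure HasExtent (f : R) (m M : ℤ) : Prop where
  bot_ne : (decompose 𝒜 f m : R) ≠ 0
  top_ne : (decompose 𝒜 f M : R) ≠ 0
  mem_Icc : ∀ i, (decompose 𝒜 f i : R) ≠ 0 → m ≤ i ∧ i ≤ M

variable {𝒜}

theorem exists_hasExtent {f : R} (hf : f ≠ 0) : ∃ m M, HasExtent 𝒜 f m M := by
  classical
  have hs : (decompose 𝒜 f).support.Nonempty := by
    rw [Finset.nonempty_iff_ne_empty, Ne, DFinsupp.support_eq_empty]
    exact fun h => hf ((decomposeAddEquiv 𝒜).map_eq_zero_iff.1 h)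
  have key : ∀ i, i ∈ (decompose 𝒜 f).support ↔ (decompose 𝒜 f i : R) ≠ 0 := by
    intro i
    simp
  exact ⟨_, _, (key _).1 (Finset.min'_mem _ hs), (key _).1 (Finset.max'_mem _ hs), fun i hi =>
    ⟨Finset.min'_le _ _ ((key i).2 hi), Finset.le_max' _ _ ((key i).2 hi)⟩⟩

theorem HasExtent.le {f : R} {m M : ℤ} (h : HasExtent 𝒜 f m M) : m ≤ M :=
  (h.mem_Icc m h.bot_ne).2

theorem HasExtent.unique {f : R} {m M m' M' : ℤ} (h : HasExtent 𝒜 f m M)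
    (h' : HasExtent 𝒜 f m' M') : m = m' ∧ M = M' :=
  ⟨le_antisymm (h.mem_Icc _ h'.bot_ne).1 (h'.mem_Icc _ h.bot_ne).1,
    le_antisymm (h'.mem_Icc _ h.top_ne).2 (h.mem_Icc _ h'.top_ne).2⟩

theorem hasExtent_of_mem {f : R} {n : ℤ} (hf : f ≠ 0) (hn : f ∈ 𝒜 n) : HasExtent 𝒜 f n n := by
  have h : (decompose 𝒜 f n : R) ≠ 0 := by rwa [decompose_of_mem_same 𝒜 hn]
  refine ⟨h, h, fun i hi => ?_⟩
  by_contra hne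
  exact hi (decompose_of_mem_ne 𝒜 hn (by omega))

theorem HasExtent.mem {f : R} {n : ℤ} (h : HasExtent 𝒜 f n n) : f ∈ 𝒜 n := by
  classical
  rw [← sum_support_decompose 𝒜 f]
  refine sum_mem fun i hi => ?_
  have hi' : (decompose 𝒜 f i : R) ≠ 0 := by simpa using hi
  obtain rfl : i = n := by have := h.mem_Icc i hi'; omega
  exact SetLike.coe_mem _

theorem coe_decompose_mul_of_unique {f g : R} {M N : ℤ}
    (h : ∀ i j, i + j = M + N → (decompose 𝒜 f i : R) ≠ 0 → (decompose 𝒜 g j : R) ≠ 0 →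
      i = M ∧ j = N) :
    (decompose 𝒜 (f * g) (M + N) : R) = decompose 𝒜 f M * decompose 𝒜 g N := by
  classical
  rw [decompose_mul, coe_mul_apply]
  rw [Finset.sum_eq_single (M, N)]
  · rintro ⟨i, j⟩ hij hne
    simp only [Finset.mem_filter, Finset.mem_product, DFinsupp.mem_support_toFun, ne_eq] at hij
    obtain ⟨rfl, rfl⟩ := h i j hij.2 (by simpa using hij.1.1) (by simpa using hij.1.2)
    exact absurd rfl hne
  · intro hn
    by_contra hne
    refine hn ?_
    have h1 : (decompose 𝒜 f M : R) ≠ 0 := left_ne_zero_of_mul hne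
    have h2 : (decompose 𝒜 g N : R) ≠ 0 := right_ne_zero_of_mul hne
    simpa using ⟨by simpa using h1, by simpa using h2⟩

theorem exists_of_coe_decompose_mul_ne_zero {f g : R} {n : ℤ}
    (h : (decompose 𝒜 (f * g) n : R) ≠ 0) :
    ∃ i j, i + j = n ∧ (decompose 𝒜 f i : R) ≠ 0 ∧ (decompose 𝒜 g j : R) ≠ 0 := by
  classical
  rw [decompose_mul, coe_mul_apply] at h
  obtain ⟨⟨i, j⟩, hij, -⟩ := Finset.exists_ne_zero_of_sum_ne_zero h
  simp only [Finset.mem_filter, Finset.mem_product, DFinsupp.mem_support_toFun, ne_eq] at hij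
  exact ⟨i, j, hij.2, by simpa using hij.1.1, by simpa using hij.1.2⟩

/-- One step of the division algorithm: cancelling the top components of `f` and `g`
shortens the extent of `g`. -/
theorem HasExtent.cancel_top_lt {f g : R} {m M m' M' n N : ℤ} (hf : HasExtent 𝒜 f m M)
    (hg : HasExtent 𝒜 g m' M') (hle : M - m ≤ M' - m')
    (hr : HasExtent 𝒜 ((decompose 𝒜 f M : R) * g - (decompose 𝒜 g M' : R) * f) n N) :
    N - n < M' - m' := by
  have key : ∀ i, (decompose 𝒜 ((decompose 𝒜 f M : R) * g - (decompose 𝒜 g M' : R) * f) i : R) =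
      decompose 𝒜 f M * decompose 𝒜 g (i - M) - decompose 𝒜 g M' * decompose 𝒜 f (i - M') := by
    intro i
    have h1 := coe_decompose_mul_add_of_left_mem 𝒜 (j := i - M) (b := g)
      (SetLike.coe_mem (decompose 𝒜 f M))
    have h2 := coe_decompose_mul_add_of_left_mem 𝒜 (j := i - M') (b := f)
      (SetLike.coe_mem (decompose 𝒜 g M'))
    rw [add_sub_cancel] at h1 h2
    rw [decompose_sub, ← h1, ← h2]
    simp
  have bound : ∀ i, (decompose 𝒜 ((decompose 𝒜 f M : R) * g - (decompose 𝒜 g M' : R) * f) i : R)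
      ≠ 0 → M + m' ≤ i ∧ i < M + M' := by
    intro i hi
    rw [key] at hi
    have hne : i ≠ M + M' := by
      rintro rfl
      apply hi
      rw [add_sub_cancel_left, add_sub_cancel_right]
      ring
    by_cases hz : (decompose 𝒜 g (i - M) : R) = 0
    · rw [hz, mul_zero, zero_sub, neg_ne_zero] at hi
      have := hf.mem_Icc _ (right_ne_zero_of_mul hi)
      omega
    · have := hg.mem_Icc _ hz
      omega
  have := bound _ hr.bot_ne
  have := bound _ hr.top_ne
  omega

/-- The element `a` is a product of primes and units. -/
def IsPrimeProduct (a : R) : Prop :=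
  a ∈ Submonoid.closure {p : R | IsUnit p ∨ Prime p}

theorem IsPrimeProduct.of_ne_zero [UniqueFactorizationMonoid R] {a : R} (ha : a ≠ 0) :
    IsPrimeProduct a := by
  induction a using UniqueFactorizationMonoid.induction_on_prime with
  | h₁ => exact absurd rfl ha
  | h₂ x hx => exact Submonoid.subset_closure (Or.inl hx)
  | h₃ a p ha0 hp ih => exact mul_mem (Submonoid.subset_closure (Or.inr hp)) (ih ha0)

theorem HasExtent.exists_dvd_mul {f : R} {m M : ℤ} (hf : HasExtent 𝒜 f m M) {P : Ideal R}
    (hfP : f ∈ P)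
    (hmin : ∀ g ∈ P, ∀ n N, HasExtent 𝒜 g n N → M - m ≤ N - n)
    (H : ∀ a ≠ 0, SetLike.IsHomogeneousElem 𝒜 a → IsPrimeProduct a)
    {g : R} (hgP : g ∈ P) : ∃ h, IsPrimeProduct h ∧ f ∣ h * g := by
  by_cases hg0 : g = 0
  · exact ⟨1, one_mem _, by simp [hg0]⟩
  obtain ⟨n, N, hg⟩ := exists_hasExtent (𝒜 := 𝒜) hg0
  obtain ⟨k, hk⟩ : ∃ k : ℕ, N - n < k := ⟨(N - n + 1).toNat, by omega⟩
  induction k generalizing g n N with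
  | zero => have := hg.le; omega
  | succ k ih =>
    have hle := hmin g hgP n N hg
    set r := (decompose 𝒜 f M : R) * g - (decompose 𝒜 g N : R) * f with hr
    have hrP : r ∈ P := sub_mem (P.mul_mem_left _ hgP) (P.mul_mem_left _ hfP)
    have htop : IsPrimeProduct (decompose 𝒜 f M : R) :=
      H _ hf.top_ne ⟨M, SetLike.coe_mem _⟩
    obtain ⟨h, hh, hd⟩ : ∃ h, IsPrimeProduct h ∧ f ∣ h * r := by
      by_cases hr0 : r = 0
      · exact ⟨1, one_mem _, by simp [hr0]⟩
      · obtain ⟨n', N', hr'⟩ := exists_hasExtent (𝒜 := 𝒜) hr0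
        have := hf.cancel_top_lt hg hle hr'
        exact ih hrP hr0 n' N' hr' (by omega)
    refine ⟨h * decompose 𝒜 f M, mul_mem hh htop, ?_⟩
    have heq : h * (decompose 𝒜 f M : R) * g = h * r + h * decompose 𝒜 g N * f := by
      rw [hr]; ring
    rw [heq]
    exact dvd_add hd (Dvd.intro_left _ rfl)

variable [IsDomain R]

theorem HasExtent.mul {f g : R} {m M n N : ℤ} (hf : HasExtent 𝒜 f m M)
    (hg : HasExtent 𝒜 g n N) : HasExtent 𝒜 (f * g) (m + n) (M + N) := by
  refine ⟨?_, ?_, fun k hk => ?_⟩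
  · rw [coe_decompose_mul_of_unique]
    · exact mul_ne_zero hf.bot_ne hg.bot_ne
    · intro i j hij hi hj
      have := hf.mem_Icc i hi
      have := hg.mem_Icc j hj
      omega
  · rw [coe_decompose_mul_of_unique]
    · exact mul_ne_zero hf.top_ne hg.top_ne
    · intro i j hij hi hj
      have := hf.mem_Icc i hi
      have := hg.mem_Icc j hj
      omega
  · obtain ⟨i, j, hij, hi, hj⟩ := exists_of_coe_decompose_mul_ne_zero hk
    have := hf.mem_Icc i hi
    have := hg.mem_Icc j hj
    omega

theorem isHomogeneousElem_of_dvd {f g : R} (hg0 : g ≠ 0)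
    (hg : SetLike.IsHomogeneousElem 𝒜 g) (h : f ∣ g) : SetLike.IsHomogeneousElem 𝒜 f := by
  obtain ⟨n, hn⟩ := hg
  obtain ⟨k, rfl⟩ := h
  obtain ⟨m, M, hf⟩ := exists_hasExtent (𝒜 := 𝒜) (left_ne_zero_of_mul hg0)
  obtain ⟨m', M', hk⟩ := exists_hasExtent (𝒜 := 𝒜) (right_ne_zero_of_mul hg0)
  have := (hf.mul hk).unique (hasExtent_of_mem hg0 hn)
  have := hf.le
  have := hk.le
  obtain rfl : m = M := by omega
  exact ⟨m, hf.mem⟩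

theorem dvd_of_dvd_mul_of_isPrimeProduct {f h x : R} (hh : IsPrimeProduct h)
    (hf : ∀ p, Prime p → ¬ p ∣ f) (hd : f ∣ h * x) : f ∣ x := by
  induction hh using Submonoid.closure_induction generalizing x with
  | mem p hp =>
    rcases hp with hp | hp
    · exact hp.dvd_mul_left.1 hd
    · obtain ⟨g, hg⟩ := hd
      rcases hp.dvd_or_dvd (Dvd.intro _ hg) with h | ⟨g', rfl⟩
      · exact absurd h (hf p hp)
      · refine ⟨g', mul_left_cancel₀ hp.ne_zero ?_⟩
        rw [hg]
        ring
  | one => simpa using hd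
  | mul a b _ _ iha ihb =>
    rw [mul_assoc] at hd
    exact ihb (iha hd)

/-- A noetherian graded domain is factorial as soon as its nonzero homogeneous elements are
products of primes. -/
theorem uniqueFactorizationMonoid_of_homogeneous [IsNoetherianRing R]
    (H : ∀ a ≠ 0, SetLike.IsHomogeneousElem 𝒜 a → IsPrimeProduct a) :
    UniqueFactorizationMonoid R := by
  rw [UniqueFactorizationMonoid.iff_exists_prime_mem_of_isPrime]
  intro P hP0 hP
  by_contra! hno
  classical
  have hex : ∃ k : ℕ, ∃ f ∈ P, ∃ m M, HasExtent 𝒜 f m M ∧ M - m = k := by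
    obtain ⟨f, hfP, hf0⟩ := Submodule.exists_mem_ne_zero_of_ne_bot hP0
    obtain ⟨m, M, hf⟩ := exists_hasExtent (𝒜 := 𝒜) hf0
    exact ⟨(M - m).toNat, f, hfP, m, M, hf, by have := hf.le; omega⟩
  obtain ⟨k, hk, hk_min⟩ : ∃ k : ℕ, (∃ f ∈ P, ∃ m M, HasExtent 𝒜 f m M ∧ M - m = k) ∧
      ∀ l : ℕ, (∃ f ∈ P, ∃ m M, HasExtent 𝒜 f m M ∧ M - m = l) → k ≤ l :=
    ⟨Nat.find hex, Nat.find_spec hex, fun _ => Nat.find_min' hex⟩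
  have hmin : ∀ g ∈ P, ∀ n N, HasExtent 𝒜 g n N → (k : ℤ) ≤ N - n := by
    intro g hg n N hgE
    have hle := hgE.le
    have := hk_min (N - n).toNat ⟨g, hg, n, N, hgE, by omega⟩
    omega
  obtain ⟨f, ⟨hfP, m, M, hf, hfk⟩, hfmin⟩ :=
    (wellFounded_dvdNotUnit (α := R)).has_min
      {f | f ∈ P ∧ ∃ m M, HasExtent 𝒜 f m M ∧ M - m = k} hk
  have hf0 : f ≠ 0 := by
    rintro rfl
    exact hf.bot_ne (by simp)
  have hfp : ∀ p, Prime p → ¬ p ∣ f := by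
    rintro p hp ⟨g, rfl⟩
    have hgP : g ∈ P := (hP.mem_or_mem hfP).resolve_left fun h => hno p h hp
    have hg0 := right_ne_zero_of_mul hf0
    obtain ⟨n, N, hg⟩ := exists_hasExtent (𝒜 := 𝒜) hg0
    obtain ⟨n', N', hp'⟩ := exists_hasExtent (𝒜 := 𝒜) hp.ne_zero
    have h1 := hmin g hgP n N hg
    have h2 := (hp'.mul hg).unique hf
    have h3 := hp'.le
    exact hfmin g ⟨hgP, n, N, hg, by omega⟩ ⟨hg0, p, hp.not_isUnit, mul_comm _ _⟩
  have hdvd : ∀ g ∈ P, f ∣ g := by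
    intro g hg
    obtain ⟨h, hh, hd⟩ := hf.exists_dvd_mul hfP (by simpa [hfk] using hmin) H hg
    exact dvd_of_dvd_mul_of_isPrimeProduct hh hfp hd
  refine hno f hfP ⟨hf0, fun hu => hP.ne_top (P.eq_top_of_isUnit_mem hfP hu), fun x y hxy => ?_⟩
  exact (hP.mem_or_mem (P.mem_of_dvd hxy hfP)).imp (hdvd x) (hdvd y)

end Graded

section Cyclic

open AdjoinRoot Polynomial

variable {A : Type*} [CommRing A]

/-- The ring obtained from `A` by adjoining a `c`-th root of `F`. -/
abbrev CyclicExt (F : A) (c : ℕ) : Type _ := AdjoinRoot (X ^ c - C F)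

variable {F : A} {c : ℕ}

namespace CyclicExt

/-- The adjoined `c`-th root of `F`. -/
noncomputable abbrev z (F : A) (c : ℕ) : CyclicExt F c := root (X ^ c - C F)

/-- The inclusion of `A` in the cyclic extension. -/
noncomputable abbrev incl (F : A) (c : ℕ) : A →+* CyclicExt F c := of (X ^ c - C F)

theorem z_pow : z F c ^ c = incl F c F := by
  have h := eval₂_root (X ^ c - C F)
  rw [eval₂_sub, eval₂_X_pow, eval₂_C] at h
  exact sub_eq_zero.1 h

theorem exists_linear_coeff (hc : 0 < c) (k : ℕ) (hk : k < c) :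
    ∃ φ : CyclicExt F c →ₗ[A] A, ∀ a, φ (incl F c a * z F c ^ k) = a := by
  have hm : (X ^ c - C F).Monic := monic_X_pow_sub_C F hc.ne'
  refine ⟨(lcoeff A k).comp (modByMonicHom hm), fun a => ?_⟩
  nontriviality A
  have h : incl F c a * z F c ^ k = AdjoinRoot.mk (X ^ c - C F) (C a * X ^ k) := by
    rw [map_mul, map_pow, mk_X, mk_C]
  rw [h, LinearMap.comp_apply, modByMonicHom_mk, (modByMonic_eq_self_iff hm).2]
  · simp
  · rw [degree_X_pow_sub_C hc]
    exact (degree_C_mul_X_pow_le k a).trans_lt (by exact_mod_cast hk)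

theorem dvd_of_incl_dvd (hc : 0 < c) {a b : A} {k : ℕ} (hk : k < c)
    (h : incl F c a ∣ incl F c b * z F c ^ k) : a ∣ b := by
  obtain ⟨φ, hφ⟩ := exists_linear_coeff (F := F) hc k hk
  obtain ⟨y, hy⟩ := h
  refine ⟨φ y, ?_⟩
  have h : incl F c a * y = a • y := (Algebra.smul_def a y).symm
  rw [← hφ b, hy, h, φ.map_smul, smul_eq_mul]

theorem incl_dvd_incl_iff (hc : 0 < c) {a b : A} : incl F c a ∣ incl F c b ↔ a ∣ b :=
  ⟨fun h => dvd_of_incl_dvd hc hc (by simpa using h), map_dvd _⟩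

theorem dvd_of_z_dvd_incl (hc : 0 < c) {b : A} (h : z F c ∣ incl F c b) : F ∣ b := by
  have hr : (X ^ c - C F).eval₂ (Ideal.Quotient.mk (Ideal.span {F})) 0 = 0 := by
    rw [eval₂_sub, eval₂_X_pow, eval₂_C, zero_pow hc.ne', zero_sub, neg_eq_zero,
      Ideal.Quotient.eq_zero_iff_mem]
    exact Ideal.mem_span_singleton_self F
  have h2 := map_dvd (AdjoinRoot.lift (Ideal.Quotient.mk (Ideal.span {F})) 0 hr) h
  rw [lift_root, lift_of, zero_dvd_iff, Ideal.Quotient.eq_zero_iff_mem,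
    Ideal.mem_span_singleton] at h2
  exact h2

theorem z_dvd_incl (hc : 0 < c) : z F c ∣ incl F c F := by
  rw [← z_pow]
  exact dvd_pow_self _ hc.ne'

section Grading

variable (𝒜 : ℤ → AddSubgroup A) (ω : ℤ) (F c)

/-- The grading of the cyclic extension in which the degrees of `A` are multiplied by `c` and
the adjoined root has degree `ω`. -/
noncomputable def grading (j : ℤ) : AddSubgroup (CyclicExt F c) :=
  AddSubgroup.closure {x | ∃ (i : ℤ) (k : ℕ) (a : A), a ∈ 𝒜 i ∧ c * i + k * ω = j ∧
    x = incl F c a * z F c ^ k}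

variable {𝒜 ω F c}

theorem mem_grading {i : ℤ} {a : A} (ha : a ∈ 𝒜 i) (k : ℕ) {j : ℤ} (hj : c * i + k * ω = j) :
    incl F c a * z F c ^ k ∈ grading F c 𝒜 ω j :=
  AddSubgroup.subset_closure ⟨i, k, a, ha, hj, rfl⟩

theorem incl_mem_grading {i : ℤ} {a : A} (ha : a ∈ 𝒜 i) :
    incl F c a ∈ grading F c 𝒜 ω (c * i) := by
  simpa using mem_grading (F := F) (c := c) (ω := ω) ha 0 rfl

variable [GradedRing 𝒜]

theorem z_mem_grading : z F c ∈ grading F c 𝒜 ω ω := by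
  simpa using mem_grading (F := F) (c := c) (ω := ω) (SetLike.one_mem_graded 𝒜) 1 (j := ω)
    (by simp)

instance : SetLike.GradedMonoid (grading F c 𝒜 ω) where
  one_mem := by
    simpa using incl_mem_grading (F := F) (c := c) (ω := ω) (SetLike.one_mem_graded 𝒜)
  mul_mem i j x y hx hy := by
    induction hx using AddSubgroup.closure_induction with
    | mem x hx =>
      induction hy using AddSubgroup.closure_induction with
      | mem y hy =>
        obtain ⟨i, k, a, ha, rfl, rfl⟩ := hx
        obtain ⟨i', k', a', ha', rfl, rfl⟩ := hy
        have h : incl F c a * z F c ^ k * (incl F c a' * z F c ^ k') =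
            incl F c (a * a') * z F c ^ (k + k') := by
          rw [map_mul]; ring
        rw [h]
        exact mem_grading (SetLike.mul_mem_graded ha ha') _ (by push_cast; ring)
      | zero => rw [mul_zero]; exact zero_mem _
      | add y w _ _ h₁ h₂ => rw [mul_add]; exact add_mem h₁ h₂
      | neg y _ h => rw [mul_neg]; exact neg_mem h
    | zero => rw [zero_mul]; exact zero_mem _
    | add x w _ _ h₁ h₂ => rw [add_mul]; exact add_mem h₁ h₂
    | neg x _ h => rw [neg_mul]; exact neg_mem h

variable (F c 𝒜 ω)

/-- The homogeneous components of elements of `A`, viewed in the cyclic extension. -/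
noncomputable def inclDecompose : A →+* ⨁ j, grading F c 𝒜 ω j :=
  (DirectSum.toSemiring (fun i => (DirectSum.of (fun j => grading F c 𝒜 ω j) (c * i)).comp
      (((incl F c).toAddMonoidHom.comp (𝒜 i).subtype).codRestrict (grading F c 𝒜 ω (c * i))
        fun a => incl_mem_grading a.2))
    (by
      refine DirectSum.of_eq_of_gradedMonoid_eq (Sigma.subtype_ext (mul_zero _) ?_)
      exact map_one (incl F c))
    (fun {i j} a b => by
      simp only [AddMonoidHom.comp_apply]
      rw [DirectSum.of_mul_of]
      refine DirectSum.of_eq_of_gradedMonoid_eq (Sigma.subtype_ext (mul_add _ _ _) ?_)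
      exact map_mul (incl F c) (a : A) b)).comp
    (decomposeRingEquiv 𝒜).toRingHom

variable {F c 𝒜 ω}

theorem inclDecompose_of_mem {i : ℤ} {a : A} (ha : a ∈ 𝒜 i) :
    inclDecompose F c 𝒜 ω a =
      DirectSum.of (fun j => grading F c 𝒜 ω j) (c * i) ⟨incl F c a, incl_mem_grading ha⟩ := by
  have h : (decomposeRingEquiv 𝒜) a = DirectSum.of (fun i => 𝒜 i) i ⟨a, ha⟩ :=
    decompose_of_mem 𝒜 ha
  rw [inclDecompose, RingHom.comp_apply]
  change DirectSum.toSemiring _ _ _ ((decomposeRingEquiv 𝒜) a) = _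
  rw [h, DirectSum.toSemiring_of]
  rfl

theorem of_z_pow (k : ℕ) :
    DirectSum.of (fun j => grading F c 𝒜 ω j) ω ⟨z F c, z_mem_grading⟩ ^ k =
      DirectSum.of (fun j => grading F c 𝒜 ω j) (k • ω)
        ⟨z F c ^ k, SetLike.pow_mem_graded k z_mem_grading⟩ := by
  rw [DirectSum.ofPow]
  rfl

/-- The decomposition of an element of the cyclic extension in homogeneous components. -/
noncomputable def decomposeHom (hF : F ∈ 𝒜 ω) : CyclicExt F c →+* ⨁ j, grading F c 𝒜 ω j :=
  AdjoinRoot.lift (inclDecompose F c 𝒜 ω)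
    (DirectSum.of (fun j => grading F c 𝒜 ω j) ω ⟨z F c, z_mem_grading⟩) (by
      rw [eval₂_sub, eval₂_X_pow, eval₂_C, inclDecompose_of_mem hF, of_z_pow, sub_eq_zero]
      refine DirectSum.of_eq_of_gradedMonoid_eq (Sigma.subtype_ext (nsmul_eq_mul _ _) ?_)
      exact z_pow)

theorem decomposeHom_of_mem (hF : F ∈ 𝒜 ω) {j : ℤ} {x : CyclicExt F c}
    (hx : x ∈ grading F c 𝒜 ω j) :
    decomposeHom hF x = DirectSum.of (fun j => grading F c 𝒜 ω j) j ⟨x, hx⟩ := by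
  induction hx using AddSubgroup.closure_induction with
  | mem x hx =>
    obtain ⟨i, k, a, ha, rfl, rfl⟩ := hx
    rw [map_mul, map_pow, decomposeHom, lift_of, lift_root, inclDecompose_of_mem ha, of_z_pow,
      DirectSum.of_mul_of]
    refine DirectSum.of_eq_of_gradedMonoid_eq (Sigma.subtype_ext ?_ rfl)
    change (c : ℤ) * i + k • ω = c * i + k * ω
    rw [nsmul_eq_mul]
  | zero =>
    rw [map_zero]
    exact (map_zero (DirectSum.of (fun j => grading F c 𝒜 ω j) j)).symm
  | add x y hx hy h₁ h₂ =>
    rw [map_add, h₁, h₂, ← map_add]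
    rfl
  | neg x hx h =>
    rw [map_neg, h, ← map_neg]
    rfl

/-- The grading of the cyclic extension is a ring grading. -/
noncomputable abbrev gradedRing (hF : F ∈ 𝒜 ω) : GradedRing (grading F c 𝒜 ω) where
  decompose' := decomposeHom hF
  left_inv x := by
    classical
    have h : (DirectSum.coeRingHom (grading F c 𝒜 ω)).comp (decomposeHom hF) =
        RingHom.id (CyclicExt F c) := by
      refine AdjoinRoot.ringHom_ext (RingHom.ext fun a => ?_) ?_
      · induction a using DirectSum.Decomposition.inductionOn 𝒜 with
        | zero => simp
        | homogeneous a =>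
          simp only [RingHom.comp_apply, RingHom.id_apply]
          rw [decomposeHom_of_mem hF (incl_mem_grading a.2)]
          exact DirectSum.coeRingHom_of _ _ _
        | add a b ha hb => simpa using congrArg₂ (· + ·) ha hb
      · simp only [RingHom.comp_apply, RingHom.id_apply]
        rw [decomposeHom_of_mem hF z_mem_grading]
        exact DirectSum.coeRingHom_of _ _ _
    exact DFunLike.congr_fun h x
  right_inv x := by
    induction x using DirectSum.induction_on with
    | zero => simp
    | of j x =>
      rw [DirectSum.coeAddMonoidHom_of]
      exact decomposeHom_of_mem hF x.2
    | add x y hx hy => rw [map_add, map_add, hx, hy]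

theorem exists_of_mem_grading (hF : F ∈ 𝒜 ω) (hc : 0 < c) (hgcd : Int.gcd c ω = 1) {j : ℤ}
    {x : CyclicExt F c} (hx : x ∈ grading F c 𝒜 ω j) :
    ∃ (i : ℤ) (k : ℕ) (a : A), k < c ∧ a ∈ 𝒜 i ∧ c * i + k * ω = j ∧
      x = incl F c a * z F c ^ k := by
  have hcop : IsCoprime (c : ℤ) ω := Int.isCoprime_iff_gcd_eq_one.2 hgcd
  have hc' : (0 : ℤ) < c := by exact_mod_cast hc
  induction hx using AddSubgroup.closure_induction with
  | mem x hx =>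
    obtain ⟨i, k, a, ha, rfl, rfl⟩ := hx
    refine ⟨i + (k / c : ℕ) • ω, k % c, a * F ^ (k / c), Nat.mod_lt _ hc,
      SetLike.mul_mem_graded ha (SetLike.pow_mem_graded _ hF), ?_, ?_⟩
    · have h : (k : ℤ) = c * (k / c : ℕ) + (k % c : ℕ) := by
        exact_mod_cast (Nat.div_add_mod k c).symm
      rw [nsmul_eq_mul]
      linear_combination (-ω) * h
    · conv_lhs => rw [← Nat.div_add_mod k c, pow_add, pow_mul, z_pow]
      rw [map_mul, map_pow, mul_assoc]
  | zero =>
    obtain ⟨u, v, huv⟩ := hcop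
    have hmod := Int.emod_add_mul_ediv (j * v) c
    have h0 := Int.emod_nonneg (j * v) hc'.ne'
    have h1 := Int.emod_lt_of_pos (j * v) hc'
    refine ⟨j * u + ω * (j * v / c), (j * v % c).toNat, 0, by omega, zero_mem _, ?_, by simp⟩
    rw [Int.toNat_of_nonneg h0]
    linear_combination ω * hmod + j * huv
  | add x y _ _ hx hy =>
    obtain ⟨i, k, a, hk, ha, hj, rfl⟩ := hx
    obtain ⟨i', k', a', hk', ha', hj', rfl⟩ := hy
    have hdvd : (c : ℤ) ∣ (k' - k : ℤ) :=
      hcop.dvd_of_dvd_mul_right ⟨i - i', by linear_combination hj' - hj⟩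
    have hkk : (k : ℤ) = k' := by
      have := Int.eq_zero_of_abs_lt_dvd hdvd (by rw [abs_lt]; omega)
      omega
    obtain rfl : k = k' := by exact_mod_cast hkk
    obtain rfl : i = i' := mul_left_cancel₀ hc'.ne' (by linear_combination hj - hj')
    exact ⟨i, k, a + a', hk, add_mem ha ha', hj, by rw [map_add, add_mul]⟩
  | neg x _ hx =>
    obtain ⟨i, k, a, hk, ha, hj, rfl⟩ := hx
    exact ⟨i, k, -a, hk, neg_mem ha, hj, by rw [map_neg, neg_mul]⟩

/-- Primality of a homogeneous element of the cyclic extension can be tested on monomials. -/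
theorem prime_of_isHomogeneousElem (hF : F ∈ 𝒜 ω) (hc : 0 < c) (hgcd : Int.gcd c ω = 1)
    {p : CyclicExt F c} (hp : SetLike.IsHomogeneousElem (grading F c 𝒜 ω) p) (hp0 : p ≠ 0)
    (hpu : ¬ IsUnit p)
    (h : ∀ (a b : A) (k l : ℕ), k < c → l < c →
      p ∣ (incl F c a * z F c ^ k) * (incl F c b * z F c ^ l) →
      p ∣ incl F c a * z F c ^ k ∨ p ∣ incl F c b * z F c ^ l) : Prime p := by
  let _ := gradedRing (c := c) hF
  rw [← Ideal.span_singleton_prime hp0]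
  refine Ideal.IsHomogeneous.isPrime_of_homogeneous_mem_or_mem (𝒜 := grading F c 𝒜 ω)
    (Ideal.homogeneous_span _ _ fun x hx => ?_) (Ideal.span_singleton_eq_top.not.2 hpu) ?_
  · rwa [Set.mem_singleton_iff.1 hx]
  · rintro x y ⟨i, hx⟩ ⟨j, hy⟩ hxy
    obtain ⟨-, k, a, hk, -, -, rfl⟩ := exists_of_mem_grading hF hc hgcd hx
    obtain ⟨-, l, b, hl, -, -, rfl⟩ := exists_of_mem_grading hF hc hgcd hy
    simp only [Ideal.mem_span_singleton] at hxy ⊢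
    exact h a b k l hk hl hxy

theorem incl_injective (hc : 0 < c) : Function.Injective (incl F c) := by
  refine (injective_iff_map_eq_zero _).2 fun a ha => ?_
  rw [← zero_dvd_iff, ← incl_dvd_incl_iff (F := F) hc, ha, map_zero]

theorem not_isUnit_incl (hc : 0 < c) {a : A} (ha : ¬ IsUnit a) : ¬ IsUnit (incl F c a) := by
  rw [isUnit_iff_dvd_one, ← map_one (incl F c), incl_dvd_incl_iff hc, ← isUnit_iff_dvd_one]
  exact ha

theorem prime_z (hF : F ∈ 𝒜 ω) (hFp : Prime F) (hc : 0 < c) (hgcd : Int.gcd c ω = 1) :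
    Prime (z F c) := by
  refine prime_of_isHomogeneousElem (𝒜 := 𝒜) hF hc hgcd ⟨ω, z_mem_grading⟩ ?_ ?_ ?_
  · intro h
    have h1 := z_pow (F := F) (c := c)
    rw [h, zero_pow hc.ne'] at h1
    exact hFp.ne_zero ((map_eq_zero_iff _ (incl_injective hc)).1 h1.symm)
  · intro h
    have h1 := h.pow c
    rw [z_pow] at h1
    exact not_isUnit_incl hc hFp.not_isUnit h1
  · intro a b k l _ _ hd
    rcases Nat.eq_zero_or_pos k with rfl | hk
    · rcases Nat.eq_zero_or_pos l with rfl | hl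
      · simp only [pow_zero, mul_one] at hd ⊢
        rw [← map_mul] at hd
        exact (hFp.dvd_or_dvd (dvd_of_z_dvd_incl hc hd)).imp
          (fun h => (z_dvd_incl hc).trans (map_dvd _ h))
          (fun h => (z_dvd_incl hc).trans (map_dvd _ h))
      · exact Or.inr ((dvd_pow_self _ hl.ne').mul_left _)
    · exact Or.inl ((dvd_pow_self _ hk.ne').mul_left _)

theorem prime_incl [IsDomain A] (hF : F ∈ 𝒜 ω) (hc : 0 < c) (hgcd : Int.gcd c ω = 1) {p : A} (hp : Prime p) (hph : SetLike.IsHomogeneousElem 𝒜 p) (hpF : ¬ p ∣ F) :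
    Prime (incl F c p) := by
  obtain ⟨n, hn⟩ := hph
  refine prime_of_isHomogeneousElem (𝒜 := 𝒜) hF hc hgcd ⟨_, incl_mem_grading hn⟩ ?_
    (not_isUnit_incl hc hp.not_isUnit) ?_
  · exact (map_ne_zero_iff _ (incl_injective hc)).2 hp.ne_zero
  · intro a b k l hk hl hd
    have heq : incl F c a * z F c ^ k * (incl F c b * z F c ^ l) =
        incl F c (a * b * F ^ ((k + l) / c)) * z F c ^ ((k + l) % c) := by
      rw [map_mul, map_mul, map_pow, ← z_pow, ← pow_mul, mul_assoc (_ * _) _ (_ ^ (_ % _)),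
        ← pow_add, Nat.div_add_mod, pow_add]
      ring
    rw [heq] at hd
    have hd' := dvd_of_incl_dvd hc (Nat.mod_lt _ hc) hd
    rcases hp.dvd_or_dvd hd' with hab | hFF
    · exact (hp.dvd_or_dvd hab).imp (fun h => (map_dvd (incl F c) h).mul_right _)
        (fun h => (map_dvd (incl F c) h).mul_right _)
    · exact absurd (hp.dvd_of_dvd_pow hFF) hpF

theorem uniqueFactorizationMonoid [IsDomain A] [IsNoetherianRing A] [IsDomain (CyclicExt F c)]
    [UniqueFactorizationMonoid A] (hF : F ∈ 𝒜 ω) (hFp : Prime F) (hc : 0 < c)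
    (hgcd : Int.gcd c ω = 1) : UniqueFactorizationMonoid (CyclicExt F c) := by
  let _ := gradedRing (c := c) hF
  have hz : IsPrimeProduct (z F c) := Submonoid.subset_closure (Or.inr (prime_z hF hFp hc hgcd))
  have key : ∀ b : A, b ≠ 0 → SetLike.IsHomogeneousElem 𝒜 b → IsPrimeProduct (incl F c b) := by
    intro b hb0 hb
    induction b using UniqueFactorizationMonoid.induction_on_prime with
    | h₁ => exact absurd rfl hb0
    | h₂ x hx => exact Submonoid.subset_closure (Or.inl (hx.map _))
    | h₃ a p ha0 hp ih =>
      rw [map_mul]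
      refine mul_mem ?_ (ih ha0 (isHomogeneousElem_of_dvd hb0 hb (Dvd.intro_left _ rfl)))
      by_cases hpF : p ∣ F
      · obtain ⟨u, hu⟩ := (hp.associated_of_dvd hFp hpF).symm
        rw [← hu, map_mul, ← z_pow]
        exact mul_mem (pow_mem hz c) (Submonoid.subset_closure (Or.inl (u.isUnit.map _)))
      · exact Submonoid.subset_closure (Or.inr (prime_incl hF hc hgcd hp
          (isHomogeneousElem_of_dvd hb0 hb (Dvd.intro _ rfl)) hpF))
  refine uniqueFactorizationMonoid_of_homogeneous (𝒜 := grading F c 𝒜 ω) ?_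
  rintro x hx0 ⟨j, hx⟩
  obtain ⟨i, k, a, -, ha, -, rfl⟩ := exists_of_mem_grading hF hc hgcd hx
  refine mul_mem (key a ?_ ⟨i, ha⟩) (pow_mem hz k)
  rintro rfl
  simp at hx0

theorem prime_of_irreducible [IsDomain A] [IsDomain (CyclicExt F c)]
    [UniqueFactorizationMonoid (CyclicExt F c)] (hF : F ∈ 𝒜 ω) (hFp : Prime F) (hc : 0 < c)
    (hgcd : Int.gcd c ω = 1) {a : A} (ha : Irreducible a) (hah : SetLike.IsHomogeneousElem 𝒜 a) :
    Prime a := by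
  let _ := gradedRing (c := c) hF
  have ha0 : incl F c a ≠ 0 := (map_ne_zero_iff _ (incl_injective hc)).2 ha.ne_zero
  obtain ⟨q, hq, hqa⟩ := WfDvdMonoid.exists_irreducible_factor
    (not_isUnit_incl (F := F) hc ha.not_isUnit) ha0
  have hqp : Prime q := UniqueFactorizationMonoid.irreducible_iff_prime.1 hq
  obtain ⟨n, hn⟩ := hah
  obtain ⟨j, hj⟩ := isHomogeneousElem_of_dvd (𝒜 := grading F c 𝒜 ω) ha0
    ⟨_, incl_mem_grading hn⟩ hqa
  obtain ⟨i, k, b, -, hb, -, rfl⟩ := exists_of_mem_grading hF hc hgcd hj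
  rcases Nat.eq_zero_or_pos k with rfl | hk
  · rw [pow_zero, mul_one] at hqp hqa
    have hba : b ∣ a := (incl_dvd_incl_iff hc).1 hqa
    have hbp : Prime b := by
      refine ⟨fun h => hqp.ne_zero (by rw [h, map_zero]),
        fun h => hqp.not_isUnit (h.map _), fun x y hxy => ?_⟩
      have h := hqp.dvd_or_dvd (map_mul (incl F c) x y ▸ map_dvd (incl F c) hxy)
      simpa only [incl_dvd_incl_iff hc] using h
    exact (hbp.irreducible.associated_of_dvd ha hba).prime hbp
  · have hFa : F ∣ a := dvd_of_z_dvd_incl hc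
      (((dvd_pow_self _ hk.ne').mul_left _).trans hqa)
    exact (hFp.irreducible.associated_of_dvd ha hFa).prime hFp

theorem uniqueFactorizationMonoid_base [IsDomain A] [IsNoetherianRing A]
    [IsDomain (CyclicExt F c)] [UniqueFactorizationMonoid (CyclicExt F c)] (hF : F ∈ 𝒜 ω)
    (hFp : Prime F) (hc : 0 < c) (hgcd : Int.gcd c ω = 1) : UniqueFactorizationMonoid A := by
  refine uniqueFactorizationMonoid_of_homogeneous (𝒜 := 𝒜) fun a ha0 ha => ?_
  induction a using WfDvdMonoid.induction_on_irreducible with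
  | zero => exact absurd rfl ha0
  | unit u hu => exact Submonoid.subset_closure (Or.inl hu)
  | mul a i ha0' hi ih =>
    refine mul_mem (Submonoid.subset_closure (Or.inr ?_))
      (ih ha0' (isHomogeneousElem_of_dvd ha0 ha (Dvd.intro_left _ rfl)))
    exact prime_of_irreducible hF hFp hc hgcd hi
      (isHomogeneousElem_of_dvd ha0 ha (Dvd.intro _ rfl))

end Grading

end CyclicExt

end Cyclic

/-- Let `A = ⊕_{i∈ℤ} A_i` be a noetherian ℤ-graded integral domain which is
finitely generated as an `A₀`-algebra, let `ω ∈ ℤ`, let `F ∈ A_ω` be a nonzero prime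
element of `A`, let `c` be a positive integer with `gcd(c, ω) = 1`, and set
`B = A[Z]/(Z^c − F)` (an integral domain under these hypotheses, recorded here as an
instance).  Then `A` is a unique factorization domain if and only if `B` is a unique
factorization domain. -/
theorem stmt_1 {A : Type*} [CommRing A] [IsDomain A] [IsNoetherianRing A]
    (𝒜 : ℤ → AddSubgroup A) [GradedRing 𝒜]
    (hfg : ∃ s : Finset A, Subring.closure ((𝒜 0 : Set A) ∪ (s : Set A)) = ⊤)
    (ω : ℤ) (F : A) (hF : F ∈ 𝒜 ω) (hF0 : F ≠ 0) (hFprime : Prime F)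
    (c : ℕ) (hc : 0 < c) (hgcd : Int.gcd (c : ℤ) ω = 1)
    [hB : IsDomain (Polynomial A ⧸ Ideal.span {Polynomial.X ^ c - Polynomial.C F})] :
    UniqueFactorizationMonoid A ↔
      UniqueFactorizationMonoid
        (Polynomial A ⧸ Ideal.span {Polynomial.X ^ c - Polynomial.C F}) := by
  have hgcd' : Int.gcd c ω = 1 := hgcd
  have : IsDomain (CyclicExt F c) := hB
  constructor
  · intro _
    exact CyclicExt.uniqueFactorizationMonoid hF hFprime hc hgcd'
  · intro h
    have : UniqueFactorizationMonoid (CyclicExt F c) := h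
    exact CyclicExt.uniqueFactorizationMonoid_base hF hFprime hc hgcd'
end

section
/- Let A_0 be an integral domain, let n ≥ 0, let R_n = A_0[z_0, …, z_n] be a polynomial ring in n+1 variables over A_0, and let a_1, …, a_n, b_1, …, b_n be positive integers such that gcd(a_i, b_1 b_2 ⋯ b_i) = 1 for each i with 1 ≤ i ≤ n. Then the ideal I_n = (z_1^{a_1} + z_0^{b_1}, z_2^{a_2} + z_1^{b_2}, …, z_n^{a_n} + z_{n-1}^{b_n}) is a prime ideal of R_n. -/
open MvPolynomial

namespace BinomialChain

/-- The exponent of the parameter `t` in the monomial parametrization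
`z_i = ± t ^ weight a b n i` of the curve `z_{i+1} ^ a i + z_i ^ b i = 0`, `i < n`. -/
def weight (a b : ℕ → ℕ) (n i : ℕ) : ℕ :=
  (∏ j ∈ Finset.range i, b j) * ∏ j ∈ Finset.Ico i n, a j

lemma weight_succ_mul (a b : ℕ → ℕ) {n i : ℕ} (hi : i < n) :
    weight a b n (i + 1) * a i = weight a b n i * b i := by
  rw [weight, weight, Finset.prod_range_succ, Finset.prod_eq_prod_Ico_succ_bot hi]
  ring

lemma weight_succ_right (a b : ℕ → ℕ) {n i : ℕ} (hi : i ≤ n) :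
    weight a b (n + 1) i = weight a b n i * a n := by
  rw [weight, weight, Finset.prod_Ico_succ_top hi, mul_assoc]

lemma eq_of_sum_weight_eq (a b : ℕ → ℕ) (n : ℕ)
    (hcop : ∀ i < n, ∀ j ≤ i, (a i).Coprime (b j)) (m m' : Fin (n + 1) → ℕ)
    (hm : ∀ i : Fin n, m i.succ < a i) (hm' : ∀ i : Fin n, m' i.succ < a i)
    (h : ∑ i : Fin (n + 1), weight a b n i * m i = ∑ i : Fin (n + 1), weight a b n i * m' i) : m = m' := by
  induction n with
  | zero =>
    funext i
    fin_cases i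
    simpa [weight] using h
  | succ n ih =>
    have key : ∀ f : Fin (n + 2) → ℕ, ∑ i : Fin (n + 2), weight a b (n + 1) i * f i =
        a n * (∑ i : Fin (n + 1), weight a b n i * f i.castSucc) +
          (∏ j ∈ Finset.range (n + 1), b j) * f (Fin.last _) := by
      intro f
      rw [Fin.sum_univ_castSucc, Finset.mul_sum]
      congr 1
      · refine Finset.sum_congr rfl fun i _ => ?_
        rw [Fin.val_castSucc, weight_succ_right a b (Nat.lt_succ_iff.mp i.isLt)]
        ring
      · simp [weight]
    rw [key, key] at h
    have hP : (a n).Coprime (∏ j ∈ Finset.range (n + 1), b j) :=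
      Nat.Coprime.prod_right fun j hj =>
        hcop n n.lt_succ_self j (Nat.lt_succ_iff.mp (Finset.mem_range.mp hj))
    have hlast : m (Fin.last _) = m' (Fin.last _) := by
      have hmod : (∏ j ∈ Finset.range (n + 1), b j) * m (Fin.last _) ≡
          (∏ j ∈ Finset.range (n + 1), b j) * m' (Fin.last _) [MOD a n] := by
        have h2 := congrArg (· % a n) h
        simpa [Nat.ModEq] using h2
      exact (Nat.ModEq.cancel_left_of_coprime hP hmod).eq_of_lt_of_lt
        (by simpa using hm (Fin.last n)) (by simpa using hm' (Fin.last n))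
    have hpos : 0 < a n := (Nat.zero_le _).trans_lt (by simpa using hm (Fin.last n))
    rw [hlast] at h
    have hinit := ih (fun i hi => hcop i (hi.trans n.lt_succ_self))
      (fun i => m i.castSucc) (fun i => m' i.castSucc)
      (fun i => by simpa using hm i.castSucc) (fun i => by simpa using hm' i.castSucc)
      (Nat.eq_of_mul_eq_mul_left hpos (Nat.add_right_cancel h))
    funext i
    induction i using Fin.lastCases with
    | last => exact hlast
    | cast i => exact congrFun hinit i

lemma intUnits_pow_odd (u : ℤˣ) {k : ℕ} (hk : Odd k) : u ^ k = u := by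
  rcases Int.units_eq_one_or u with rfl | rfl
  · simp
  · exact hk.neg_one_pow

lemma exists_signs (a b : ℕ → ℕ) (n : ℕ) (hcop : ∀ i < n, ∀ j ≤ i, (a i).Coprime (b j)) :
    ∃ s : ℕ → ℤˣ, ∀ i < n, s (i + 1) ^ a i = -s i ^ b i := by
  induction n with
  | zero => exact ⟨1, by simp⟩
  | succ n ih =>
    rcases Nat.even_or_odd (a n) with he | ho
    · have hb : ∀ j ≤ n, Odd (b j) := fun j hj => by
        have h := (hcop n n.lt_succ_self j hj).coprime_dvd_left he.two_dvd
        exact Nat.coprime_two_left.mp h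
      let t : ℕ → ℤˣ := Nat.rec 1 fun j u => -u ^ a (n - j)
      have ht : ∀ j, t (j + 1) = -t j ^ a (n - j) := fun j => rfl
      refine ⟨fun i => t (n + 1 - i), fun i hi => ?_⟩
      have h1 : n + 1 - i = n - i + 1 := by omega
      have h2 : n - (n - i) = i := by omega
      have h3 : n + 1 - (i + 1) = n - i := by omega
      simp only [h1, h3, intUnits_pow_odd _ (hb i (by omega)), ht, h2, neg_neg]
    · obtain ⟨s, hs⟩ := ih fun i hi => hcop i (hi.trans n.lt_succ_self)
      refine ⟨Function.update s (n + 1) (-s n ^ b n), fun i hi => ?_⟩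
      rw [Function.update_of_ne (by omega : i ≠ n + 1)]
      rcases Nat.lt_succ_iff_lt_or_eq.mp hi with h | rfl
      · rw [Function.update_of_ne (by omega), hs i h]
      · rw [Function.update_self, intUnits_pow_odd _ ho]

section Reduction

variable {A : Type*} [CommRing A] {n : ℕ} (a b : Fin n → ℕ)

/-- The ideal generated by the binomials `z_{i+1} ^ a i + z_i ^ b i`. -/
noncomputable abbrev chainIdeal (A : Type*) [CommRing A] {n : ℕ} (a b : Fin n → ℕ) :
    Ideal (MvPolynomial (Fin (n + 1)) A) :=
  Ideal.span (Set.range fun i : Fin n =>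
    (X i.succ : MvPolynomial (Fin (n + 1)) A) ^ a i + X i.castSucc ^ b i)

/-- The exponents of the monomials divisible by no `z_{i+1} ^ a i`. -/
def reducedExponents : Set (Fin (n + 1) →₀ ℕ) := {m | ∀ i : Fin n, m i.succ < a i}

lemma monomial_mem_sup (ha : ∀ i, 0 < a i) (m : Fin (n + 1) →₀ ℕ) (c : A) :
    monomial m c ∈ (chainIdeal A a b).restrictScalars A ⊔
      restrictSupport A (reducedExponents a) := by
  let B := ∑ i, b i + 1
  let μ : (Fin (n + 1) →₀ ℕ) → ℕ := fun m => ∑ i : Fin (n + 1), m i * B ^ (i : ℕ)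
  have hμadd : ∀ p q, μ (p + q) = μ p + μ q := fun p q => by
    simp [μ, add_mul, Finset.sum_add_distrib]
  have hμsingle : ∀ i k, μ (Finsupp.single i k) = k * B ^ (i : ℕ) := fun i k => by
    simp [μ, Finsupp.single_apply, ite_mul]
  induction hN : μ m using Nat.strong_induction_on generalizing m c with
  | _ N ih =>
    by_cases hm : m ∈ reducedExponents a
    · refine Submodule.mem_sup_right ?_
      rw [mem_restrictSupport_iff]
      exact (Finset.coe_subset.mpr support_monomial_subset).trans (by simpa using hm)
    · obtain ⟨i, hi⟩ : ∃ i : Fin n, a i ≤ m i.succ := by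
        simpa [reducedExponents] using hm
      obtain ⟨r, rfl⟩ := exists_add_of_le (Finsupp.single_le_iff.mpr hi)
      have hlt : μ (Finsupp.single i.castSucc (b i) + r) < N := by
        rw [← hN, hμadd, hμadd, hμsingle, hμsingle, Fin.val_castSucc, Fin.val_succ, pow_succ']
        have hB : b i < B :=
          Nat.lt_succ_of_le (Finset.single_le_sum (fun _ _ => Nat.zero_le _) (Finset.mem_univ i))
        have hpow : 0 < B ^ (i : ℕ) := pow_pos (Nat.succ_pos _) _
        have h1 := Nat.mul_lt_mul_of_pos_right hB hpow
        have h2 := Nat.le_mul_of_pos_left (B * B ^ (i : ℕ)) (ha i)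
        omega
      have hgen : monomial r c * (X i.succ ^ a i + X i.castSucc ^ b i) ∈ chainIdeal A a b :=
        Ideal.mul_mem_left _ _ (Ideal.subset_span ⟨i, rfl⟩)
      have hsplit : monomial (Finsupp.single i.succ (a i) + r) c =
          monomial r c * (X i.succ ^ a i + X i.castSucc ^ b i) -
            monomial (Finsupp.single i.castSucc (b i) + r) c := by
        rw [X_pow_eq_monomial, X_pow_eq_monomial, mul_add, monomial_mul, monomial_mul, mul_one,
          add_comm r, add_comm r, add_sub_cancel_right]
      rw [hsplit]
      exact Submodule.sub_mem _ (Submodule.mem_sup_left hgen) (ih _ hlt _ _ rfl)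

lemma exists_sub_mem_restrictSupport (ha : ∀ i, 0 < a i) (p : MvPolynomial (Fin (n + 1)) A) :
    ∃ q ∈ restrictSupport A (reducedExponents a), p - q ∈ chainIdeal A a b := by
  have hp : p ∈ (chainIdeal A a b).restrictScalars A ⊔
      restrictSupport A (reducedExponents a) := by
    rw [p.as_sum]
    exact Submodule.sum_mem _ fun m _ => monomial_mem_sup a b ha m _
  obtain ⟨y, hy, q, hq, rfl⟩ := Submodule.mem_sup.mp hp
  exact ⟨q, hq, by simpa using hy⟩

end Reduction

section Parametrization

variable {A : Type*} [CommRing A] {σ : Type*} [Fintype σ]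

/-- The algebra homomorphism `z_i ↦ u i * t ^ w i`. -/
noncomputable def param (u : σ → Aˣ) (w : σ → ℕ) : MvPolynomial σ A →ₐ[A] Polynomial A :=
  aeval fun i => Polynomial.monomial (w i) (u i : A)

lemma param_monomial (u : σ → Aˣ) (w : σ → ℕ) (m : σ →₀ ℕ) (c : A) :
    param u w (monomial m c) =
      Polynomial.monomial (∑ i, w i * m i) (c * (∏ i, u i ^ m i : Aˣ)) := by
  rw [param, aeval_monomial, Finsupp.prod_fintype _ _ (by simp)]
  simp only [← Polynomial.C_mul_X_pow_eq_monomial, mul_pow, Finset.prod_mul_distrib, ← pow_mul,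
    Finset.prod_pow_eq_pow_sum, Polynomial.algebraMap_eq, Units.coe_prod, Units.val_pow_eq_pow_val,
    map_mul, map_prod, map_pow, mul_assoc]

lemma eq_zero_of_param_eq_zero (u : σ → Aˣ) (w : σ → ℕ) {S : Set (σ →₀ ℕ)}
    (hS : Set.InjOn (fun m : σ →₀ ℕ => ∑ i, w i * m i) S) {q : MvPolynomial σ A}
    (hq : q ∈ restrictSupport A S) (h : param u w q = 0) : q = 0 := by
  rw [mem_restrictSupport_iff] at hq
  ext m
  rw [coeff_zero]
  by_contra hm
  have hmem : m ∈ q.support := mem_support_iff.mpr hm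
  have hcoeff := congrArg (Polynomial.coeff · (∑ i, w i * m i)) h
  simp only [Polynomial.coeff_zero] at hcoeff
  rw [q.as_sum, map_sum, Polynomial.finsetSum_coeff, Finset.sum_eq_single_of_mem m hmem] at hcoeff
  · rw [param_monomial, Polynomial.coeff_monomial_same, Units.mul_left_eq_zero] at hcoeff
    exact hm hcoeff
  · intro m' hm' hne
    rw [param_monomial, Polynomial.coeff_monomial_of_ne]
    exact fun he => hne (hS (hq hm') (hq hmem) he.symm)

end Parametrization

end BinomialChain

open BinomialChain

/-- Let `A₀` be an integral domain, `n ≥ 0`, let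
`R_n = A₀[z_0, …, z_n]` be a polynomial ring in `n+1` variables, and let
`a_1, …, a_n, b_1, …, b_n` be positive integers (here indexed by `i : Fin n`,
with `a i` playing the role of `a_{i+1}`) such that `gcd(a_i, b_1 ⋯ b_i) = 1`
for each `i`.  Then the ideal `I_n = (z_1^{a_1} + z_0^{b_1}, …, z_n^{a_n} + z_{n-1}^{b_n})`
is a prime ideal of `R_n`. -/
theorem stmt_3 {A₀ : Type*} [CommRing A₀] [IsDomain A₀]
    (n : ℕ) (a b : Fin n → ℕ)
    (ha : ∀ i, 0 < a i) (hb : ∀ i, 0 < b i)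
    (hcop : ∀ i : Fin n, Nat.Coprime (a i) (∏ j ∈ Finset.Iic i, b j)) :
    (Ideal.span (Set.range fun i : Fin n =>
      (X i.succ : MvPolynomial (Fin (n + 1)) A₀) ^ a i + X i.castSucc ^ b i)).IsPrime := by
  let α : ℕ → ℕ := fun k => if h : k < n then a ⟨k, h⟩ else 1
  let β : ℕ → ℕ := fun k => if h : k < n then b ⟨k, h⟩ else 1
  have hα : ∀ i : Fin n, α i = a i := fun i => by simp [α]
  have hβ : ∀ i : Fin n, β i = b i := fun i => by simp [β]
  have hcop' : ∀ i < n, ∀ j ≤ i, (α i).Coprime (β j) := fun i hi j hj => by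
    have h := (hcop ⟨i, hi⟩).coprime_dvd_right
      (Finset.dvd_prod_of_mem b
        (Finset.mem_Iic.mpr (show (⟨j, hj.trans_lt hi⟩ : Fin n) ≤ _ from hj)))
    simpa [α, β, hi, hj.trans_lt hi] using h
  obtain ⟨s, hs⟩ := exists_signs α β n hcop'
  let φ := param (A := A₀) (fun i : Fin (n + 1) => Units.map (Int.castRingHom A₀) (s i))
    fun i => weight α β n i
  change (chainIdeal A₀ a b).IsPrime
  suffices h : chainIdeal A₀ a b = RingHom.ker φ from h ▸ RingHom.ker_isPrime φ
  have hle : chainIdeal A₀ a b ≤ RingHom.ker φ := by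
    rw [Ideal.span_le]
    rintro _ ⟨i, rfl⟩
    have hsign : ((s (i + 1) : ℤ) : A₀) ^ a i = -((s i : ℤ) : A₀) ^ b i := by
      have h := congrArg (fun u : ℤˣ => ((u : ℤ) : A₀)) (hs i i.isLt)
      simpa [hα, hβ] using h
    have hw := weight_succ_mul α β i.isLt
    rw [hα, hβ] at hw
    simp [φ, param, RingHom.mem_ker, Polynomial.monomial_pow, hw, hsign]
  refine le_antisymm hle fun p hp => ?_
  obtain ⟨q, hq, hpq⟩ := exists_sub_mem_restrictSupport (A := A₀) a b ha p
  have hφq : φ q = 0 := by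
    have h := hle hpq
    rw [RingHom.mem_ker] at h hp
    rwa [map_sub, hp, zero_sub, neg_eq_zero] at h
  have hinj : Set.InjOn (fun m : Fin (n + 1) →₀ ℕ => ∑ i : Fin (n + 1), weight α β n i * m i)
      (reducedExponents a) := fun m hm m' hm' h =>
    DFunLike.coe_injective (eq_of_sum_weight_eq α β n hcop' m m'
      (fun i => (hα i).symm ▸ hm i) (fun i => (hα i).symm ▸ hm' i) h)
  rwa [eq_zero_of_param_eq_zero _ _ hinj hq hφq, sub_zero] at hpq
end

section
/- Let K be a noetherian unique factorization domain, let n ≥ 0, let K[z_0, …, z_{n+1}] be a polynomial ring in n+2 variables over K, let a_1, …, a_n, b_1, …, b_n be positive integers such that gcd(a_i, b_1 ⋯ b_i) = 1 for each i, and let f ∈ K be nonzero. Then the ring A_n := K[z_0, …, z_{n+1}]/(f z_{i+1} + z_i^{a_i} + z_{i-1}^{b_i})_{1 ≤ i ≤ n} is a unique factorization domain, and its field of fractions is isomorphic to frac(K)(z_0, z_1), a purely transcendental extension of transcendence degree 2 over frac(K). -/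
set_option synthInstance.maxHeartbeats 1000000
set_option maxHeartbeats 1000000

open MvPolynomial

/-- The ring `A_n = K[z_0, …, z_{n+1}] / (f z_{i+1} + z_i^{a_i} + z_{i-1}^{b_i})_{1 ≤ i ≤ n}`,
with relations indexed by `i : Fin n` (so the index `i : Fin n` corresponds to the
relation with subscript `i+1`). -/
abbrev Statement4Ring (K : Type*) [CommRing K] (n : ℕ) (f : K) (a b : Fin n → ℕ) :=
  MvPolynomial (Fin (n + 2)) K ⧸
    Ideal.span (Set.range fun i : Fin n =>
      C f * X i.succ.succ + X i.succ.castSucc ^ a i + X i.castSucc.castSucc ^ b i)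

/-- A factor which no prime in `s` divides can be cancelled against products of elements of `s`. -/
theorem dvd_of_dvd_multiset_prod_mul {B : Type*} [CommRing B] [IsDomain B] {s : Multiset B}
    (hs : ∀ p ∈ s, Prime p) {x : B} (hx : ∀ p ∈ s, ¬ p ∣ x) (y : B) (h : x ∣ s.prod * y) :
    x ∣ y := by
  induction s using Multiset.induction_on generalizing y with
  | empty => simpa using h
  | cons p s ih =>
    have hp := hs p (Multiset.mem_cons_self p s)
    refine ih (fun q hq => hs q (Multiset.mem_cons_of_mem hq))
      (fun q hq => hx q (Multiset.mem_cons_of_mem hq)) y ?_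
    obtain ⟨c, hc⟩ := h
    rw [Multiset.prod_cons, mul_assoc] at hc
    obtain ⟨c', rfl⟩ := (hp.dvd_or_dvd (Dvd.intro _ hc)).resolve_left
      (hx p (Multiset.mem_cons_self p s))
    exact ⟨c', mul_left_cancel₀ hp.ne_zero (by rw [hc]; ring)⟩

/-- A form of Nagata's criterion: a noetherian domain `B` which becomes equal to a unique
factorization subdomain `A` after inverting `f`, a product of primes of `B`, is factorial. -/
theorem uniqueFactorizationMonoid_of_forall_pow_mul_mem_range {A B : Type*} [CommRing A]
    [IsDomain A] [UniqueFactorizationMonoid A] [CommRing B] [IsDomain B] [IsNoetherianRing B]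
    (φ : A →+* B) (hφ : Function.Injective φ) (f : A) (s : Multiset B) (hs : ∀ p ∈ s, Prime p)
    (hsf : s.prod = φ f) (hB : ∀ y : B, ∃ (N : ℕ) (c : A), φ f ^ N * y = φ c) :
    UniqueFactorizationMonoid B := by
  have hf0 : φ f ≠ 0 := by
    rw [← hsf]
    exact Multiset.prod_ne_zero fun h => (hs 0 h).ne_zero rfl
  refine UniqueFactorizationMonoid.iff_exists_prime_mem_of_isPrime.2 fun P hP hPp => ?_
  by_cases hfP : φ f ∈ P
  · rw [← hsf, hPp.multiset_prod_mem_iff_exists_mem] at hfP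
    obtain ⟨p, hp, hpP⟩ := hfP
    exact ⟨p, hpP, hs p hp⟩
  have hcomap : P.comap φ ≠ ⊥ := by
    obtain ⟨y, hyP, hy0⟩ := Submodule.exists_mem_ne_zero_of_ne_bot hP
    obtain ⟨N, c, hc⟩ := hB y
    intro hbot
    have hcP : c ∈ P.comap φ := by
      rw [Ideal.mem_comap, ← hc]
      exact P.mul_mem_left _ hyP
    rw [hbot, Ideal.mem_bot] at hcP
    rw [hcP, map_zero] at hc
    exact mul_ne_zero (pow_ne_zero _ hf0) hy0 hc
  obtain ⟨q, hqP, hq⟩ := (hPp.comap φ).exists_mem_prime_of_ne_bot hcomap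
  have hqf : ¬ q ∣ f := fun h => hfP ((P.comap φ).mem_of_dvd h hqP)
  have hφq : φ q ≠ 0 := (map_ne_zero_iff φ hφ).2 hq.ne_zero
  obtain ⟨x, ⟨hxq, M, hM⟩, hmin⟩ := (wellFounded_dvdNotUnit (α := B)).has_min
    {x | x ∣ φ q ∧ ∃ M : ℕ, φ q ∣ φ f ^ M * x} ⟨φ q, dvd_rfl, 0, by simp⟩
  have hx0 : x ≠ 0 := ne_zero_of_dvd_ne_zero hφq hxq
  have hxP : x ∈ P := (hPp.mem_or_mem (P.mem_of_dvd hM hqP)).resolve_left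
    fun h => hfP (hPp.mem_of_pow_mem _ h)
  have hsx : ∀ p ∈ s, ¬ p ∣ x := by
    rintro p hp ⟨x', rfl⟩
    refine hmin x' ⟨(Dvd.intro_left _ rfl).trans hxq, M + 1, ?_⟩
      ⟨right_ne_zero_of_mul hx0, p, (hs p hp).not_isUnit, mul_comm _ _⟩
    obtain ⟨t, ht⟩ := Multiset.dvd_prod hp
    refine hM.trans ⟨t, ?_⟩
    rw [pow_succ, ← hsf, ht]
    ring
  have hcancel : ∀ (N : ℕ) (y : B), x ∣ φ f ^ N * y → x ∣ y := by
    intro N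
    induction N with
    | zero => simp
    | succ N ih =>
      intro y h
      refine ih y (dvd_of_dvd_multiset_prod_mul hs hsx _ ?_)
      rwa [hsf, ← mul_assoc, ← pow_succ']
  refine ⟨x, hxP, hx0, fun hu => hPp.ne_top (P.eq_top_of_isUnit_mem hxP hu), ?_⟩
  intro y z hyz
  obtain ⟨N, c, hc⟩ := hB y
  obtain ⟨L, d, hd⟩ := hB z
  obtain ⟨w, hw⟩ : φ q ∣ φ f ^ M * φ c * φ d := by
    refine hM.trans ?_
    rw [← hc, ← hd]
    obtain ⟨v, hv⟩ := hyz
    exact ⟨φ f ^ N * φ f ^ L * v, by linear_combination (φ f ^ M * φ f ^ N * φ f ^ L) * hv⟩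
  obtain ⟨J, e, he⟩ := hB w
  have hdvd : q ∣ f ^ J * f ^ M * (c * d) := by
    refine ⟨e, hφ ?_⟩
    simp only [map_mul, map_pow, ← he]
    linear_combination φ f ^ J * hw
  have hqpow : ∀ k, ¬ q ∣ f ^ k := fun k h => hqf (hq.dvd_of_dvd_pow h)
  rw [mul_assoc] at hdvd
  have hcd := (hq.dvd_or_dvd ((hq.dvd_or_dvd hdvd).resolve_left (hqpow _))).resolve_left (hqpow _)
  refine (hq.dvd_or_dvd hcd).imp (fun h => hcancel N y ?_) (fun h => hcancel L z ?_)
  · rw [hc]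
    exact hxq.trans (map_dvd φ h)
  · rw [hd]
    exact hxq.trans (map_dvd φ h)

/-- If `a` is coprime to `N`, the powers `(τ X ^ N) ^ e` with `e < a` are linearly independent over
the subring of polynomials in `ε X ^ a`. -/
theorem eq_zero_of_sum_comp_mul_pow_eq_zero {k : Type*} [CommRing k] {a N : ℕ}
    (ha : 0 < a) (haN : a.Coprime N) {ε τ : k} (hε : IsUnit ε) (hτ : IsUnit τ)
    (c : ℕ → Polynomial k)
    (h : ∑ e ∈ Finset.range a, (c e).comp (Polynomial.C ε * Polynomial.X ^ a) *
      (Polynomial.C τ * Polynomial.X ^ N) ^ e = 0) (e : ℕ) (he : e < a) : c e = 0 := by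
  have hcomp : ∀ e, (c e).comp (Polynomial.C ε * Polynomial.X ^ a) =
      Polynomial.expand k a ((c e).comp (Polynomial.C ε * Polynomial.X)) := by
    intro e
    rw [Polynomial.expand_eq_comp_X_pow, Polynomial.comp_assoc]
    simp
  ext m
  have hcoeff := congrArg (fun P : Polynomial k => P.coeff (m * a + N * e)) h
  simp only [Polynomial.finsetSum_coeff, Polynomial.coeff_zero] at hcoeff
  rw [Finset.sum_eq_single_of_mem e (Finset.mem_range.2 he)] at hcoeff
  · rw [mul_pow, ← pow_mul, ← mul_assoc, Polynomial.coeff_mul_X_pow, hcomp, ← Polynomial.C_pow,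
      Polynomial.coeff_mul_C, Polynomial.coeff_expand_mul ha, Polynomial.comp_C_mul_X_coeff] at hcoeff
    simpa using ((hε.pow m).mul_left_eq_zero).1 (((hτ.pow e).mul_left_eq_zero).1 hcoeff)
  · intro e' he' hne
    rw [mul_pow, ← pow_mul, ← mul_assoc, Polynomial.coeff_mul_X_pow', hcomp, ← Polynomial.C_pow,
      Polynomial.coeff_mul_C, Polynomial.coeff_expand ha]
    split_ifs with h1 h2
    · exfalso
      have h3 : N * e' ≡ m * a + N * e [MOD a] := (Nat.modEq_iff_dvd' h1).2 h2
      have h4 : m * a + N * e ≡ N * e [MOD a] := by simp [Nat.ModEq]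
      have h5 : e' ≡ e [MOD a] := Nat.ModEq.cancel_left_of_coprime haN (h3.trans h4)
      exact hne (Nat.ModEq.eq_of_lt_of_lt h5 (Finset.mem_range.1 he') he)
    · simp
    · rfl

/-- A homomorphism `ψ : A → k[t][s]` with kernel `(p)`, sending `x` to `± t ^ β` and `y` to `s`,
whose image is closed under taking coefficients with respect to `s`. -/
structure IsMonomialReduction {k A : Type*} [CommRing k] [CommRing A] (p x y : A) (β : ℕ) (σ : k)
    (ψ : A →+* Polynomial (Polynomial k)) : Prop where
  ker_eq : RingHom.ker ψ = Ideal.span {p}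
  sign : σ = 1 ∨ σ = -1
  map_left : ψ x = Polynomial.C (Polynomial.C σ * Polynomial.X ^ β)
  map_right : ψ y = Polynomial.X
  coeff_mem : ∀ r i, ∃ c, ψ c = Polynomial.C ((ψ r).coeff i)

namespace IsMonomialReduction

variable {k A : Type*} [CommRing k] [CommRing A] {p x y : A} {β : ℕ} {σ : k}
  {ψ : A →+* Polynomial (Polynomial k)}

/-- The specialization `t ↦ ε t ^ a`, `s ↦ τ t ^ N` composed with `ψ`. -/
noncomputable def specialize (ψ : A →+* Polynomial (Polynomial k)) (a N : ℕ) (ε τ : k) :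
    A →+* Polynomial k :=
  (Polynomial.eval₂RingHom (Polynomial.compRingHom (Polynomial.C ε * Polynomial.X ^ a))
    (Polynomial.C τ * Polynomial.X ^ N)).comp ψ

theorem specialize_of_eq_C {a N : ℕ} {ε τ : k} {r : A} {c : Polynomial k}
    (hr : ψ r = Polynomial.C c) :
    specialize ψ a N ε τ r = c.comp (Polynomial.C ε * Polynomial.X ^ a) := by
  simp [specialize, hr]

theorem specialize_right (h : IsMonomialReduction p x y β σ ψ) (a N : ℕ) (ε τ : k) :
    specialize ψ a N ε τ y = Polynomial.C τ * Polynomial.X ^ N := by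
  simp [specialize, h.map_right]

theorem map_self (h : IsMonomialReduction p x y β σ ψ) : ψ p = 0 := by
  rw [← RingHom.mem_ker, h.ker_eq]
  exact Ideal.mem_span_singleton_self p

theorem specialize_relation (h : IsMonomialReduction p x y β σ ψ) {a b : ℕ} {ε τ : k}
    (hετ : τ ^ a + σ ^ b * ε ^ (b * β) = 0) :
    specialize ψ a (b * β) ε τ (y ^ a + x ^ b) = 0 := by
  rw [map_add, map_pow, map_pow, h.specialize_right, specialize_of_eq_C h.map_left]
  simp only [Polynomial.mul_comp, Polynomial.C_comp, Polynomial.pow_comp, Polynomial.X_comp]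
  have := congrArg (Polynomial.C (R := k)) hετ
  simp only [map_add, map_mul, map_pow, map_zero] at this
  linear_combination (Polynomial.X ^ (a * (b * β))) * this

/-- There are signs for which the specialization kills the next relation. -/
theorem exists_signs (h : IsMonomialReduction p x y β σ ψ) {a b : ℕ}
    (hab : a.Coprime (b * β)) : ∃ ε τ : k, IsUnit ε ∧ (τ = 1 ∨ τ = -1) ∧
      τ ^ a + σ ^ b * ε ^ (b * β) = 0 := by
  rcases Nat.even_or_odd a with hae | hao
  · have hodd : Odd (b * β) := by
      rw [← Nat.not_even_iff_odd]
      intro he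
      exact absurd (Nat.dvd_gcd hae.two_dvd he.two_dvd) (by rw [hab]; decide)
    obtain ⟨hb, -⟩ := Nat.odd_mul.1 hodd
    rcases h.sign with rfl | rfl
    · exact ⟨-1, 1, by simp, by simp, by simp [hodd.neg_one_pow]⟩
    · exact ⟨1, 1, by simp, by simp, by simp [hb.neg_one_pow]⟩
  · refine ⟨1, -σ ^ b, by simp, ?_, ?_⟩
    · rcases h.sign with rfl | rfl
      · simp
      · rcases neg_one_pow_eq_or k b with hb | hb <;> simp [hb]
    · have : (σ ^ b) ^ a = σ ^ b := by
        rcases h.sign with rfl | rfl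
        · simp
        · rw [← pow_mul, mul_comm, pow_mul, hao.neg_one_pow]
      rw [hao.neg_pow, this]
      simp

theorem mem_span_of_specialize_eq_zero [Nontrivial k] (h : IsMonomialReduction p x y β σ ψ)
    {a b N : ℕ} {ε τ : k} (ha : 0 < a) (haN : a.Coprime N) (hε : IsUnit ε) (hτ : IsUnit τ)
    (hg : specialize ψ a N ε τ (y ^ a + x ^ b) = 0) {r : A} (hr : specialize ψ a N ε τ r = 0) :
    r ∈ Ideal.span {p, y ^ a + x ^ b} := by
  have : Nontrivial A := ψ.domain_nontrivial
  have hp_mem : ∀ u, ψ u = 0 → u ∈ Ideal.span {p, y ^ a + x ^ b} := by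
    intro u hu
    rw [← RingHom.mem_ker, h.ker_eq] at hu
    exact Ideal.span_mono (by simp) hu
  let S : Subring A := (Polynomial.C : Polynomial k →+* _).range.comap ψ
  have hxS : x ∈ S := ⟨_, h.map_left.symm⟩
  choose c hc using h.coeff_mem r
  have hcS : ∀ i, c i ∈ S := fun i => ⟨_, (hc i).symm⟩
  let P : Polynomial S := ∑ i ∈ Finset.range ((ψ r).natDegree + 1),
    Polynomial.monomial i ⟨c i, hcS i⟩
  have hP : ψ (r - P.eval₂ S.subtype y) = 0 := by
    rw [map_sub, sub_eq_zero, Polynomial.eval₂_finsetSum, map_sum]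
    conv_lhs => rw [Polynomial.as_sum_range_C_mul_X_pow (ψ r)]
    refine Finset.sum_congr rfl fun i _ => ?_
    rw [Polynomial.eval₂_monomial, map_mul, map_pow, h.map_right]
    exact congrArg (· * Polynomial.X ^ i) (hc i).symm
  let H : Polynomial S := Polynomial.X ^ a + Polynomial.C (⟨x, hxS⟩ ^ b)
  have hH : H.Monic := Polynomial.monic_X_pow_add_C _ ha.ne'
  have hHeval : H.eval₂ S.subtype y = y ^ a + x ^ b := by
    simp [H]
  have hdecomp : P.eval₂ S.subtype y =
      (P %ₘ H).eval₂ S.subtype y + (y ^ a + x ^ b) * (P /ₘ H).eval₂ S.subtype y := by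
    rw [← hHeval, ← Polynomial.eval₂_mul, ← Polynomial.eval₂_add, Polynomial.modByMonic_add_div]
  have hdeg : (P %ₘ H).natDegree < a := by
    have hHdeg : H.natDegree = a := Polynomial.natDegree_X_pow_add_C
    refine (Polynomial.natDegree_modByMonic_lt P hH ?_).trans_eq hHdeg
    intro h1
    rw [h1, Polynomial.natDegree_one] at hHdeg
    omega
  choose d hd using fun e => ((P %ₘ H).coeff e).2
  have hrem : specialize ψ a N ε τ ((P %ₘ H).eval₂ S.subtype y) = 0 := by
    have h1 : specialize ψ a N ε τ (r - P.eval₂ S.subtype y) = 0 := by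
      rw [specialize, RingHom.comp_apply, hP, map_zero]
    rw [hdecomp, map_sub, hr, map_add, map_mul, hg] at h1
    simpa using h1
  have hd0 : ∀ e < a, d e = 0 := by
    refine eq_zero_of_sum_comp_mul_pow_eq_zero ha haN hε hτ d ?_
    rw [Polynomial.eval₂_eq_sum_range' _ hdeg, map_sum] at hrem
    rw [← hrem]
    refine Finset.sum_congr rfl fun e _ => ?_
    rw [map_mul, map_pow, h.specialize_right]
    congr 1
    exact (specialize_of_eq_C (hd e).symm).symm
  have hrem_mem : (P %ₘ H).eval₂ S.subtype y ∈ Ideal.span {p, y ^ a + x ^ b} := by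
    rw [Polynomial.eval₂_eq_sum_range' _ hdeg]
    refine Ideal.sum_mem _ fun e he => Ideal.mul_mem_right _ _ (hp_mem _ ?_)
    have := hd e
    rw [hd0 e (Finset.mem_range.1 he), map_zero] at this
    exact this.symm
  rw [← sub_add_cancel r (P.eval₂ S.subtype y)]
  refine Ideal.add_mem _ (hp_mem _ hP) ?_
  rw [hdecomp]
  exact Ideal.add_mem _ hrem_mem (Ideal.mul_mem_right _ _ (Ideal.subset_span (by simp)))

/-- The reduction extends along `A → A[z] / (f z + y ^ a + x ^ b)`. -/
theorem exists_step [Nontrivial k] (h : IsMonomialReduction p x y β σ ψ) {A' : Type*}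
    [CommRing A'] (Φ : Polynomial A →+* A') (hΦ : Function.Surjective Φ) {f : A} (hpf : p ∣ f)
    {a b : ℕ} (ha : 0 < a) (hab : a.Coprime (b * β))
    (hker : RingHom.ker Φ =
      Ideal.span {Polynomial.C f * Polynomial.X + Polynomial.C (y ^ a + x ^ b)}) :
    ∃ (τ : k) (ψ' : A' →+* Polynomial (Polynomial k)),
      IsMonomialReduction (Φ (Polynomial.C p)) (Φ (Polynomial.C y)) (Φ Polynomial.X)
        (b * β) τ ψ' := by
  obtain ⟨ε, τ, hε, hτ, hετ⟩ := h.exists_signs hab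
  have hτu : IsUnit τ := by rcases hτ with rfl | rfl <;> simp
  have hg := h.specialize_relation hετ
  set χ := specialize ψ a (b * β) ε τ with hχ
  have hχp : χ p = 0 := by rw [hχ, specialize, RingHom.comp_apply, h.map_self, map_zero]
  have hle : RingHom.ker Φ ≤ RingHom.ker (Polynomial.mapRingHom χ) := by
    rw [hker, Ideal.span_singleton_le_iff_mem, RingHom.mem_ker, map_add, map_mul]
    obtain ⟨c, rfl⟩ := hpf
    simp only [Polynomial.coe_mapRingHom, Polynomial.map_C, hg, map_mul, hχp]
    simp
  have hlift := RingHom.liftOfRightInverse_comp_apply Φ _ (Function.rightInverse_surjInv hΦ)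
    ⟨Polynomial.mapRingHom χ, hle⟩
  set ψ' := RingHom.liftOfRightInverse Φ _ (Function.rightInverse_surjInv hΦ)
    ⟨Polynomial.mapRingHom χ, hle⟩
  simp only [Polynomial.coe_mapRingHom] at hlift
  refine ⟨τ, ψ', le_antisymm ?_ ?_, hτ, ?_, ?_, ?_⟩
  · intro r' hr'
    obtain ⟨P, rfl⟩ := hΦ r'
    rw [RingHom.mem_ker, hlift] at hr'
    have hspan : ∀ u ∈ Ideal.span {p, y ^ a + x ^ b},
        Φ (Polynomial.C u) ∈ Ideal.span {Φ (Polynomial.C p)} := by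
      intro u hu
      have hfg : Φ (Polynomial.C f * Polynomial.X + Polynomial.C (y ^ a + x ^ b)) = 0 := by
        rw [← RingHom.mem_ker, hker]
        exact Ideal.mem_span_singleton_self _
      obtain ⟨c, rfl⟩ := hpf
      obtain ⟨v, w, rfl⟩ := Ideal.mem_span_pair.1 hu
      rw [Ideal.mem_span_singleton]
      refine ⟨Φ (Polynomial.C v) - Φ (Polynomial.C w) * Φ (Polynomial.C c) * Φ Polynomial.X, ?_⟩
      rw [map_add, map_mul, Polynomial.C_mul, map_mul] at hfg
      rw [map_add, map_mul, map_mul, map_add, map_mul, map_mul]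
      linear_combination Φ (Polynomial.C w) * hfg
    rw [Polynomial.as_sum_range_C_mul_X_pow P, map_sum]
    refine Ideal.sum_mem _ fun i _ => ?_
    rw [map_mul]
    refine Ideal.mul_mem_right _ _ (hspan _ ?_)
    refine h.mem_span_of_specialize_eq_zero ha hab hε hτu hg ?_
    simpa using congrArg (fun Q => Polynomial.coeff Q i) hr'
  · rw [Ideal.span_singleton_le_iff_mem, RingHom.mem_ker, hlift, Polynomial.map_C, hχp, map_zero]
  · rw [hlift, Polynomial.map_C, hχ, h.specialize_right]
  · rw [hlift, Polynomial.map_X]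
  · intro r' i
    obtain ⟨P, rfl⟩ := hΦ r'
    exact ⟨Φ (Polynomial.C (P.coeff i)), by
      rw [hlift, hlift, Polynomial.map_C, Polynomial.coeff_map]⟩

end IsMonomialReduction

/-- A domain `B` which becomes equal to a subring `A` after inverting `f` has the same fraction
field as `A`. -/
theorem exists_fractionRing_ringEquiv {A B : Type*} [CommRing A] [IsDomain A] [CommRing B]
    [IsDomain B] (φ : A →+* B) (hφ : Function.Injective φ) {f : A} (hf : f ≠ 0)
    (hB : ∀ y : B, ∃ (N : ℕ) (c : A), φ f ^ N * y = φ c) :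
    ∃ e : FractionRing B ≃+* FractionRing A,
      ∀ u, e (algebraMap B (FractionRing B) (φ u)) = algebraMap A (FractionRing A) u := by
  let ι : A →+* FractionRing B := (algebraMap B (FractionRing B)).comp φ
  have hι : Function.Injective ι := (IsFractionRing.injective B (FractionRing B)).comp hφ
  let : Algebra A (FractionRing B) := ι.toAlgebra
  have hfrac : ∀ y : B, ∃ c d : A, ι d ≠ 0 ∧ algebraMap B (FractionRing B) y = ι c / ι d := by
    intro y
    obtain ⟨N, c, hc⟩ := hB y
    have h0 : ι (f ^ N) ≠ 0 := (map_ne_zero_iff ι hι).2 (pow_ne_zero N hf)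
    refine ⟨c, f ^ N, h0, ?_⟩
    rw [eq_div_iff h0, mul_comm]
    simp only [ι, RingHom.comp_apply, ← hc, map_mul, map_pow]
  have : IsFractionRing A (FractionRing B) := by
    have : FaithfulSMul A (FractionRing B) := (faithfulSMul_iff_algebraMap_injective _ _).2 hι
    refine IsFractionRing.of_field A (FractionRing B) fun z => ?_
    obtain ⟨y, w, -, rfl⟩ := IsFractionRing.div_surjective (A := B) z
    obtain ⟨c, d, hd, h1⟩ := hfrac y
    obtain ⟨c', d', hd', h2⟩ := hfrac w
    refine ⟨c * d', d * c', ?_⟩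
    change _ = ι _ / ι _
    rw [h1, h2, map_mul, map_mul, div_div_div_eq]
  exact ⟨(IsLocalization.algEquiv (nonZeroDivisors A) (FractionRing B)
    (FractionRing A)).toRingEquiv, fun u => (IsLocalization.algEquiv (nonZeroDivisors A)
    (FractionRing B) (FractionRing A)).commutes u⟩

/-- The quotient of a commutative ring by a prime element is a domain. -/
theorem isDomain_quotient_span_singleton {K : Type*} [CommRing K] {p : K}
    (hp : Prime p) : IsDomain (K ⧸ Ideal.span {p}) :=
  (Ideal.Quotient.isDomain_iff_prime _).2 ((Ideal.span_singleton_prime hp.ne_zero).2 hp)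

/-- The properties of the pair `(z_n, z_{n+1})` in `A_n` which are propagated along the tower
`A_0 → A_1 → ⋯`. -/
structure IsFactorialStage (K : Type*) [CommRing K] [IsDomain K] (f : K) (β : ℕ)
    (A : Type*) [CommRing A] [Algebra K A] (x y : A) : Prop where
  isDomain : IsDomain A
  uniqueFactorizationMonoid : UniqueFactorizationMonoid A
  algebraMap_injective : Function.Injective (algebraMap K A)
  exists_ringEquiv : ∃ e : FractionRing A ≃+* FractionRing (MvPolynomial (Fin 2) K), ∀ u : K,
    e (algebraMap A (FractionRing A) (algebraMap K A u)) =
      algebraMap (MvPolynomial (Fin 2) K) (FractionRing (MvPolynomial (Fin 2) K)) (C u)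
  exists_reduction : ∀ p : K, Prime p → p ∣ f →
    ∃ (σ : K ⧸ Ideal.span {p}) (ψ : A →+* Polynomial (Polynomial (K ⧸ Ideal.span {p}))),
      IsMonomialReduction (algebraMap K A p) x y β σ ψ

namespace IsFactorialStage

variable {K : Type*} [CommRing K] [IsDomain K] {f : K} {β : ℕ} {A : Type*} [CommRing A]
  [Algebra K A] {x y : A}

theorem prime_algebraMap (h : IsFactorialStage K f β A x y) {p : K} (hp : Prime p)
    (hpf : p ∣ f) : Prime (algebraMap K A p) := by
  have := isDomain_quotient_span_singleton hp
  obtain ⟨σ, ψ, hψ⟩ := h.exists_reduction p hp hpf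
  rw [← Ideal.span_singleton_prime
    ((map_ne_zero_iff _ h.algebraMap_injective).2 hp.ne_zero), ← hψ.ker_eq]
  exact RingHom.ker_isPrime ψ

theorem not_dvd_relation (h : IsFactorialStage K f β A x y) {p : K} (hp : Prime p)
    (hpf : p ∣ f) {a b : ℕ} (ha : 0 < a) : ¬ algebraMap K A p ∣ y ^ a + x ^ b := by
  have := isDomain_quotient_span_singleton hp
  obtain ⟨σ, ψ, hψ⟩ := h.exists_reduction p hp hpf
  rw [← Ideal.mem_span_singleton, ← hψ.ker_eq, RingHom.mem_ker, map_add, map_pow, map_pow,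
    hψ.map_left, hψ.map_right, ← Polynomial.C_pow]
  exact (Polynomial.monic_X_pow_add_C _ ha.ne').ne_zero

theorem prime_relation [UniqueFactorizationMonoid K] (h : IsFactorialStage K f β A x y)
    (hf : f ≠ 0) {a b : ℕ} (ha : 0 < a) :
    Prime (Polynomial.C (algebraMap K A f) * Polynomial.X + Polynomial.C (y ^ a + x ^ b)) := by
  have := h.isDomain
  have := h.uniqueFactorizationMonoid
  have hf0 := (map_ne_zero_iff _ h.algebraMap_injective).2 hf
  refine (Polynomial.irreducible_C_mul_X_add_C hf0 ?_).prime
  refine (UniqueFactorizationMonoid.isRelPrime_iff_no_prime_factors hf0).2 ?_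
  intro q hqf hqg hq
  obtain ⟨s, hs, u, hu⟩ := UniqueFactorizationMonoid.exists_prime_factors f hf
  rw [← hu, map_mul] at hqf
  have hqs := (hq.dvd_or_dvd hqf).resolve_right
    fun h' => hq.not_isUnit (isUnit_of_dvd_unit h' (u.isUnit.map _))
  rw [map_multiset_prod] at hqs
  obtain ⟨_, hr, hqr⟩ := hq.exists_mem_multiset_dvd hqs
  obtain ⟨p, hp, rfl⟩ := Multiset.mem_map.1 hr
  have hpf : p ∣ f := (Multiset.dvd_prod hp).trans ⟨u, hu.symm⟩
  have hass := hq.associated_of_dvd (h.prime_algebraMap (hs p hp) hpf) hqr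
  exact h.not_dvd_relation (hs p hp) hpf ha (hass.symm.dvd.trans hqg)

theorem step [UniqueFactorizationMonoid K] (h : IsFactorialStage K f β A x y) (hf : f ≠ 0)
    {a b : ℕ} (ha : 0 < a) (hab : a.Coprime (b * β)) {A' : Type*} [CommRing A'] [Algebra K A']
    [IsNoetherianRing A'] (Φ : Polynomial A →+* A') (hΦ : Function.Surjective Φ)
    (hΦK : ∀ u, Φ (Polynomial.C (algebraMap K A u)) = algebraMap K A' u)
    (hker : RingHom.ker Φ = Ideal.span
      {Polynomial.C (algebraMap K A f) * Polynomial.X + Polynomial.C (y ^ a + x ^ b)}) :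
    IsFactorialStage K f (b * β) A' (Φ (Polynomial.C y)) (Φ Polynomial.X) := by
  have := h.isDomain
  have := h.uniqueFactorizationMonoid
  have hf0 := (map_ne_zero_iff _ h.algebraMap_injective).2 hf
  have hprime := h.prime_relation hf ha (b := b)
  have hdom : IsDomain A' := by
    have : (RingHom.ker Φ).IsPrime := by
      rw [hker]
      exact (Ideal.span_singleton_prime hprime.ne_zero).2 hprime
    exact (RingHom.quotientKerEquivOfSurjective hΦ).symm.toMulEquiv.isDomain
  let φ : A →+* A' := Φ.comp Polynomial.C
  have hφ : Function.Injective φ := by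
    rw [injective_iff_map_eq_zero]
    intro c hc
    have hmem : Polynomial.C c ∈ RingHom.ker Φ := hc
    rw [hker, Ideal.mem_span_singleton] at hmem
    by_contra hc0
    have := Polynomial.degree_le_of_dvd hmem (Polynomial.C_ne_zero.2 hc0)
    rw [Polynomial.degree_linear hf0, Polynomial.degree_C hc0] at this
    exact absurd this (by decide)
  have hinj : Function.Injective (algebraMap K A') := by
    have : ⇑(algebraMap K A') = φ ∘ algebraMap K A := funext fun u => (hΦK u).symm
    rw [this]
    exact hφ.comp h.algebraMap_injective
  have hrel : φ (algebraMap K A f) * Φ Polynomial.X = φ (-(y ^ a + x ^ b)) := by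
    have : Φ (Polynomial.C (algebraMap K A f) * Polynomial.X + Polynomial.C (y ^ a + x ^ b)) = 0 := by
      rw [← RingHom.mem_ker, hker]
      exact Ideal.mem_span_singleton_self _
    rw [map_add, map_mul] at this
    rw [map_neg]
    exact eq_neg_of_add_eq_zero_left this
  have hB : ∀ z : A', ∃ (N : ℕ) (c : A), φ (algebraMap K A f) ^ N * z = φ c := by
    intro z
    obtain ⟨P, rfl⟩ := hΦ z
    induction P using Polynomial.induction_on' with
    | add P Q hP hQ =>
      obtain ⟨N, c, hc⟩ := hP
      obtain ⟨M, d, hd⟩ := hQ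
      refine ⟨N + M, algebraMap K A f ^ M * c + algebraMap K A f ^ N * d, ?_⟩
      rw [map_add, map_add, map_mul, map_mul, map_pow, map_pow]
      linear_combination φ (algebraMap K A f) ^ M * hc + φ (algebraMap K A f) ^ N * hd
    | monomial N c =>
      refine ⟨N, (-(y ^ a + x ^ b)) ^ N * c, ?_⟩
      rw [map_mul, map_pow, ← hrel, ← Polynomial.C_mul_X_pow_eq_monomial, map_mul, map_pow]
      change _ * (φ c * _) = _
      ring
  have hred : ∀ p : K, Prime p → p ∣ f →
      ∃ (σ : K ⧸ Ideal.span {p}) (ψ : A' →+* Polynomial (Polynomial (K ⧸ Ideal.span {p}))),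
        IsMonomialReduction (algebraMap K A' p) (Φ (Polynomial.C y)) (Φ Polynomial.X)
          (b * β) σ ψ := by
    intro p hp hpf
    have := isDomain_quotient_span_singleton hp
    obtain ⟨σ, ψ, hψ⟩ := h.exists_reduction p hp hpf
    rw [← hΦK]
    exact hψ.exists_step Φ hΦ (map_dvd _ hpf) ha hab hker
  have hprime' : ∀ p : K, Prime p → p ∣ f → Prime (algebraMap K A' p) := by
    intro p hp hpf
    have := isDomain_quotient_span_singleton hp
    obtain ⟨σ, ψ, hψ⟩ := hred p hp hpf
    rw [← Ideal.span_singleton_prime ((map_ne_zero_iff _ hinj).2 hp.ne_zero), ← hψ.ker_eq]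
    exact RingHom.ker_isPrime ψ
  refine ⟨hdom, ?_, hinj, ?_, hred⟩
  · obtain ⟨s, hs, u, hu⟩ := UniqueFactorizationMonoid.exists_prime_factors f hf
    refine uniqueFactorizationMonoid_of_forall_pow_mul_mem_range φ hφ
      (algebraMap K A s.prod) (s.map (algebraMap K A')) ?_ ?_ ?_
    · intro q hq
      obtain ⟨p, hp, rfl⟩ := Multiset.mem_map.1 hq
      exact hprime' p (hs p hp) ((Multiset.dvd_prod hp).trans ⟨u, hu.symm⟩)
    · rw [← map_multiset_prod]
      exact (hΦK _).symm
    · intro z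
      obtain ⟨N, c, hc⟩ := hB z
      refine ⟨N, algebraMap K A ↑u⁻¹ ^ N * c, ?_⟩
      have hsu : φ (algebraMap K A s.prod) =
          φ (algebraMap K A ↑u⁻¹) * φ (algebraMap K A f) := by
        rw [← map_mul, ← map_mul, ← hu, mul_comm s.prod, Units.inv_mul_cancel_left]
      rw [hsu, map_mul, map_pow, ← hc]
      ring
  · obtain ⟨e, he⟩ := h.exists_ringEquiv
    obtain ⟨e', he'⟩ := exists_fractionRing_ringEquiv φ hφ hf0 hB
    refine ⟨e'.trans e, fun u => ?_⟩
    rw [← hΦK, RingEquiv.trans_apply, ← he]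
    exact congrArg e (he' _)

end IsFactorialStage

theorem IsFactorialStage.of_algEquiv {K : Type*} [CommRing K] [IsDomain K]
    [UniqueFactorizationMonoid K] (f : K) {A : Type*} [CommRing A] [Algebra K A]
    (e : MvPolynomial (Fin 2) K ≃ₐ[K] A) : IsFactorialStage K f 1 A (e (X 0)) (e (X 1)) := by
  have hdom : IsDomain A := e.symm.toMulEquiv.isDomain
  refine ⟨hdom, e.toMulEquiv.uniqueFactorizationMonoid inferInstance, ?_, ?_, ?_⟩
  · have : ⇑(algebraMap K A) = e ∘ C := funext fun u => (e.commutes u).symm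
    rw [this]
    exact e.injective.comp (C_injective _ _)
  · refine ⟨IsFractionRing.ringEquivOfRingEquiv e.symm.toRingEquiv, fun u => ?_⟩
    rw [IsFractionRing.ringEquivOfRingEquiv_algebraMap]
    exact congrArg _ (e.symm.commutes u)
  · intro p hp hpf
    let k := K ⧸ Ideal.span {p}
    let j : MvPolynomial (Fin 2) k ≃+* Polynomial (Polynomial k) := RingEquiv.ofRingHom
      (eval₂Hom (Polynomial.C.comp Polynomial.C) ![Polynomial.C Polynomial.X, Polynomial.X])
      (Polynomial.eval₂RingHom (Polynomial.eval₂RingHom C (X 0)) (X 1))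
      (by ext <;> simp) (by
        ext i
        · simp
        · fin_cases i <;> simp)
    have hjX : ∀ i, j (X i) = ![Polynomial.C Polynomial.X, Polynomial.X] i :=
      fun i => eval₂Hom_X' _ _ i
    have hjC : ∀ c : k, j (C c) = Polynomial.C (Polynomial.C c) := fun c => eval₂Hom_C _ _ c
    let ψ : A →+* Polynomial (Polynomial k) :=
      (j.toRingHom.comp (MvPolynomial.map (Ideal.Quotient.mk (Ideal.span {p})))).comp
        e.symm.toAlgHom.toRingHom
    have hψ : ∀ P, ψ (e P) = j (MvPolynomial.map (Ideal.Quotient.mk (Ideal.span {p})) P) :=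
      fun P => congrArg
        (fun Q => j (MvPolynomial.map (Ideal.Quotient.mk (Ideal.span {p})) Q))
        (e.symm_apply_apply P)
    refine ⟨1, ψ, ?_, Or.inl rfl, ?_, ?_, ?_⟩
    · ext r
      obtain ⟨P, rfl⟩ := e.surjective r
      have hC : algebraMap K A p = e (C p) := (e.commutes p).symm
      rw [RingHom.mem_ker, hψ, map_eq_zero_iff j j.injective, ← RingHom.mem_ker,
        MvPolynomial.ker_map, Ideal.mk_ker, Ideal.map_span, Set.image_singleton, hC,
        Ideal.mem_span_singleton, Ideal.mem_span_singleton, map_dvd_iff]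
    · rw [hψ, map_X, hjX]
      simp
    · rw [hψ, map_X, hjX]
      simp
    · intro r i
      obtain ⟨P, hP⟩ := map_surjective _ Ideal.Quotient.mk_surjective
        (j.symm (Polynomial.C ((ψ r).coeff i)))
      exact ⟨e P, by rw [hψ, hP, RingEquiv.apply_symm_apply]⟩

/-- Adjoining one variable to a polynomial ring: if `A` is a quotient of the polynomial ring in
`m` variables and `A'` is the quotient of the polynomial ring in `m + 1` variables by the relations
of `A` and one further relation `r`, then `A'` is the quotient of `A[X]` by the class of `r`. -/
theorem exists_polynomial_ringHom {K : Type*} [CommRing K] {m : ℕ} {A A' : Type*} [CommRing A]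
    [Algebra K A] [CommRing A'] [Algebra K A'] (π : MvPolynomial (Fin m) K →ₐ[K] A)
    (hπ : Function.Surjective π) (π' : MvPolynomial (Fin (m + 1)) K →ₐ[K] A')
    (hπ' : Function.Surjective π') (r : MvPolynomial (Fin (m + 1)) K)
    (hker : RingHom.ker π' =
      (RingHom.ker π).map (rename (R := K) Fin.castSucc) ⊔ Ideal.span {r})
    (τ : MvPolynomial (Fin (m + 1)) K →+* Polynomial A)
    (hτ : ∀ P, τ (rename Fin.castSucc P) = Polynomial.C (π P))
    (hτ' : τ (X (Fin.last m)) = Polynomial.X) :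
    ∃ Φ : Polynomial A →+* A', Function.Surjective Φ ∧
      (∀ P, Φ (Polynomial.C (π P)) = π' (rename Fin.castSucc P)) ∧
      Φ Polynomial.X = π' (X (Fin.last m)) ∧ RingHom.ker Φ = Ideal.span {τ r} := by
  have hle : RingHom.ker (π : MvPolynomial (Fin m) K →+* A) ≤
      RingHom.ker ((π'.comp (rename Fin.castSucc) : MvPolynomial (Fin m) K →ₐ[K] A') :
        MvPolynomial (Fin m) K →+* A') := by
    intro P hP
    have : rename Fin.castSucc P ∈ RingHom.ker π' :=
      hker ▸ Ideal.mem_sup_left (Ideal.mem_map_of_mem _ hP)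
    exact this
  let j : A →+* A' := RingHom.liftOfSurjective (π : MvPolynomial (Fin m) K →+* A) hπ ⟨_, hle⟩
  have hj : ∀ P, j (π P) = π' (rename Fin.castSucc P) :=
    fun P => RingHom.liftOfRightInverse_comp_apply _ _ _ ⟨_, hle⟩ P
  let Φ : Polynomial A →+* A' := Polynomial.eval₂RingHom j (π' (X (Fin.last m)))
  have hΦC : ∀ P, Φ (Polynomial.C (π P)) = π' (rename Fin.castSucc P) := by simp [Φ, hj]
  have hΦX : Φ Polynomial.X = π' (X (Fin.last m)) := by simp [Φ]
  have hcomp : Φ.comp τ = π' := by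
    refine MvPolynomial.ringHom_ext (fun u => ?_) fun i => ?_
    · have := hτ (C u)
      rw [rename_C] at this
      rw [RingHom.comp_apply, this, hΦC, rename_C]
      rfl
    · rw [RingHom.comp_apply]
      refine Fin.lastCases ?_ (fun i => ?_) i
      · rw [hτ', hΦX]
        rfl
      · rw [← rename_X (R := K) Fin.castSucc i, hτ, hΦC]
        rfl
  have hsurj : Function.Surjective τ := by
    intro Q
    induction Q using Polynomial.induction_on' with
    | add p q hp hq =>
      obtain ⟨P, rfl⟩ := hp
      obtain ⟨Q, rfl⟩ := hq
      exact ⟨P + Q, map_add _ _ _⟩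
    | monomial k c =>
      obtain ⟨P, rfl⟩ := hπ c
      exact ⟨rename Fin.castSucc P * X (Fin.last m) ^ k, by
        rw [map_mul, map_pow, hτ, hτ', Polynomial.C_mul_X_pow_eq_monomial]⟩
  refine ⟨Φ, ?_, hΦC, hΦX, ?_⟩
  · intro y
    obtain ⟨P, rfl⟩ := hπ' y
    exact ⟨τ P, RingHom.congr_fun hcomp P⟩
  · have hcomap : (RingHom.ker Φ).comap τ = RingHom.ker π' := by
      rw [RingHom.comap_ker, hcomp]
      rfl
    rw [← Ideal.map_comap_of_surjective τ hsurj (RingHom.ker Φ), hcomap, hker, Ideal.map_sup,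
      Ideal.map_span, Set.image_singleton, sup_eq_right]
    refine le_trans ?_ bot_le
    rw [Ideal.map_le_iff_le_comap, Ideal.map_le_iff_le_comap]
    intro P hP
    rw [Ideal.mem_comap, Ideal.mem_comap, Ideal.mem_bot, hτ, RingHom.mem_ker.1 hP, map_zero]

/-- The relation `f z_{i+2} + z_{i+1}^{a_i} + z_i^{b_i}` among the generators of `A_n`. -/
noncomputable abbrev statement4Relation {K : Type*} [CommRing K] {n : ℕ} (f : K) (a b : Fin n → ℕ)
    (i : Fin n) : MvPolynomial (Fin (n + 2)) K :=
  C f * X i.succ.succ + X i.succ.castSucc ^ a i + X i.castSucc.castSucc ^ b i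

theorem span_statement4Relation_succ {K : Type*} [CommRing K] {n : ℕ} (f : K)
    (a b : Fin (n + 1) → ℕ) :
    Ideal.span (Set.range (statement4Relation f a b)) =
      (Ideal.span (Set.range
        (statement4Relation f (a ∘ Fin.castSucc) (b ∘ Fin.castSucc)))).map
          (rename (R := K) Fin.castSucc) ⊔ Ideal.span {statement4Relation f a b (Fin.last n)} := by
  rw [Ideal.map_span, ← Ideal.span_union, ← Set.range_comp]
  congr 1
  have hren : ∀ i : Fin n, rename Fin.castSucc
      (statement4Relation f (a ∘ Fin.castSucc) (b ∘ Fin.castSucc) i) =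
        statement4Relation f a b i.castSucc := fun i => by simp [statement4Relation]
  ext P
  simp only [Set.mem_range, Set.mem_union, Set.mem_singleton_iff, Function.comp_apply, hren]
  rw [Fin.exists_iff_castSucc, or_comm, eq_comm (a := P)]

theorem IsFactorialStage.of_surjective.{u} {K : Type u} [CommRing K] [IsDomain K]
    [IsNoetherianRing K] [UniqueFactorizationMonoid K] {f : K} (hf : f ≠ 0) (n : ℕ) (a b : Fin n → ℕ)
    (ha : ∀ i, 0 < a i) (hcop : ∀ i : Fin n, Nat.Coprime (a i) (∏ j ∈ Finset.Iic i, b j))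
    {A : Type u} [CommRing A] [Algebra K A] (π : MvPolynomial (Fin (n + 2)) K →ₐ[K] A)
    (hπ : Function.Surjective π)
    (hker : RingHom.ker π = Ideal.span (Set.range (statement4Relation f a b))) :
    IsFactorialStage K f (∏ j, b j) A (π (X (Fin.last n).castSucc)) (π (X (Fin.last (n + 1)))) := by
  induction n generalizing A with
  | zero =>
    have hbij : Function.Bijective π := by
      refine ⟨?_, hπ⟩
      rw [Set.range_eq_empty, Ideal.span_empty] at hker
      exact (RingHom.injective_iff_ker_eq_bot π).2 hker
    exact IsFactorialStage.of_algEquiv f (AlgEquiv.ofBijective π hbij)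
  | succ n ih =>
    have hprod : ∀ i : Fin n, ∏ j ∈ Finset.Iic i.castSucc, b j =
        ∏ j ∈ Finset.Iic i, (b ∘ Fin.castSucc) j := by
      intro i
      rw [← Fin.map_castSuccEmb_Iic, Finset.prod_map]
      rfl
    let I := Ideal.span (Set.range
      (statement4Relation f (a ∘ Fin.castSucc) (b ∘ Fin.castSucc)))
    obtain ⟨B, _, _, ρ, hρ, hρker⟩ : ∃ (B : Type u) (_ : CommRing B) (_ : Algebra K B)
        (ρ : MvPolynomial (Fin (n + 2)) K →ₐ[K] B), Function.Surjective ρ ∧ RingHom.ker ρ = I :=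
      ⟨_, _, _, Ideal.Quotient.mkₐ K I, Ideal.Quotient.mkₐ_surjective K I,
        Ideal.Quotient.mkₐ_ker K I⟩
    have hstage := ih (a ∘ Fin.castSucc) (b ∘ Fin.castSucc) (fun i => ha _)
      (fun i => by rw [← hprod]; exact hcop _) ρ hρ hρker
    have hb : ∏ j, b j = b (Fin.last n) * ∏ j, (b ∘ Fin.castSucc) j := by
      rw [Fin.prod_univ_castSucc, mul_comm]
      rfl
    have hlast := hcop (Fin.last n)
    rw [show Finset.Iic (Fin.last n) = Finset.univ from Finset.Iic_top, hb] at hlast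
    let v : Fin (n + 3) → Polynomial B :=
      Fin.lastCases (motive := fun _ => Polynomial B) Polynomial.X
        fun i => Polynomial.C (ρ (X i))
    let τ : MvPolynomial (Fin (n + 3)) K →+* Polynomial B :=
      eval₂Hom (Polynomial.C.comp (algebraMap K B)) v
    have hτ' : τ (X (Fin.last (n + 2))) = Polynomial.X := by simp [τ, v]
    have hτ : ∀ P, τ (rename Fin.castSucc P) = Polynomial.C (ρ P) := by
      have : τ.comp (rename Fin.castSucc : _ →ₐ[K] _).toRingHom =
          Polynomial.C.comp (ρ : MvPolynomial (Fin (n + 2)) K →+* B) := by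
        refine MvPolynomial.ringHom_ext (fun u => ?_) fun i => ?_
        · simp [τ]
        · simp [τ, v]
      exact RingHom.congr_fun this
    obtain ⟨Φ, hΦ, hΦC, hΦX, hΦker⟩ := exists_polynomial_ringHom ρ hρ π hπ
      (statement4Relation f a b (Fin.last n))
      (by rw [hker, hρker, span_statement4Relation_succ]) τ hτ hτ'
    have hC : ∀ u : K, ρ (C u) = algebraMap K B u := ρ.commutes
    have hrel : τ (statement4Relation f a b (Fin.last n)) =
        Polynomial.C (algebraMap K B f) * Polynomial.X + Polynomial.C
          (ρ (X (Fin.last (n + 1))) ^ a (Fin.last n) +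
            ρ (X (Fin.last n).castSucc) ^ b (Fin.last n)) := by
      have hτC := hτ (C f)
      rw [rename_C, hC] at hτC
      rw [statement4Relation, ← rename_X (R := K) Fin.castSucc, ← rename_X (R := K) Fin.castSucc]
      simp only [map_add, map_mul, map_pow, hτ, hτC, Fin.succ_last, hτ', add_assoc]
    have : IsNoetherianRing A :=
      isNoetherianRing_of_surjective _ _ (π : MvPolynomial (Fin (n + 3)) K →+* A) hπ
    have := hstage.step hf (ha _) hlast Φ hΦ
      (fun u => by rw [← hC, hΦC, rename_C]; exact π.commutes u) (hΦker.trans (by rw [hrel]))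
    rw [hΦX, hΦC, rename_X] at this
    rw [hb]
    exact this

/-- Let `K` be a noetherian UFD, `n ≥ 0`, let `K[z_0, …, z_{n+1}]` be a
polynomial ring in `n+2` variables over `K`, let `a_1, …, a_n, b_1, …, b_n` be positive
integers with `gcd(a_i, b_1 ⋯ b_i) = 1` for each `i`, and let `f ∈ K` be nonzero.  Then
`A_n := K[z_0, …, z_{n+1}]/(f z_{i+1} + z_i^{a_i} + z_{i-1}^{b_i})_{1 ≤ i ≤ n}` is a
unique factorization domain, and its fraction field is isomorphic to
`frac(K)(z_0, z_1)`, a purely transcendental extension of transcendence degree 2 of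
`frac(K)` (compatibly with the maps from `K`). -/
theorem stmt_4 {K : Type*} [CommRing K] [IsDomain K] [IsNoetherianRing K]
    [UniqueFactorizationMonoid K]
    (n : ℕ) (a b : Fin n → ℕ)
    (ha : ∀ i, 0 < a i) (hb : ∀ i, 0 < b i)
    (hcop : ∀ i : Fin n, Nat.Coprime (a i) (∏ j ∈ Finset.Iic i, b j))
    (f : K) (hf : f ≠ 0) :
    IsDomain (Statement4Ring K n f a b) ∧
      (∀ [IsDomain (Statement4Ring K n f a b)],
        UniqueFactorizationMonoid (Statement4Ring K n f a b)) ∧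
      ∃ e : FractionRing (Statement4Ring K n f a b) ≃+*
          FractionRing (MvPolynomial (Fin 2) K),
        ∀ x : K,
          e (algebraMap (Statement4Ring K n f a b)
              (FractionRing (Statement4Ring K n f a b))
              (Ideal.Quotient.mk _ (C x))) =
            algebraMap (MvPolynomial (Fin 2) K) (FractionRing (MvPolynomial (Fin 2) K))
              (C x) := by
  have h := IsFactorialStage.of_surjective hf n a b ha hcop (Ideal.Quotient.mkₐ K _)
    (Ideal.Quotient.mkₐ_surjective K _) (Ideal.Quotient.mkₐ_ker K _)
  exact ⟨h.isDomain, h.uniqueFactorizationMonoid, h.exists_ringEquiv⟩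
end

section
/- Let k be a field, n ≥ 0, let a > b > c_1 > ⋯ > c_n ≥ 2 be pairwise relatively prime integers, and let λ_1 = 1, λ_2, …, λ_n ∈ k* be distinct. Then the ring B = k[x, y, z_1, …, z_n]/(x^a + λ_i y^b + z_i^{c_i})_{1 ≤ i ≤ n} is a unique factorization domain, its fraction field is a purely transcendental extension of k of transcendence degree 2 (i.e., B is rational over k), and B admits a positive ℤ-grading over k. -/
set_option synthInstance.maxHeartbeats 1000000
set_option maxHeartbeats 1000000

open MvPolynomial

/-- The ring `B = k[x, y, z_1, …, z_n] / (x^a + λ_i y^b + z_i^{c_i})_{1 ≤ i ≤ n}`,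
with `x = X 0`, `y = X 1`, `z_i = X (i+1)` and relations indexed by `i : Fin n`. -/
abbrev MoriRing (k : Type*) [CommRing k] (n : ℕ) (a b : ℕ) (c : Fin n → ℕ)
    (lam : Fin n → k) :=
  MvPolynomial (Fin (n + 2)) k ⧸
    Ideal.span (Set.range fun i : Fin n =>
      (X 0 : MvPolynomial (Fin (n + 2)) k) ^ a + C (lam i) * X 1 ^ b +
        X i.succ.succ ^ c i)

/-- `B` admits a positive ℤ-grading over `k`: there is a ℤ-grading `B = ⊕ B_i` by
`k`-submodules with `B_i = 0` for `i < 0` and `B_0 = k`. -/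
def HasPositiveZGrading (k B : Type*) [CommRing k] [CommRing B] [Algebra k B] : Prop :=
  ∃ 𝒜 : ℤ → Submodule k B, Nonempty (GradedAlgebra 𝒜) ∧
    (∀ i : ℤ, i < 0 → 𝒜 i = ⊥) ∧ 𝒜 0 = 1


theorem UniqueFactorizationMonoid.of_isLocalization_closure_primes {B : Type*} [CommRing B]
    [IsDomain B] [IsNoetherianRing B] {S : Set B} (hS : ∀ s ∈ S, Prime s) (T : Type*) [CommRing T]
    [IsDomain T] [Algebra B T] [IsLocalization (Submonoid.closure S) T]
    [UniqueFactorizationMonoid T] : UniqueFactorizationMonoid B := by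
  have hM : Submonoid.closure S ≤ nonZeroDivisors B :=
    Submonoid.closure_le.2 fun s hs ↦ mem_nonZeroDivisors_of_ne_zero (hS s hs).ne_zero
  have hinj : Function.Injective (algebraMap B T) := IsLocalization.injective T hM
  rw [UniqueFactorizationMonoid.iff_exists_prime_mem_of_isPrime]
  intro P hP0 hP
  by_cases h : ∃ s ∈ S, s ∈ P
  · obtain ⟨s, hs, hsP⟩ := h
    exact ⟨s, hsP, hS s hs⟩
  push Not at h
  have hdisj : Disjoint (Submonoid.closure S : Set B) (P : Set B) := by
    rw [Set.disjoint_left]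
    intro m hm
    have : Submonoid.closure S ≤ P.primeCompl := Submonoid.closure_le.2 fun s hs ↦ h s hs
    exact this hm
  have hPT := IsLocalization.isPrime_of_isPrime_disjoint (Submonoid.closure S) T P hP hdisj
  have hPT0 : P.map (algebraMap B T) ≠ ⊥ := by
    rwa [Ne, Ideal.map_eq_bot_iff_of_injective hinj]
  obtain ⟨q, hqP, hq⟩ :=
    (UniqueFactorizationMonoid.iff_exists_prime_mem_of_isPrime.1 ‹_›) _ hPT0 hPT
  obtain ⟨⟨b₀, m₀⟩, hb₀⟩ := (IsLocalization.mem_map_algebraMap_iff (Submonoid.closure S) T).1 hqP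
  let V : Set B := {b | b ∈ P ∧ Prime (algebraMap B T b)}
  have hV : V.Nonempty := by
    refine ⟨b₀, b₀.2, ?_⟩
    rw [← hb₀]
    exact (associated_mul_unit_right q _ (IsLocalization.map_units T m₀)).prime hq
  obtain ⟨b, ⟨hbP, hb⟩, hmin⟩ := (wellFounded_dvdNotUnit (α := B)).has_min V hV
  have hb0 : b ≠ 0 := fun h0 ↦ hb.ne_zero (by simp [h0])
  have hndvd : ∀ s ∈ S, ¬ s ∣ b := by
    rintro s hs ⟨d, rfl⟩
    refine hmin d ⟨(hP.mem_or_mem hbP).resolve_left (h s hs), ?_⟩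
      ⟨right_ne_zero_of_mul hb0, s, (hS s hs).not_isUnit, mul_comm _ _⟩
    rw [map_mul] at hb
    exact (associated_unit_mul_left _ _
      (IsLocalization.map_units T ⟨s, Submonoid.subset_closure hs⟩)).prime hb
  have hcancel : ∀ m ∈ Submonoid.closure S, ∀ f, b ∣ m * f → b ∣ f := by
    intro m hm
    induction hm using Submonoid.closure_induction with
    | mem s hs =>
      rintro f ⟨d, hd⟩
      obtain ⟨d', rfl⟩ := ((hS s hs).dvd_or_dvd ⟨f, hd.symm⟩).resolve_left (hndvd s hs)
      exact ⟨d', mul_left_cancel₀ (hS s hs).ne_zero (by rw [hd]; ring)⟩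
    | one => intro f hf; simpa using hf
    | mul x y _ _ hx hy => intro f hf; exact hy f (hx _ (by rwa [← mul_assoc]))
  have hdvd : ∀ f, algebraMap B T b ∣ algebraMap B T f → b ∣ f := by
    rintro f ⟨d, hd⟩
    obtain ⟨d, m, rfl⟩ := IsLocalization.exists_mk'_eq (Submonoid.closure S) d
    refine hcancel m m.2 f ⟨d, hinj ?_⟩
    rw [map_mul, map_mul, hd, mul_left_comm, IsLocalization.mk'_spec']
  refine ⟨b, hbP, hb0, fun hu ↦ hP.ne_top (P.eq_top_of_isUnit_mem hbP hu), fun f g hfg ↦ ?_⟩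
  refine (hb.dvd_or_dvd ?_).imp (hdvd f) (hdvd g)
  rw [← map_mul]
  exact map_dvd _ hfg

theorem exists_exponents {σ : Type*} [Fintype σ] [DecidableEq σ] {e : σ → ℕ}
    (he : ∀ l, 0 < e l) (hco : Pairwise fun i j ↦ (e i).Coprime (e j)) :
    ∃ (p : σ → ℕ) (N : σ → σ → ℕ), ∀ l j, e l * N l j = p j + if l = j then 1 else 0 := by
  have key : ∀ j, ∃ p : ℕ, ∀ l, e l ∣ p + if l = j then 1 else 0 := by
    intro j
    have hc : (e j).Coprime (∏ i ∈ {j}ᶜ, e i) :=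
      Nat.Coprime.prod_right fun i hi ↦ hco (by simpa [eq_comm] using hi)
    obtain ⟨p, h1, h2⟩ := Nat.chineseRemainder hc (e j - 1) 0
    refine ⟨p, fun l ↦ ?_⟩
    split_ifs with hl
    · subst hl
      have := (h1.add_right 1)
      rw [Nat.sub_add_cancel (he l)] at this
      exact (Nat.modEq_zero_iff_dvd.1 (this.trans (by simp [Nat.ModEq])))
    · exact (Finset.dvd_prod_of_mem e (by simpa using hl)).trans (Nat.modEq_zero_iff_dvd.1 h2)
  choose p hp using key
  choose N hN using fun l j ↦ hp j l
  exact ⟨p, N, fun l j ↦ (hN l j).symm⟩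

theorem linearIndepOn_of_eq_C_mul_X_pow {k ι : Type*} [Field k] {s : Set ι}
    {v : ι → Polynomial (Polynomial k)} (f : ι → Polynomial k) (d : ι → ℕ)
    (hv : ∀ i ∈ s, v i = Polynomial.C (f i) * Polynomial.X ^ d i) (hf : ∀ i ∈ s, f i ≠ 0)
    (hinj : s.InjOn fun i ↦ (d i, (f i).natDegree)) : LinearIndepOn k v s := by
  classical
  rw [linearIndepOn_iff']
  intro t g ht hg
  by_contra! hne
  obtain ⟨i₁, hi₁, hgi₁⟩ := hne
  obtain ⟨i, hi, hmax⟩ := (t.filter (g · ≠ 0)).exists_max_image (fun i ↦ (f i).natDegree)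
    ⟨i₁, by simp [hi₁, hgi₁]⟩
  simp only [Finset.mem_filter] at hi hmax
  rw [Finset.sum_congr rfl fun i hi ↦ by rw [hv i (ht hi)]] at hg
  have h := congr_arg (fun P ↦ (P.coeff (d i)).coeff (f i).natDegree) hg
  simp only [Polynomial.finsetSum_coeff, Polynomial.coeff_smul, Polynomial.coeff_C_mul,
    Polynomial.coeff_X_pow, Polynomial.coeff_zero] at h
  rw [Finset.sum_eq_single i] at h
  · simp [hi.2, hf i (ht hi.1)] at h
  · intro j hj hji
    by_cases hgj : g j = 0
    · simp [hgj]
    by_cases hd : d i = d j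
    · have hlt : (f j).natDegree < (f i).natDegree :=
        lt_of_le_of_ne (hmax j ⟨hj, hgj⟩) fun h' ↦
          hji (hinj (ht hj) (ht hi.1) (by simp [hd, h']))
      simp [hd, Polynomial.coeff_eq_zero_of_natDegree_lt hlt]
    · simp [hd]
  · intro h'; exact absurd hi.1 h'

theorem exists_restrictSupport_sub_mem {k σ : Type*} [Field k] (Z : Set σ) {e : σ → ℕ}
    (he : ∀ l, 0 < e l) {J : Ideal (MvPolynomial σ k)}
    (hJ : ∀ l ∈ Z, ∃ g ∈ supported k Zᶜ, X l ^ e l - g ∈ J) (f : MvPolynomial σ k) :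
    ∃ g ∈ restrictSupport k {m : σ →₀ ℕ | ∀ l ∈ Z, m l < e l}, f - g ∈ J := by
  classical
  set M : Set (σ →₀ ℕ) := {m : σ →₀ ℕ | ∀ l ∈ Z, m l < e l}
  have hX : ∀ (i : σ) (g), g ∈ restrictSupport k M →
      ∃ g' ∈ restrictSupport k M, g * X i - g' ∈ J := by
    intro i g hg
    rw [restrictSupport_eq_span] at hg
    induction hg using Submodule.span_induction with
    | zero => exact ⟨0, zero_mem _, by simp⟩
    | add g₁ g₂ _ _ h₁ h₂ =>
      obtain ⟨g₁', h₁, h₁'⟩ := h₁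
      obtain ⟨g₂', h₂, h₂'⟩ := h₂
      exact ⟨g₁' + g₂', add_mem h₁ h₂, by convert add_mem h₁' h₂' using 1; ring⟩
    | smul a g₁ _ h₁ =>
      obtain ⟨g₁', h₁, h₁'⟩ := h₁
      refine ⟨a • g₁', Submodule.smul_mem _ a h₁, ?_⟩
      rw [smul_mul_assoc, ← smul_sub, smul_eq_C_mul]
      exact J.mul_mem_left _ h₁'
    | mem g hg =>
      obtain ⟨m, hm, rfl⟩ := hg
      by_cases hi : m + Finsupp.single i 1 ∈ M
      · refine ⟨monomial (m + Finsupp.single i 1) 1, ?_, ?_⟩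
        · rw [monomial_mem_restrictSupport]; exact Or.inl hi
        · simp [X, monomial_mul]
      · have hiZ : i ∈ Z := by
          by_contra hiZ
          refine hi fun l hl ↦ ?_
          have : i ≠ l := fun h ↦ hiZ (h ▸ hl)
          simpa [Finsupp.single_apply, this] using hm l hl
        have hie : m i + 1 = e i := by
          by_contra hne
          refine hi fun l hl ↦ ?_
          have := hm l hl
          by_cases h : i = l
          · subst h; simp; omega
          · simpa [Finsupp.single_apply, h] using hm l hl
        obtain ⟨q, hq, hqJ⟩ := hJ i hiZ
        refine ⟨monomial (m.erase i) 1 * q, ?_, ?_⟩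
        · rw [mem_restrictSupport_iff]
          intro u hu l hl
          obtain ⟨u₁, hu₁, u₂, hu₂, rfl⟩ := Finset.mem_add.1 (support_mul _ _ hu)
          have h1 : u₁ = m.erase i := by simpa using support_monomial_subset hu₁
          have h2 : u₂ l = 0 := by
            by_contra h0
            have := (mem_supported.1 hq) (mem_vars_iff_mem_support l |>.2 ⟨u₂, hu₂, by simpa using h0⟩)
            exact this hl
          subst h1
          by_cases h : l = i
          · subst h; simp [h2, he]
          · simpa [h2, h] using hm l hl
        · have : monomial m (1 : k) * X i - monomial (m.erase i) 1 * q
              = monomial (m.erase i) 1 * (X i ^ e i - q) := by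
            rw [mul_sub, X_pow_eq_monomial, monomial_mul, X, monomial_mul]
            congr 3
            ext l
            by_cases h : l = i
            · subst h; simp [hie]
            · simp [h]
          rw [this]
          exact J.mul_mem_left _ hqJ
  induction f using MvPolynomial.induction_on with
  | C a =>
    refine ⟨C a, ?_, by simp⟩
    rw [C_apply, monomial_mem_restrictSupport]
    exact Or.inl fun l _ ↦ by simpa using he l
  | add p q hp hq =>
    obtain ⟨g₁', h₁, h₁'⟩ := hp
    obtain ⟨g₂', h₂, h₂'⟩ := hq
    exact ⟨g₁' + g₂', add_mem h₁ h₂, by convert add_mem h₁' h₂' using 1; ring⟩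
  | mul_X p i hp =>
    obtain ⟨g, hg, hgJ⟩ := hp
    obtain ⟨g', hg', hgJ'⟩ := hX i g hg
    refine ⟨g', hg', ?_⟩
    convert add_mem (J.mul_mem_right (X i) hgJ) hgJ' using 1
    ring

theorem ker_eq_of_linearIndependent {k σ A : Type*} [Field k] [CommRing A] [Algebra k A]
    {Z : Set σ} {e : σ → ℕ} (he : ∀ l, 0 < e l) {J : Ideal (MvPolynomial σ k)}
    (hJ : ∀ l ∈ Z, ∃ g ∈ supported k Zᶜ, X l ^ e l - g ∈ J)
    (φ : MvPolynomial σ k →ₐ[k] A) (hφ : J ≤ RingHom.ker φ)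
    (hli : LinearIndepOn k (fun m ↦ φ (monomial m 1)) {m : σ →₀ ℕ | ∀ l ∈ Z, m l < e l}) :
    RingHom.ker φ = J := by
  refine le_antisymm (fun f hf ↦ ?_) hφ
  obtain ⟨g, hg, hfg⟩ := exists_restrictSupport_sub_mem Z he hJ f
  have h0 : φ g = 0 := by
    have := hφ hfg
    rw [RingHom.mem_ker] at this hf
    rw [map_sub, hf, zero_sub, neg_eq_zero] at this
    exact this
  have hg0 : g = 0 := by
    have hsum : ∑ m ∈ g.support, g.coeff m • φ (monomial m 1) = 0 := by
      rw [← h0]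
      conv_rhs => rw [g.as_sum, map_sum]
      refine Finset.sum_congr rfl fun m _ ↦ ?_
      rw [← map_smul, smul_monomial, smul_eq_mul, mul_one]
    ext m
    by_cases hm : m ∈ g.support
    · exact linearIndepOn_iff'.1 hli g.support (g.coeff ·) hg hsum m hm
    · simpa using hm
  simpa [hg0] using hfg

section Weights

variable {σ : Type*} [Fintype σ] [DecidableEq σ]

theorem eq_of_sum_mul_eq {m m' c : σ → ℕ} {p : σ} (hc : 0 < c p)
    (h : ∑ l, m l * c l = ∑ l, m' l * c l) (hne : ∀ l, l ≠ p → m l * c l = m' l * c l) :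
    m p = m' p := by
  rw [← Finset.add_sum_erase _ _ (Finset.mem_univ p),
    ← Finset.add_sum_erase Finset.univ (fun j ↦ m' j * _) (Finset.mem_univ p),
    Finset.sum_congr rfl fun j hj ↦ hne j (Finset.ne_of_mem_erase hj)] at h
  exact Nat.eq_of_mul_eq_mul_right hc (Nat.add_right_cancel h)

/-- The weight of the variable `X l` making all the monomials `X l ^ e l` of equal weight. -/
def coprimeWeight (e : σ → ℕ) (l : σ) : ℕ := ∏ j ∈ {l}ᶜ, e j

theorem mul_coprimeWeight (e : σ → ℕ) (l : σ) : e l * coprimeWeight e l = ∏ j, e j := by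
  rw [coprimeWeight, ← Finset.prod_singleton e l, Finset.prod_mul_prod_compl]

theorem coprimeWeight_pos {e : σ → ℕ} (he : ∀ l, 0 < e l) (l : σ) : 0 < coprimeWeight e l :=
  Finset.prod_pos fun j _ ↦ he j

theorem eq_of_sum_mul_coprimeWeight_eq {e : σ → ℕ}
    (hco : Pairwise fun i j ↦ (e i).Coprime (e j)) {m m' : σ → ℕ}
    (h : ∑ j, m j * coprimeWeight e j = ∑ j, m' j * coprimeWeight e j) {l : σ}
    (hm : m l < e l) (hm' : m' l < e l) : m l = m' l := by
  have hmod : ∀ r : σ → ℕ,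
      ∑ j, r j * coprimeWeight e j ≡ r l * coprimeWeight e l [MOD e l] := by
    intro r
    rw [← Finset.add_sum_erase _ _ (Finset.mem_univ l)]
    refine (Nat.ModEq.add_left _ (Nat.modEq_zero_iff_dvd.2 (Finset.dvd_sum fun j hj ↦ ?_)))
    exact Dvd.dvd.mul_left (Finset.dvd_prod_of_mem e (by simpa [eq_comm] using hj)) _
  have hc : (e l).Coprime (coprimeWeight e l) :=
    Nat.Coprime.prod_right fun i hi ↦ hco (by simpa [eq_comm] using hi)
  refine Nat.ModEq.eq_of_lt_of_lt ?_ hm hm'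
  refine Nat.ModEq.cancel_right_of_coprime hc ((hmod m).symm.trans ?_)
  rw [h]
  exact hmod m'

theorem exists_sum_mul_coprimeWeight_eq_one [Nonempty σ] {e : σ → ℕ}
    (hco : Pairwise fun i j ↦ (e i).Coprime (e j)) :
    ∃ γ : σ → ℤ, ∑ l, γ l * (coprimeWeight e l : ℤ) = 1 := by
  obtain ⟨γ, hγ⟩ := (exists_sum_eq_one_iff_pairwise_coprime' (s := fun l ↦ (e l : ℤ))).2
    fun i j hij ↦ Nat.isCoprime_iff_coprime.2 (hco hij)
  exact ⟨γ, by simpa [coprimeWeight] using hγ⟩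

variable {k : Type*} [Field k]

/-- The element `∏ j, τ j ^ N l j` of `k[t]` times the power of `u` given by the weight of `l`,
as an element of `k[t][u]`. -/
noncomputable def weightedParam (e : σ → ℕ) (N : σ → σ → ℕ) (τ : σ → Polynomial k) (l : σ) :
    Polynomial (Polynomial k) :=
  Polynomial.C (∏ j, τ j ^ N l j) * Polynomial.X ^ coprimeWeight e l

theorem weightedParam_ne_zero (e : σ → ℕ) (N : σ → σ → ℕ) {τ : σ → Polynomial k}
    (hτ : ∀ j, τ j ≠ 0) (l : σ) : weightedParam e N τ l ≠ 0 :=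
  mul_ne_zero (by simpa [Finset.prod_eq_zero_iff] using fun j h ↦ absurd h (hτ j))
    (pow_ne_zero _ Polynomial.X_ne_zero)

theorem weightedParam_pow {e p : σ → ℕ} {N : σ → σ → ℕ}
    (hN : ∀ l j, e l * N l j = p j + if l = j then 1 else 0) (τ : σ → Polynomial k) (l : σ) :
    weightedParam e N τ l ^ e l = Polynomial.C (τ l) *
      (Polynomial.C (∏ j, τ j ^ p j) * Polynomial.X ^ ∏ j, e j) := by
  rw [weightedParam, mul_pow, ← pow_mul, mul_comm _ (e l), mul_coprimeWeight, ← map_pow,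
    ← Finset.prod_pow, ← mul_assoc, ← map_mul]
  congr 2
  simp_rw [← pow_mul, mul_comm _ (e l), hN, pow_add, Finset.prod_mul_distrib]
  rw [mul_comm]
  congr 1
  simp [pow_ite]

theorem prod_weightedParam_pow (e : σ → ℕ) (N : σ → σ → ℕ) (τ : σ → Polynomial k)
    (m : σ → ℕ) : ∏ l, weightedParam e N τ l ^ m l =
      Polynomial.C (∏ l, (∏ j, τ j ^ N l j) ^ m l) *
        Polynomial.X ^ ∑ l, m l * coprimeWeight e l := by
  simp_rw [weightedParam, mul_pow, Finset.prod_mul_distrib, map_prod, map_pow, ← pow_mul,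
    Finset.prod_pow_eq_pow_sum, map_prod, map_pow, mul_comm]

theorem isPrime_of_binomial_relations {e : σ → ℕ} (he : ∀ l, 0 < e l)
    (hco : Pairwise fun i j ↦ (e i).Coprime (e j)) {p q : σ} (hpq : p ≠ q) {μ : σ → k}
    (hμ : ∀ l, μ l ≠ 0) {J : Ideal (MvPolynomial σ k)} (hq : X q ∈ J)
    (hJ : ∀ l, l ≠ p → l ≠ q → X l ^ e l - C (μ l) * X p ^ e p ∈ J)
    (hmin : ∀ I : Ideal (MvPolynomial σ k), X q ∈ I →
      (∀ l, l ≠ p → l ≠ q → X l ^ e l - C (μ l) * X p ^ e p ∈ I) → J ≤ I) :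
    J.IsPrime := by
  obtain ⟨r, N, hN⟩ := exists_exponents he hco
  let τ : σ → Polynomial k := fun l ↦ if l = p then 1 else Polynomial.C (μ l)
  have hτ : ∀ l, τ l ≠ 0 := by
    intro l
    by_cases h : l = p <;> simp [τ, h, hμ]
  let φ : MvPolynomial σ k →ₐ[k] Polynomial (Polynomial k) :=
    aeval fun l ↦ if l = q then 0 else weightedParam e N τ l
  let e' : σ → ℕ := Function.update e q 1
  have he' : ∀ l, 0 < e' l := by
    intro l
    by_cases h : l = q
    · subst h; simp [e']
    · simpa [e', h] using he l
  have hle : ∀ l, e' l ≤ e l := by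
    intro l
    by_cases h : l = q
    · subst h; simpa [e'] using Nat.succ_le_of_lt (he _)
    · simp [e', h]
  have hφ : J ≤ RingHom.ker φ := by
    refine hmin _ (by simp [φ, RingHom.mem_ker]) fun l hlp hlq ↦ ?_
    have h1 : φ (X l ^ e l) = weightedParam e N τ l ^ e l := by simp [φ, hlq]
    have h2 : φ (X p ^ e p) = weightedParam e N τ p ^ e p := by simp [φ, hpq]
    have h3 : φ (C (μ l)) = Polynomial.C (Polynomial.C (μ l)) := by
      simp [φ, algHom_C]
    rw [RingHom.mem_ker, map_sub, map_mul, h1, h2, h3, weightedParam_pow hN, weightedParam_pow hN]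
    simp [τ, hlp]
  have hker := ker_eq_of_linearIndependent (Z := {p}ᶜ) he' (J := J) (fun l hl ↦ ?_) φ hφ ?_
  · rw [← hker]
    exact RingHom.ker_isPrime _
  · by_cases h : l = q
    · subst h
      exact ⟨0, zero_mem _, by simpa [e'] using hq⟩
    · refine ⟨C (μ l) * X p ^ e p, ?_, by simpa [e', h] using hJ l hl h⟩
      rw [compl_compl]
      refine mul_mem (Subalgebra.algebraMap_mem _ (μ l)) (pow_mem ?_ _)
      exact X_mem_supported.2 rfl
  · have hmono : ∀ m ∈ {m : σ →₀ ℕ | ∀ l ∈ ({p}ᶜ : Set σ), m l < e' l}, φ (monomial m 1) =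
        Polynomial.C (∏ l, (∏ j, τ j ^ N l j) ^ m l) *
          Polynomial.X ^ ∑ l, m l * coprimeWeight e l := by
      intro m hm
      rw [← prod_weightedParam_pow]
      simp only [φ, aeval_monomial, map_one, one_mul]
      rw [Finsupp.prod_fintype _ _ (by simp)]
      refine Finset.prod_congr rfl fun l _ ↦ ?_
      split_ifs with h
      · have : m l = 0 := by simpa [h, e'] using hm q hpq.symm
        simp [this]
      · rfl
    refine linearIndepOn_of_eq_C_mul_X_pow _ _ hmono (fun m _ ↦ ?_)
      fun m hm m' hm' hmm ↦ ?_
    · exact Finset.prod_ne_zero_iff.2 fun l _ ↦ pow_ne_zero _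
        (Finset.prod_ne_zero_iff.2 fun j _ ↦ pow_ne_zero _ (hτ j))
    · have hd := congr_arg Prod.fst hmm
      have hne : ∀ l, l ≠ p → m l = m' l := fun l hl ↦
        eq_of_sum_mul_coprimeWeight_eq hco hd ((hm l hl).trans_le (hle l))
          ((hm' l hl).trans_le (hle l))
      ext l
      by_cases h : l = p
      · subst h
        exact eq_of_sum_mul_eq (coprimeWeight_pos he l) hd fun j hj ↦ by rw [hne j hj]
      · exact hne l h

end Weights

section Parametrization

variable {σ k : Type*} [Field k]

/-- The ideal generated by `X x ^ e x + lam l * X y ^ e y + X l ^ e l` for `l ≠ x, y`. -/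
noncomputable def trinomialIdeal (e : σ → ℕ) (lam : σ → k) (x y : σ) : Ideal (MvPolynomial σ k) :=
  Ideal.span ((fun l ↦ X x ^ e x + C (lam l) * X y ^ e y + X l ^ e l) '' {x, y}ᶜ)

theorem trinomial_mem (e : σ → ℕ) (lam : σ → k) {x y l : σ} (hx : l ≠ x) (hy : l ≠ y) :
    X x ^ e x + C (lam l) * X y ^ e y + X l ^ e l ∈ trinomialIdeal e lam x y :=
  Ideal.subset_span ⟨l, by simp [hx, hy], rfl⟩

theorem trinomialIdeal_le {e : σ → ℕ} {lam : σ → k} {x y : σ} {I : Ideal (MvPolynomial σ k)}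
    (h : ∀ l, l ≠ x → l ≠ y → X x ^ e x + C (lam l) * X y ^ e y + X l ^ e l ∈ I) :
    trinomialIdeal e lam x y ≤ I := by
  refine Ideal.span_le.2 ?_
  rintro _ ⟨l, hl, rfl⟩
  simp only [Set.mem_compl_iff, Set.mem_insert_iff, Set.mem_singleton_iff, not_or] at hl
  exact h l hl.1 hl.2

variable [DecidableEq σ]

/-- The polynomials `x ^ a / y ^ b` and `z ^ c / y ^ b` in the parameter `t = x ^ a / y ^ b`. -/
noncomputable def trinomialRatio (lam : σ → k) (x y l : σ) : Polynomial k :=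
  if l = x then Polynomial.X else if l = y then 1 else -(Polynomial.X + Polynomial.C (lam l))

theorem natDegree_trinomialRatio (lam : σ → k) {x y : σ} (hxy : x ≠ y) (l : σ) :
    (trinomialRatio lam x y l).natDegree = if l = y then 0 else 1 := by
  unfold trinomialRatio
  by_cases hx : l = x
  · simp [hx, hxy]
  · by_cases hy : l = y <;> simp [hx, hy, hxy.symm, -neg_add_rev]

theorem trinomialRatio_ne_zero (lam : σ → k) (x y l : σ) : trinomialRatio lam x y l ≠ 0 := by
  unfold trinomialRatio
  split_ifs
  · exact Polynomial.X_ne_zero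
  · exact one_ne_zero
  · exact neg_ne_zero.2 (Polynomial.X_add_C_ne_zero _)

variable [Fintype σ]

theorem ker_aeval_weightedParam {e p : σ → ℕ} {N : σ → σ → ℕ} (he : ∀ l, 0 < e l)
    (hco : Pairwise fun i j ↦ (e i).Coprime (e j))
    (hN : ∀ l j, e l * N l j = p j + if l = j then 1 else 0) {x y : σ} (hxy : x ≠ y)
    (lam : σ → k) :
    RingHom.ker (aeval (R := k) (weightedParam e N (trinomialRatio lam x y))) =
      trinomialIdeal e lam x y := by
  set τ := trinomialRatio lam x y with hτdef
  have hτ : ∀ l, τ l ≠ 0 := trinomialRatio_ne_zero lam x y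
  refine ker_eq_of_linearIndependent (Z := {x, y}ᶜ) he (fun l hl ↦ ?_) _ ?_ ?_
  · simp only [Set.mem_compl_iff, Set.mem_insert_iff, Set.mem_singleton_iff, not_or] at hl
    refine ⟨-(X x ^ e x + C (lam l) * X y ^ e y), ?_, ?_⟩
    · rw [compl_compl]
      exact neg_mem (add_mem (pow_mem (X_mem_supported.2 (by simp)) _)
        (mul_mem (Subalgebra.algebraMap_mem _ (lam l)) (pow_mem (X_mem_supported.2 (by simp)) _)))
    · convert trinomial_mem e lam hl.1 hl.2 using 1
      ring
  · refine trinomialIdeal_le fun l hlx hly ↦ ?_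
    rw [RingHom.mem_ker]
    simp only [map_add, map_mul, map_pow, aeval_X, algHom_C, weightedParam_pow hN]
    simp only [hτdef, trinomialRatio, if_pos, if_neg hxy.symm, if_neg hlx, if_neg hly,
      Polynomial.algebraMap_apply, Algebra.algebraMap_self_apply, map_neg, map_add, map_one]
    ring
  · refine linearIndepOn_of_eq_C_mul_X_pow (fun m ↦ ∏ l, (∏ j, τ j ^ N l j) ^ m l)
      (fun m ↦ ∑ l, m l * coprimeWeight e l) (fun m _ ↦ ?_) (fun m _ ↦ ?_)
      fun m hm m' hm' hmm ↦ ?_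
    · rw [← prod_weightedParam_pow]
      simp only [aeval_monomial, map_one, one_mul]
      exact Finsupp.prod_fintype _ _ (by simp)
    · exact Finset.prod_ne_zero_iff.2 fun l _ ↦ pow_ne_zero _
        (Finset.prod_ne_zero_iff.2 fun j _ ↦ pow_ne_zero _ (hτ j))
    · let D : σ → ℕ := fun l ↦ if l = y then 0 else 1
      have hdeg : ∀ m : σ →₀ ℕ, (∏ l, (∏ j, τ j ^ N l j) ^ m l).natDegree =
          ∑ l, m l * ∑ j, N l j * D j := by
        intro m
        rw [Polynomial.natDegree_prod _ _ fun l _ ↦ pow_ne_zero _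
          (Finset.prod_ne_zero_iff.2 fun j _ ↦ pow_ne_zero _ (hτ j))]
        refine Finset.sum_congr rfl fun l _ ↦ ?_
        rw [Polynomial.natDegree_pow, Polynomial.natDegree_prod _ _ fun j _ ↦
          pow_ne_zero _ (hτ j)]
        simp only [Polynomial.natDegree_pow, hτdef, natDegree_trinomialRatio lam hxy, D]
      have hQ : ∀ l, e l * ∑ j, N l j * D j = ∑ j, p j * D j + D l := by
        intro l
        simp_rw [Finset.mul_sum, ← mul_assoc, hN, add_mul, Finset.sum_add_distrib]
        simp
      have hE : ∀ m : σ →₀ ℕ, (∏ j, e j) * ∑ l, m l * ∑ j, N l j * D j =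
          (∑ j, p j * D j) * ∑ l, m l * coprimeWeight e l +
            ∑ l, m l * (coprimeWeight e l * D l) := by
        intro m
        rw [Finset.mul_sum, Finset.mul_sum, ← Finset.sum_add_distrib]
        refine Finset.sum_congr rfl fun l _ ↦ ?_
        rw [← mul_coprimeWeight e l]
        linear_combination (m l * coprimeWeight e l) * hQ l
      have hu : ∑ l, m l * coprimeWeight e l = ∑ l, m' l * coprimeWeight e l :=
        congr_arg Prod.fst hmm
      have ht : ∑ l, m l * (coprimeWeight e l * D l) =
          ∑ l, m' l * (coprimeWeight e l * D l) := by
        have := congr_arg Prod.snd hmm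
        simp only [hdeg] at this
        have h1 := hE m
        rw [this, hE m', hu] at h1
        exact (Nat.add_left_cancel h1).symm
      have hz : ∀ l, l ≠ x → l ≠ y → m l = m' l := fun l hlx hly ↦
        eq_of_sum_mul_coprimeWeight_eq hco hu (hm l (by simp [hlx, hly]))
          (hm' l (by simp [hlx, hly]))
      have hx : m x = m' x := by
        refine eq_of_sum_mul_eq (c := fun l ↦ coprimeWeight e l * D l)
          (by simpa [D, hxy] using coprimeWeight_pos he x) ht fun l hl ↦ ?_
        by_cases hly : l = y
        · simp [D, hly]
        · rw [hz l hl hly]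
      have hy : m y = m' y := by
        refine eq_of_sum_mul_eq (coprimeWeight_pos he y) hu fun l hl ↦ ?_
        by_cases hlx : l = x
        · rw [hlx, hx]
        · rw [hz l hlx hl]
      ext l
      by_cases hlx : l = x
      · rw [hlx, hx]
      by_cases hly : l = y
      · rw [hly, hy]
      exact hz l hlx hly

theorem exists_mul_aeval_weightedParam_eq {e p : σ → ℕ} {N : σ → σ → ℕ}
    (hco : Pairwise fun i j ↦ (e i).Coprime (e j))
    (hN : ∀ l j, e l * N l j = p j + if l = j then 1 else 0) {x y : σ} (hxy : x ≠ y)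
    (lam : σ → k) (f : Polynomial (Polynomial k)) :
    ∃ m ∈ Submonoid.closure (Set.range (X : σ → MvPolynomial σ k)), ∃ g,
      f * aeval (R := k) (weightedParam e N (trinomialRatio lam x y)) m =
        aeval (R := k) (weightedParam e N (trinomialRatio lam x y)) g := by
  set τ := trinomialRatio lam x y with hτdef
  have hτ : ∀ l, τ l ≠ 0 := trinomialRatio_ne_zero lam x y
  set φ := aeval (R := k) (weightedParam e N τ) with hφ
  set M := Submonoid.closure (Set.range (X : σ → MvPolynomial σ k))
  let K := FractionRing (Polynomial (Polynomial k))
  let ι : Polynomial (Polynomial k) →+* K := algebraMap _ _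
  have hι : Function.Injective ι := IsFractionRing.injective _ K
  have hφX : ∀ l, φ (X l) = weightedParam e N τ l := fun l ↦ aeval_X _ l
  have hφM : ∀ m ∈ M, φ m ≠ 0 := by
    intro m hm
    induction hm using Submonoid.closure_induction with
    | mem m hm =>
      obtain ⟨l, rfl⟩ := hm
      rw [hφX]
      exact weightedParam_ne_zero e N hτ l
    | one => simp
    | mul a b _ _ ha hb => rw [map_mul]; exact mul_ne_zero ha hb
  let G : Subgroup Kˣ :=
    { carrier := {u | ∃ m ∈ M, ∃ m' ∈ M, (u : K) * ι (φ m) = ι (φ m')}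
      one_mem' := ⟨1, one_mem _, 1, one_mem _, by simp⟩
      mul_mem' := by
        rintro u v ⟨m, hm, m', hm', h⟩ ⟨n, hn, n', hn', h'⟩
        refine ⟨m * n, mul_mem hm hn, m' * n', mul_mem hm' hn', ?_⟩
        simp only [Units.val_mul, map_mul, ← h, ← h']
        ring
      inv_mem' := by
        rintro u ⟨m, hm, m', hm', h⟩
        exact ⟨m', hm', m, hm, by rw [← h, Units.inv_mul_cancel_left]⟩ }
  have hunit : ∀ {f}, f ≠ 0 → ι f ≠ 0 := fun {f} hf ↦ by rwa [Ne, map_eq_zero_iff ι hι]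
  let v : σ → Kˣ := fun l ↦ Units.mk0 (ι (φ (X l))) (hunit (hφM _ (Submonoid.subset_closure ⟨l, rfl⟩)))
  have hv : ∀ l, v l ∈ G := fun l ↦
    ⟨1, one_mem _, X l, Submonoid.subset_closure ⟨l, rfl⟩, by simp [v]⟩
  let t : σ → Kˣ := fun l ↦ Units.mk0 (ι (Polynomial.C (τ l)))
    (hunit (Polynomial.C_ne_zero.2 (hτ l)))
  let u : Kˣ := Units.mk0 (ι Polynomial.X) (hunit Polynomial.X_ne_zero)
  have ht : ∀ l, t l ∈ G := by
    intro l
    have : t l = v l ^ e l / v y ^ e y := by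
      rw [eq_div_iff_mul_eq']
      ext
      simp only [v, t, Units.val_mul, Units.val_pow_eq_pow_val, Units.val_mk0, ← map_pow,
        ← map_mul]
      simp only [map_pow, hφX, weightedParam_pow hN]
      simp only [hτdef, trinomialRatio, if_pos, if_neg hxy.symm]
      simp only [map_one, one_mul, mul_comm]
    rw [this]
    exact div_mem (pow_mem (hv l) _) (pow_mem (hv y) _)
  have huw : ∀ l, u ^ coprimeWeight e l ∈ G := by
    intro l
    have : u ^ coprimeWeight e l = v l / ∏ j, t j ^ N l j := by
      rw [eq_div_iff_mul_eq']
      ext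
      simp only [v, t, u, Units.val_mul, Units.val_pow_eq_pow_val, Units.val_mk0,
        Units.coe_prod, hφX, weightedParam, map_prod, map_pow, map_mul]
      rw [mul_comm]
    rw [this]
    exact div_mem (hv l) (prod_mem fun j _ ↦ pow_mem (ht j) _)
  have hu : u ∈ G := by
    have : Nonempty σ := ⟨x⟩
    obtain ⟨γ, hγ⟩ := exists_sum_mul_coprimeWeight_eq_one hco
    have hsum : ∀ s : Finset σ, u ^ ∑ l ∈ s, γ l * (coprimeWeight e l : ℤ) ∈ G := by
      intro s
      induction s using Finset.induction_on with
      | empty => simp [one_mem]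
      | insert l s hl ih =>
        rw [Finset.sum_insert hl, zpow_add, mul_comm (γ l), zpow_mul, zpow_natCast]
        exact mul_mem (zpow_mem (huw l) _) ih
    simpa [hγ] using hsum Finset.univ
  have key : ∀ w ∈ G, ∀ f, (w : K) = ι f → ∃ m ∈ M, ∃ g, f * φ m = φ g := by
    rintro w ⟨m, hm, m', _, h⟩ f hf
    refine ⟨m, hm, m', hι ?_⟩
    rw [map_mul, ← hf, h]
  let H : Subalgebra k (Polynomial (Polynomial k)) :=
    { carrier := {f | ∃ m ∈ M, ∃ g, f * φ m = φ g}
      mul_mem' := by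
        rintro f f' ⟨m, hm, g, h⟩ ⟨m', hm', g', h'⟩
        exact ⟨m * m', mul_mem hm hm', g * g', by
          rw [map_mul, map_mul, ← h, ← h']; ring⟩
      add_mem' := by
        rintro f f' ⟨m, hm, g, h⟩ ⟨m', hm', g', h'⟩
        refine ⟨m * m', mul_mem hm hm', g * m' + g' * m, ?_⟩
        rw [map_mul, map_add, map_mul, map_mul, ← h, ← h']
        ring
      algebraMap_mem' := fun r ↦ ⟨1, one_mem _, C r, by simp [hφ, algHom_C]⟩ }
  have hHX : Polynomial.X ∈ H := key u hu _ rfl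
  have hHt : Polynomial.C Polynomial.X ∈ H := key (t x) (ht x) _ (by simp [t, hτdef, trinomialRatio])
  have hHC : ∀ c : Polynomial k, Polynomial.C c ∈ H := by
    intro c
    induction c using Polynomial.induction_on' with
    | add a b ha hb => rw [map_add]; exact add_mem ha hb
    | monomial n a =>
      rw [← Polynomial.C_mul_X_pow_eq_monomial, map_mul, map_pow]
      exact mul_mem (H.algebraMap_mem a) (pow_mem hHt n)
  change f ∈ H
  induction f using Polynomial.induction_on' with
  | add a b ha hb => exact add_mem ha hb
  | monomial n a =>
    rw [← Polynomial.C_mul_X_pow_eq_monomial]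
    exact mul_mem (hHC a) (pow_mem hHX n)

end Parametrization

section Birational

variable {B A : Type*} [CommRing B] [CommRing A] {ψ : B →+* A} {M : Submonoid B}

theorem IsLocalization.of_map_of_injective (hψ : Function.Injective ψ)
    (hM : M.map ψ ≤ nonZeroDivisors A) (hfrac : ∀ f : A, ∃ m ∈ M, ∃ g, f * ψ m = ψ g)
    (L : Type*) [CommRing L] [Algebra A L] [IsLocalization (M.map ψ) L] [Algebra B L]
    (halg : algebraMap B L = (algebraMap A L).comp ψ) : IsLocalization M L where
  map_units m := by
    rw [halg]
    exact IsLocalization.map_units L (⟨ψ m, m, m.2, rfl⟩ : M.map ψ)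
  surj z := by
    obtain ⟨f, ⟨_, m, hm, rfl⟩, rfl⟩ := IsLocalization.exists_mk'_eq (M.map ψ) z
    obtain ⟨m', hm', g, hg⟩ := hfrac f
    refine ⟨(g, ⟨m * m', mul_mem hm hm'⟩), ?_⟩
    simp only [halg, RingHom.comp_apply, map_mul, ← hg]
    rw [← mul_assoc]
    congr 1
    exact IsLocalization.mk'_spec L f (⟨ψ m, m, hm, rfl⟩ : M.map ψ)
  exists_of_eq {a b} h := by
    rw [halg] at h
    exact ⟨1, by rw [hψ (IsLocalization.injective L hM h)]⟩

theorem IsFractionRing.of_injective [IsDomain A] (hψ : Function.Injective ψ)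
    (hM : M.map ψ ≤ nonZeroDivisors A) (hfrac : ∀ f : A, ∃ m ∈ M, ∃ g, f * ψ m = ψ g)
    (K : Type*) [Field K] [Algebra A K] [IsFractionRing A K] [Algebra B K]
    (halg : algebraMap B K = (algebraMap A K).comp ψ) : IsFractionRing B K := by
  have hB : IsDomain B := hψ.isDomain ψ
  have hinj : Function.Injective (algebraMap B K) := by
    rw [halg]
    exact (IsFractionRing.injective A K).comp hψ
  have hunit : ∀ b ∈ nonZeroDivisors B, IsUnit (algebraMap B K b) := fun b hb ↦
    isUnit_iff_ne_zero.2 ((map_ne_zero_iff _ hinj).2 (nonZeroDivisors.ne_zero hb))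
  refine ⟨⟨fun b ↦ hunit b b.2, fun z ↦ ?_, fun {a b} h ↦ ⟨1, by rw [hinj h]⟩⟩⟩
  obtain ⟨f, f', hf', rfl⟩ := IsFractionRing.div_surjective A z
  obtain ⟨m, hm, g, hg⟩ := hfrac f
  obtain ⟨m', hm', g', hg'⟩ := hfrac f'
  have hf0 : algebraMap A K f' ≠ 0 :=
    (map_ne_zero_iff _ (IsFractionRing.injective A K)).2 (nonZeroDivisors.ne_zero hf')
  have hψM : ∀ m ∈ M, ψ m ≠ 0 := fun m hm ↦ nonZeroDivisors.ne_zero (hM ⟨m, hm, rfl⟩)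
  have hg0 : g' * m ≠ 0 := by
    refine fun h ↦ mul_ne_zero (mul_ne_zero (nonZeroDivisors.ne_zero hf') (hψM m' hm'))
      (hψM m hm) ?_
    rw [hg', ← map_mul, h, map_zero]
  refine ⟨(g * m', ⟨g' * m, mem_nonZeroDivisors_of_ne_zero hg0⟩), ?_⟩
  simp only [halg, RingHom.comp_apply, map_mul, ← hg, ← hg']
  field_simp

theorem UniqueFactorizationMonoid.of_birational [IsDomain A] [UniqueFactorizationMonoid A]
    [IsNoetherianRing B] [IsDomain B] {S : Set B} (hS : ∀ s ∈ S, Prime s)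
    (hψ : Function.Injective ψ)
    (hfrac : ∀ f : A, ∃ m ∈ Submonoid.closure S, ∃ g, f * ψ m = ψ g) :
    UniqueFactorizationMonoid B := by
  have hM : (Submonoid.closure S).map ψ ≤ nonZeroDivisors A := by
    rw [Submonoid.map_le_iff_le_comap, Submonoid.closure_le]
    exact fun s hs ↦ mem_nonZeroDivisors_of_ne_zero ((map_ne_zero_iff ψ hψ).2 (hS s hs).ne_zero)
  let T := Localization ((Submonoid.closure S).map ψ)
  have : IsDomain T := IsLocalization.isDomain_localization hM
  let : Algebra B T := ((algebraMap A T).comp ψ).toAlgebra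
  have : IsLocalization (Submonoid.closure S) T :=
    IsLocalization.of_map_of_injective hψ hM hfrac T rfl
  exact UniqueFactorizationMonoid.of_isLocalization_closure_primes hS T

end Birational

section TrinomialRing

theorem Ideal.Quotient.prime_mk_of_isPrime_sup {R : Type*} [CommRing R] {I : Ideal R} {r : R}
    (hr : r ∉ I) (h : (I ⊔ Ideal.span {r}).IsPrime) : Prime (Ideal.Quotient.mk I r) := by
  rw [← Ideal.span_singleton_prime (by rwa [Ne, Ideal.Quotient.eq_zero_iff_mem])]
  have := Ideal.map_isPrime_of_surjective (f := Ideal.Quotient.mk I) Ideal.Quotient.mk_surjective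
    (I := I ⊔ Ideal.span {r}) (by simp [Ideal.mk_ker])
  rwa [Ideal.map_sup, Ideal.map_quotient_self, bot_sup_eq, Ideal.map_span,
    Set.image_singleton] at this

variable {σ k : Type*} [Fintype σ] [DecidableEq σ] [Field k] {e : σ → ℕ}

theorem isPrime_trinomialIdeal_sup_span_X (he : ∀ l, 0 < e l)
    (hco : Pairwise fun i j ↦ (e i).Coprime (e j)) {x y : σ} (hxy : x ≠ y) {lam : σ → k}
    (hlam : ∀ l, l ≠ x → l ≠ y → lam l ≠ 0) (hinj : Set.InjOn lam {x, y}ᶜ) (q : σ) :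
    (trinomialIdeal e lam x y ⊔ Ideal.span {X q}).IsPrime := by
  set J := trinomialIdeal e lam x y ⊔ Ideal.span {X q}
  have hqJ : X q ∈ J := Ideal.mem_sup_right (Ideal.mem_span_singleton_self _)
  have hrel : ∀ l, l ≠ x → l ≠ y → X x ^ e x + C (lam l) * X y ^ e y + X l ^ e l ∈ J :=
    fun l hx hy ↦ Ideal.mem_sup_left (trinomial_mem e lam hx hy)
  have hle : ∀ I : Ideal (MvPolynomial σ k), X q ∈ I →
      (∀ l, l ≠ x → l ≠ y → X x ^ e x + C (lam l) * X y ^ e y + X l ^ e l ∈ I) → J ≤ I :=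
    fun I hq h ↦ sup_le (trinomialIdeal_le h) ((Ideal.span_singleton_le_iff_mem I).2 hq)
  have hpow : ∀ I : Ideal (MvPolynomial σ k), X q ∈ I → X q ^ e q ∈ I :=
    fun I hq ↦ I.pow_mem_of_mem hq _ (he q)
  by_cases hqx : q = x
  · subst hqx
    refine isPrime_of_binomial_relations he hco hxy.symm
      (μ := fun l ↦ if l = q ∨ l = y then 1 else -lam l) (fun l ↦ ?_) hqJ (fun l hy hx ↦ ?_)
      fun I hI h ↦ hle I hI fun l hx hy ↦ ?_
    · by_cases h : l = q ∨ l = y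
      · simp [h]
      · rw [if_neg h]
        push Not at h
        exact neg_ne_zero.2 (hlam l h.1 h.2)
    · convert sub_mem (hrel l hx hy) (hpow J hqJ) using 1
      simp only [hx, hy, or_self, if_false, map_neg]
      ring
    · convert add_mem (h l hy hx) (hpow I hI) using 1
      simp only [hx, hy, or_self, if_false, map_neg]
      ring
  by_cases hqy : q = y
  · subst hqy
    refine isPrime_of_binomial_relations he hco hxy (μ := fun _ ↦ -1) (by simp) hqJ
      (fun l hx hy ↦ ?_) fun I hI h ↦ hle I hI fun l hx hy ↦ ?_
    · convert sub_mem (hrel l hx hy) (J.mul_mem_left (C (lam l)) (hpow J hqJ)) using 1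
      simp only [map_neg, map_one]
      ring
    · convert add_mem (h l hx hy) (I.mul_mem_left (C (lam l)) (hpow I hI)) using 1
      simp only [map_neg, map_one]
      ring
  · have hxJ : X x ^ e x + C (lam q) * X y ^ e y ∈ J := by
      simpa using sub_mem (hrel q hqx hqy) (hpow J hqJ)
    refine isPrime_of_binomial_relations he hco (Ne.symm hqy) (μ := fun l ↦ if l = x then -lam q
        else if l = y ∨ l = q then 1 else lam q - lam l) (fun l ↦ ?_) hqJ (fun l hy hq ↦ ?_)
      fun I hI h ↦ ?_
    · split_ifs with h1 h2
      · exact neg_ne_zero.2 (hlam q hqx hqy)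
      · exact one_ne_zero
      · push Not at h2
        exact sub_ne_zero.2 fun h ↦ h2.2 (hinj (by simp [hqx, hqy]) (by simp [h1, h2]) h).symm
    · by_cases hx : l = x
      · subst hx
        simpa using hxJ
      · convert sub_mem (hrel l hx hy) hxJ using 1
        simp only [hx, hy, hq, or_self, if_false, map_sub]
        ring
    · have hxI := h x hxy (Ne.symm hqx)
      simp only [if_true, map_neg] at hxI
      refine hle I hI fun l hx hy ↦ ?_
      by_cases hq : l = q
      · subst hq
        convert add_mem hxI (hpow I hI) using 1
        ring
      · convert add_mem hxI (h l hy hq) using 1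
        simp only [hx, hy, hq, or_self, if_false, map_sub]
        ring

/-- The parametrization of the trinomial ring by `t = x ^ a / y ^ b` and a variable `u` of
weight one. -/
theorem exists_injective_trinomialRing_algHom (he : ∀ l, 0 < e l)
    (hco : Pairwise fun i j ↦ (e i).Coprime (e j)) {x y : σ} (hxy : x ≠ y) (lam : σ → k) :
    ∃ ψ : (MvPolynomial σ k ⧸ trinomialIdeal e lam x y) →ₐ[k] Polynomial (Polynomial k),
      Function.Injective ψ ∧
      (∀ l, ∃ c ≠ 0, ψ (Ideal.Quotient.mk _ (X l)) =
        Polynomial.C c * Polynomial.X ^ coprimeWeight e l) ∧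
      ∀ f, ∃ m ∈ Submonoid.closure (Set.range fun l ↦
        Ideal.Quotient.mk (trinomialIdeal e lam x y) (X l)), ∃ g, f * ψ m = ψ g := by
  obtain ⟨p, N, hN⟩ := exists_exponents he hco
  have hker := ker_aeval_weightedParam he hco hN hxy lam
  set φ := aeval (R := k) (weightedParam e N (trinomialRatio lam x y))
  refine ⟨Ideal.Quotient.liftₐ _ φ fun a ha ↦ by rwa [← hker] at ha, ?_, fun l ↦ ?_, fun f ↦ ?_⟩
  · rw [injective_iff_map_eq_zero]
    intro b
    obtain ⟨b, rfl⟩ := Ideal.Quotient.mk_surjective b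
    intro hb
    rw [Ideal.Quotient.eq_zero_iff_mem, ← hker]
    exact hb
  · refine ⟨∏ j, trinomialRatio lam x y j ^ N l j, ?_, ?_⟩
    · exact Finset.prod_ne_zero_iff.2 fun j _ ↦ pow_ne_zero _ (trinomialRatio_ne_zero lam x y j)
    · exact aeval_X _ l
  · obtain ⟨m, hm, g, h⟩ := exists_mul_aeval_weightedParam_eq hco hN hxy lam f
    refine ⟨Ideal.Quotient.mk _ m, ?_, Ideal.Quotient.mk _ g, h⟩
    have := Submonoid.mem_map_of_mem (Ideal.Quotient.mk (trinomialIdeal e lam x y)) hm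
    rwa [MonoidHom.map_mclosure, ← Set.range_comp] at this

theorem isDomain_trinomialRing (he : ∀ l, 0 < e l)
    (hco : Pairwise fun i j ↦ (e i).Coprime (e j)) {x y : σ} (hxy : x ≠ y) (lam : σ → k) :
    IsDomain (MvPolynomial σ k ⧸ trinomialIdeal e lam x y) := by
  obtain ⟨ψ, hψ, -⟩ := exists_injective_trinomialRing_algHom he hco hxy lam
  exact hψ.isDomain ψ.toRingHom

theorem uniqueFactorizationMonoid_trinomialRing (he : ∀ l, 0 < e l)
    (hco : Pairwise fun i j ↦ (e i).Coprime (e j)) {x y : σ} (hxy : x ≠ y) {lam : σ → k}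
    (hlam : ∀ l, l ≠ x → l ≠ y → lam l ≠ 0) (hinj : Set.InjOn lam {x, y}ᶜ)
    [IsDomain (MvPolynomial σ k ⧸ trinomialIdeal e lam x y)] :
    UniqueFactorizationMonoid (MvPolynomial σ k ⧸ trinomialIdeal e lam x y) := by
  obtain ⟨ψ, hψ, hX, hfrac⟩ := exists_injective_trinomialRing_algHom he hco hxy lam
  refine UniqueFactorizationMonoid.of_birational (ψ := ψ.toRingHom) ?_ hψ hfrac
  rintro _ ⟨q, rfl⟩
  refine Ideal.Quotient.prime_mk_of_isPrime_sup (fun hq ↦ ?_)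
    (isPrime_trinomialIdeal_sup_span_X he hco hxy hlam hinj q)
  obtain ⟨c, hc, h⟩ := hX q
  rw [Ideal.Quotient.eq_zero_iff_mem.2 hq, map_zero] at h
  exact mul_ne_zero (Polynomial.C_ne_zero.2 hc) (pow_ne_zero _ Polynomial.X_ne_zero) h.symm

theorem exists_fractionRing_trinomialRing_equiv (he : ∀ l, 0 < e l)
    (hco : Pairwise fun i j ↦ (e i).Coprime (e j)) {x y : σ} (hxy : x ≠ y) (lam : σ → k) :
    ∃ E : FractionRing (MvPolynomial σ k ⧸ trinomialIdeal e lam x y) ≃+*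
        FractionRing (MvPolynomial (Fin 2) k),
      ∀ r : k, E (algebraMap _ _ (Ideal.Quotient.mk (trinomialIdeal e lam x y) (C r))) =
        algebraMap _ _ (C r : MvPolynomial (Fin 2) k) := by
  obtain ⟨ψ, hψ, hX, hfrac⟩ := exists_injective_trinomialRing_algHom he hco hxy lam
  let θ : Polynomial (Polynomial k) ≃ₐ[k] MvPolynomial (Fin 2) k :=
    ((finSuccEquiv k 1).trans (Polynomial.mapAlgEquiv (uniqueAlgEquiv k (Fin 1)))).symm
  let K := FractionRing (MvPolynomial (Fin 2) k)
  let Ψ : (MvPolynomial σ k ⧸ trinomialIdeal e lam x y) →ₐ[k] MvPolynomial (Fin 2) k :=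
    (θ : _ →ₐ[k] _).comp ψ
  have hΨ : Function.Injective Ψ := θ.injective.comp hψ
  let : Algebra (MvPolynomial σ k ⧸ trinomialIdeal e lam x y) K :=
    ((algebraMap _ K).comp Ψ.toRingHom).toAlgebra
  have : IsFractionRing (MvPolynomial σ k ⧸ trinomialIdeal e lam x y) K := by
    refine IsFractionRing.of_injective (ψ := Ψ.toRingHom) (M := Submonoid.closure (Set.range fun l ↦
        Ideal.Quotient.mk (trinomialIdeal e lam x y) (X l))) hΨ ?_ (fun f ↦ ?_) K rfl
    · rw [Submonoid.map_le_iff_le_comap, Submonoid.closure_le]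
      rintro _ ⟨l, rfl⟩
      refine mem_nonZeroDivisors_of_ne_zero ?_
      obtain ⟨c, hc, h⟩ := hX l
      refine (map_ne_zero_iff θ θ.injective).2 ?_
      change ψ _ ≠ 0
      rw [h]
      exact mul_ne_zero (Polynomial.C_ne_zero.2 hc) (pow_ne_zero _ Polynomial.X_ne_zero)
    · obtain ⟨m, hm, g, h⟩ := hfrac (θ.symm f)
      refine ⟨m, hm, g, ?_⟩
      have := congr_arg θ h
      rwa [map_mul, θ.apply_symm_apply] at this
  refine ⟨(FractionRing.algEquiv (MvPolynomial σ k ⧸ trinomialIdeal e lam x y) K).toRingEquiv,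
    fun r ↦ ?_⟩
  refine (AlgEquiv.commutes (FractionRing.algEquiv
    (MvPolynomial σ k ⧸ trinomialIdeal e lam x y) K) _).trans ?_
  exact congr_arg (algebraMap _ K) (Ψ.commutes r)


theorem hasPositiveZGrading_trinomialRing (he : ∀ l, 0 < e l)
    (hco : Pairwise fun i j ↦ (e i).Coprime (e j)) {x y : σ} (hxy : x ≠ y) (lam : σ → k) :
    HasPositiveZGrading k (MvPolynomial σ k ⧸ trinomialIdeal e lam x y) := by
  obtain ⟨ψ, hψ, hX, -⟩ := exists_injective_trinomialRing_algHom he hco hxy lam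
  choose c _ hX using hX
  let mon : (σ →₀ ℕ) → MvPolynomial σ k ⧸ trinomialIdeal e lam x y :=
    fun m ↦ Ideal.Quotient.mk _ (monomial m 1)
  let deg : (σ →₀ ℕ) → ℕ := fun m ↦ ∑ l, m l * coprimeWeight e l
  let 𝒜 : ℤ → Submodule k (MvPolynomial σ k ⧸ trinomialIdeal e lam x y) :=
    fun i ↦ Submodule.span k (mon '' {m | (deg m : ℤ) = i})
  have hψmon : ∀ m, ψ (mon m) =
      Polynomial.C (∏ l, c l ^ m l) * Polynomial.X ^ deg m := by
    intro m
    have : mon m = ∏ l, Ideal.Quotient.mk _ (X l) ^ m l := by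
      simp only [mon, monomial_eq, map_one, one_mul]
      rw [Finsupp.prod_fintype _ _ (by simp), map_prod]
      simp only [map_pow]
    simp only [this, map_prod, map_pow, hX, mul_pow, Finset.prod_mul_distrib, ← pow_mul,
      Finset.prod_pow_eq_pow_sum, deg, mul_comm]
  have hcoeff : ∀ (i : ℤ) (n : ℕ), (n : ℤ) ≠ i → ∀ b ∈ 𝒜 i, (ψ b).coeff n = 0 := by
    intro i n hn b hb
    induction hb using Submodule.span_induction with
    | mem b hb =>
      obtain ⟨m, rfl, rfl⟩ := hb
      rw [hψmon, Polynomial.coeff_C_mul_X_pow, if_neg (by exact_mod_cast hn)]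
    | zero => simp
    | add b b' _ _ h h' => rw [map_add, Polynomial.coeff_add, h, h', add_zero]
    | smul a b _ h => rw [map_smul, Polynomial.coeff_smul, h, smul_zero]
  have hmul : ∀ m m', mon m * mon m' = mon (m + m') := by
    intro m m'
    simp only [mon, ← map_mul, monomial_mul, one_mul]
  have hgraded : SetLike.GradedMonoid 𝒜 :=
    { one_mem := Submodule.subset_span ⟨0, by simp [deg], rfl⟩
      mul_mem := by
        intro i j b b' hb hb'
        have := Submodule.mul_mem_mul hb hb'
        rw [Submodule.span_mul_span] at this
        refine Submodule.span_mono ?_ this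
        rintro _ ⟨_, ⟨m, rfl, rfl⟩, _, ⟨m', rfl, rfl⟩, rfl⟩
        refine ⟨m + m', ?_, (hmul m m').symm⟩
        simp [deg, add_mul, Finset.sum_add_distrib] }
  have hint : DirectSum.IsInternal 𝒜 := by
    rw [DirectSum.isInternal_submodule_iff_iSupIndep_and_iSup_eq_top]
    constructor
    · intro i
      rw [Submodule.disjoint_def]
      intro b hb hb'
      refine (injective_iff_map_eq_zero ψ).1 hψ b (Polynomial.ext fun n ↦ ?_)
      rw [Polynomial.coeff_zero]
      by_cases hn : (n : ℤ) = i
      · let L := ((Polynomial.lcoeff (Polynomial k) n).restrictScalars k).comp ψ.toLinearMap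
        have hL : ⨆ j, ⨆ (_ : j ≠ i), 𝒜 j ≤ LinearMap.ker L :=
          iSup₂_le fun j hj b hb ↦ hcoeff j n (fun h ↦ hj (h ▸ hn)) b hb
        exact hL hb'
      · exact hcoeff i n hn b hb
    · rw [eq_top_iff]
      rintro b -
      obtain ⟨f, rfl⟩ := Ideal.Quotient.mk_surjective b
      rw [f.as_sum, map_sum]
      refine sum_mem fun m _ ↦ Submodule.mem_iSup_of_mem (deg m : ℤ) ?_
      have : Ideal.Quotient.mk (trinomialIdeal e lam x y) (monomial m (f.coeff m)) =
          f.coeff m • mon m := by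
        have hsmul : monomial m (f.coeff m) = f.coeff m • monomial m (1 : k) := by
          rw [smul_monomial, smul_eq_mul, mul_one]
        rw [hsmul]
        rfl
      rw [this]
      exact Submodule.smul_mem _ _ (Submodule.subset_span ⟨m, rfl, rfl⟩)
  refine ⟨𝒜, ⟨{ hgraded, hint.chooseDecomposition with }⟩, fun i hi ↦ ?_, le_antisymm ?_ ?_⟩
  · rw [Submodule.span_eq_bot]
    rintro _ ⟨m, rfl, -⟩
    exact absurd hi (by simp)
  · refine Submodule.span_le.2 ?_
    rintro _ ⟨m, hm, rfl⟩
    have hm0 : m = 0 := by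
      have hd : deg m = 0 := by exact_mod_cast hm
      ext l
      have := Finset.sum_eq_zero_iff.1 hd l (Finset.mem_univ l)
      exact (mul_eq_zero.1 this).resolve_right (coprimeWeight_pos he l).ne'
    subst hm0
    exact Submodule.one_le.1 le_rfl
  · exact Submodule.one_le.2 hgraded.one_mem

theorem trinomialRing_factorial_rational_graded (he : ∀ l, 0 < e l)
    (hco : Pairwise fun i j ↦ (e i).Coprime (e j)) {x y : σ} (hxy : x ≠ y) {lam : σ → k}
    (hlam : ∀ l, l ≠ x → l ≠ y → lam l ≠ 0) (hinj : Set.InjOn lam {x, y}ᶜ)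
    {I : Ideal (MvPolynomial σ k)} (hI : I = trinomialIdeal e lam x y) :
    IsDomain (MvPolynomial σ k ⧸ I) ∧
      (∀ [IsDomain (MvPolynomial σ k ⧸ I)], UniqueFactorizationMonoid (MvPolynomial σ k ⧸ I)) ∧
      (∃ E : FractionRing (MvPolynomial σ k ⧸ I) ≃+* FractionRing (MvPolynomial (Fin 2) k),
        ∀ r : k, E (algebraMap (MvPolynomial σ k ⧸ I) (FractionRing (MvPolynomial σ k ⧸ I))
            (Ideal.Quotient.mk _ (C r))) =
          algebraMap (MvPolynomial (Fin 2) k) (FractionRing (MvPolynomial (Fin 2) k)) (C r)) ∧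
      HasPositiveZGrading k (MvPolynomial σ k ⧸ I) := by
  subst hI
  exact ⟨isDomain_trinomialRing he hco hxy lam,
    uniqueFactorizationMonoid_trinomialRing he hco hxy hlam hinj,
    exists_fractionRing_trinomialRing_equiv he hco hxy lam,
    hasPositiveZGrading_trinomialRing he hco hxy lam⟩

end TrinomialRing

theorem pairwise_coprime_cons {n : ℕ} {e : Fin n → ℕ} {a : ℕ} (ha : ∀ i, a.Coprime (e i))
    (he : Pairwise fun i j ↦ (e i).Coprime (e j)) :
    Pairwise fun i j ↦ ((Fin.cons a e : Fin (n + 1) → ℕ) i).Coprime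
      ((Fin.cons a e : Fin (n + 1) → ℕ) j) := by
  intro i j hij
  induction i using Fin.cases with
  | zero =>
    induction j using Fin.cases with
    | zero => exact absurd rfl hij
    | succ j => simpa using ha j
  | succ i =>
    induction j using Fin.cases with
    | zero => simpa using (ha i).symm
    | succ j => simpa using he fun h ↦ hij (by rw [h])

/-- Let `k` be a field, `n ≥ 0`, let `a > b > c_1 > ⋯ > c_n ≥ 2` be
pairwise relatively prime integers, and let `λ_1 = 1, λ_2, …, λ_n ∈ k*` be distinct.
Then `B = k[x, y, z_1, …, z_n]/(x^a + λ_i y^b + z_i^{c_i})_{1 ≤ i ≤ n}` is a unique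
factorization domain, its fraction field is a purely transcendental extension of `k` of
transcendence degree 2 (i.e. `B` is rational over `k`), and `B` admits a positive
ℤ-grading over `k`. -/
theorem stmt_13 {k : Type*} [Field k]
    (n : ℕ) (a b : ℕ) (c : Fin n → ℕ) (lam : Fin n → k)
    (hba : b < a) (hcb : ∀ i, c i < b) (hmono : StrictAnti c) (hc2 : ∀ i, 2 ≤ c i)
    (hab : Nat.Coprime a b) (hac : ∀ i, Nat.Coprime a (c i))
    (hbc : ∀ i, Nat.Coprime b (c i))
    (hcc : ∀ i j : Fin n, i ≠ j → Nat.Coprime (c i) (c j))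
    (hlam1 : ∀ i : Fin n, (i : ℕ) = 0 → lam i = 1)
    (hlam0 : ∀ i, lam i ≠ 0) (hlaminj : Function.Injective lam) :
    IsDomain (MoriRing k n a b c lam) ∧
      (∀ [IsDomain (MoriRing k n a b c lam)],
        UniqueFactorizationMonoid (MoriRing k n a b c lam)) ∧
      (∃ e : FractionRing (MoriRing k n a b c lam) ≃+* FractionRing (MvPolynomial (Fin 2) k),
        ∀ x : k,
          e (algebraMap (MoriRing k n a b c lam) (FractionRing (MoriRing k n a b c lam))
              (Ideal.Quotient.mk _ (C x))) =
            algebraMap (MvPolynomial (Fin 2) k) (FractionRing (MvPolynomial (Fin 2) k))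
              (C x)) ∧
      HasPositiveZGrading k (MoriRing k n a b c lam) := by
  have hcompl : ∀ l : Fin (n + 2), l ≠ 0 → l ≠ 1 → ∃ i : Fin n, l = i.succ.succ := by
    intro l h0 h1
    obtain ⟨l, rfl⟩ := Fin.exists_succ_eq.2 h0
    obtain ⟨l, rfl⟩ := Fin.exists_succ_eq.2 (fun h : l = 0 ↦ h1 (by simp [h]))
    exact ⟨l, rfl⟩
  have h01 : (0 : Fin (n + 2)) ≠ 1 := by simp
  rcases Nat.eq_zero_or_pos n with rfl | hn
  · refine trinomialRing_factorial_rational_graded (e := fun _ ↦ 1) (lam := fun _ ↦ 1)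
      (by simp) (fun _ _ _ ↦ by simp) h01 (by simp) (fun l hl ↦ ?_) ?_
    · simp only [Set.mem_compl_iff, Set.mem_insert_iff, Set.mem_singleton_iff, not_or] at hl
      exact (hcompl l hl.1 hl.2).choose.elim0
    · rw [Set.range_eq_empty, Ideal.span_empty]
      exact (le_bot_iff.1 (trinomialIdeal_le fun l hx hy ↦ (hcompl l hx hy).choose.elim0)).symm
  · have hb : 0 < b := (Nat.zero_le _).trans_lt (hcb ⟨0, hn⟩)
    let e : Fin (n + 2) → ℕ := Fin.cons a (Fin.cons b c)
    let lam' : Fin (n + 2) → k := Fin.cons 0 (Fin.cons 0 lam)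
    have he : ∀ l, 0 < e l := by
      refine Fin.cases (hb.trans hba) (Fin.cases hb fun i ↦ ?_)
      exact two_pos.trans_le (hc2 i)
    refine trinomialRing_factorial_rational_graded (e := e) (lam := lam') he ?_ h01
      (fun l hx hy ↦ ?_) (fun l hl l' hl' h ↦ ?_) (le_antisymm (Ideal.span_le.2 ?_)
        (trinomialIdeal_le fun l hx hy ↦ ?_))
    · exact pairwise_coprime_cons (Fin.cases hab hac)
        (pairwise_coprime_cons hbc fun i j hij ↦ hcc i j hij)
    · obtain ⟨i, rfl⟩ := hcompl l hx hy
      exact hlam0 i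
    · simp only [Set.mem_compl_iff, Set.mem_insert_iff, Set.mem_singleton_iff, not_or] at hl hl'
      obtain ⟨i, rfl⟩ := hcompl l hl.1 hl.2
      obtain ⟨j, rfl⟩ := hcompl l' hl'.1 hl'.2
      have hij : i = j := hlaminj h
      rw [hij]
    · rintro _ ⟨i, rfl⟩
      exact trinomial_mem e lam' (l := i.succ.succ) (x := 0) (y := 1) (Fin.succ_ne_zero _)
        fun h ↦ Fin.succ_ne_zero i (Fin.succ_injective _ h)
    · obtain ⟨i, rfl⟩ := hcompl l hx hy
      exact Ideal.subset_span ⟨i, rfl⟩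
end
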